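/- (Scalar curvature lower bound, 2-dimensional conformal version of Chen's estimate.) For every δ ∈ (0,1) there exists C = C(δ) > 0 with the following property. Let T > 0, let (𝓜, u) be a conformal Ricci flow spacetime in the ambient space ℂ × (0,T), let [t₁,t₂] ⊆ (0,T), and let γ : [t₁,t₂] → ℂ be a C¹ map with (γ(t),t) ∈ 𝓜 for all t ∈ [t₁,t₂]. Suppose there are constants r₀, K > 0 and A ≥ 2 + 24 r₀⁻² t₂ such that: (i) for every t ∈ [t₁,t₂] the ball B_{g(t)}(γ(t), A r₀) has compact closure contained in 𝓜_t; (ii) for every t ∈ [t₁,t₂] the Gaussian curvature satisfies K_{g(t)} = −(Δ log u)(·,t)/(2u(·,t)) ≤ r₀⁻² on B_{g(t)}(γ(t), r₀); (iii) the scalar curvature satisfies R_{g(t₁)} = −(Δ log u)(·,t₁)/u(·,t₁) ≥ −K on B_{g(t₁)}(γ(t₁), A r₀); (iv) √(u(γ(t),t))·|γ′(t)| ≤ r₀⁻¹ for every t ∈ [t₁,t₂]. Then for every t ∈ [t₁,t₂] and every z ∈ B_{g(t)}(γ(t), 3Ar₀/4) one has R_{g(t)}(z) := −(Δ log u)(z,t)/u(z,t)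 ≥ min{ −1/((1−δ)(t−t₁) + 1/K), −C/(A² r₀²) }. -/

import Mathlib

open Set MeasureTheory Filter Metric

/-- The Euclidean Laplacian of `f : ℂ → ℝ` at `z`, i.e. `∂²f/∂x² + ∂²f/∂y²`. -/
noncomputable def lap (f : ℂ → ℝ) (z : ℂ) : ℝ :=
  iteratedFDeriv ℝ 2 f z ![1, 1] + iteratedFDeriv ℝ 2 f z ![Complex.I, Complex.I]

/-- The time-timeSlice of a spacetime `M ⊆ ℂ × ℝ` at time `t`. -/
def timeSlice (M : Set (ℂ × ℝ)) (t : ℝ) : Set ℂ := {z | (z, t) ∈ M}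

/-- The conformal distance on `Ω` induced by a conformal factor `v`: the infimum of
`v`-lengths of `C¹` paths in `Ω` joining `x` to `y`. -/
noncomputable def confDist (v : ℂ → ℝ) (Ω : Set ℂ) (x y : ℂ) : ℝ :=
  sInf {L : ℝ | ∃ γ : ℝ → ℂ, ContDiffOn ℝ 1 γ (Icc 0 1) ∧
    (∀ s ∈ Icc (0:ℝ) 1, γ s ∈ Ω) ∧ γ 0 = x ∧ γ 1 = y ∧
    L = ∫ s in (0:ℝ)..1, Real.sqrt (v (γ s)) * ‖derivWithin γ (Icc 0 1) s‖}

/-- The conformal ball of centre `p` and radius `ρ` in `Ω` for the metric `v|dz|²`. -/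
def confBall (v : ℂ → ℝ) (Ω : Set ℂ) (p : ℂ) (ρ : ℝ) : Set ℂ :=
  {z ∈ connectedComponentIn Ω p | confDist v Ω p z < ρ}

/-- The conformal metric `v|dz|²` is complete on `Ω`: every connected component of `Ω` is a
complete metric space with respect to the induced distance `confDist v Ω`. -/
def ConfComplete (v : ℂ → ℝ) (Ω : Set ℂ) : Prop :=
  ∀ x₀ ∈ Ω, ∀ x : ℕ → ℂ, (∀ n, x n ∈ connectedComponentIn Ω x₀) →
    (∀ ε : ℝ, 0 < ε → ∃ N : ℕ, ∀ m ≥ N, ∀ n ≥ N, confDist v Ω (x m) (x n) < ε) →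
    ∃ l ∈ connectedComponentIn Ω x₀,
      Tendsto (fun n => confDist v Ω (x n) l) atTop (nhds 0)

/-- A conformal Ricci flow spacetime in the ambient space `ℂ × (0,T)`:
`M` is a connected open subset of `ℂ × (0,T)` with non-empty time-slices, and `u` is a smooth
positive conformal factor on `M` solving the logarithmic fast diffusion equation
`∂u/∂t = Δ log u`. -/
structure ConfRFS (T : ℝ) (M : Set (ℂ × ℝ)) (u : ℂ → ℝ → ℝ) : Prop where
  sub : M ⊆ {p : ℂ × ℝ | p.2 ∈ Ioo 0 T}
  opn : IsOpen M
  conn : IsConnected M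
  nonempty : ∀ t ∈ Ioo (0:ℝ) T, (timeSlice M t).Nonempty
  pos : ∀ p ∈ M, 0 < u p.1 p.2
  smooth : ContDiffOn ℝ (⊤ : ℕ∞) (fun p : ℂ × ℝ => u p.1 p.2) M
  lfde : ∀ p ∈ M, deriv (u p.1) p.2 = lap (fun z => Real.log (u z p.2)) p.1

/-- A conformal Ricci flow spacetime is complete if the metric `u(·,t)|dz|²` is complete on the
timeSlice `M_t` for every `t ∈ (0,T)`. -/
def ConfRFSComplete (T : ℝ) (M : Set (ℂ × ℝ)) (u : ℂ → ℝ → ℝ) : Prop :=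
  ∀ t ∈ Ioo (0:ℝ) T, ConfComplete (fun z => u z t) (timeSlice M t)

/-- There is a time-preserving path in `M` from time `s` to the point `(z,t)`. -/
def TimePreservingFrom (M : Set (ℂ × ℝ)) (s : ℝ) (z : ℂ) (t : ℝ) : Prop :=
  ∃ γ : ℝ → ℂ, ContinuousOn γ (Icc s t) ∧ (∀ r ∈ Icc s t, (γ r, r) ∈ M) ∧ γ t = z

/-- The hindsight function of a spacetime `M`. -/
noncomputable def hindsight (M : Set (ℂ × ℝ)) (z : ℂ) (t : ℝ) : ℝ :=
  sInf {s : ℝ | 0 < s ∧ s ≤ t ∧ TimePreservingFrom M s z t}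

/-- A spacetime is initially determined if its hindsight function vanishes identically. -/
def InitiallyDetermined (M : Set (ℂ × ℝ)) : Prop :=
  ∀ p ∈ M, hindsight M p.1 p.2 = 0

/-- A spacetime in `ℂ × (0,T)` is expanding if worldlines persist until the final time. -/
def Expanding (T : ℝ) (M : Set (ℂ × ℝ)) : Prop :=
  ∀ (z : ℂ) (t t' : ℝ), (z, t) ∈ M → t ≤ t' → t' < T → (z, t') ∈ M

/-- An expanding spacetime is continuous if each timeSlice is the interior of the intersection of
all later slices. -/
def ContinuousSpacetime (T : ℝ) (M : Set (ℂ × ℝ)) : Prop :=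
  ∀ s ∈ Ioo (0:ℝ) T, timeSlice M s = interior (⋂ t ∈ Ioo s T, timeSlice M t)

/-- The vanishing time of the point `(z,t)`: the supremum of the connected component containing
`t` of the set of times at which `z` belongs to the spacetime. -/
noncomputable def vanishTime (M : Set (ℂ × ℝ)) (z : ℂ) (t : ℝ) : ℝ :=
  sSup (connectedComponentIn {r : ℝ | (z, r) ∈ M} t)

/-- There is a `C¹` curve in `Ω`, parametrised by the whole line, whose restriction to `[0,1]`
joins `x` to `y` and has `v`-length `L`. -/
def C1Joined (v : ℂ → ℝ) (Ω : Set ℂ) (x y : ℂ) (L : ℝ) : Prop :=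
  ∃ c : ℝ → ℂ, ContDiff ℝ 1 c ∧ (∀ s, c s ∈ Ω) ∧ c 0 = x ∧ c 1 = y ∧
    ∫ s in (0:ℝ)..1, Real.sqrt (v (c s)) * ‖deriv c s‖ = L

lemma reparametrize {v : ℂ → ℝ} {Ω : Set ℂ} (hv : ContinuousOn v Ω) {a b : ℝ} (hab : a < b)
    {c : ℝ → ℂ} (hc : ContDiffOn ℝ 1 c (Icc a b)) (hcΩ : ∀ s ∈ Icc a b, c s ∈ Ω)
    {g : ℝ → ℝ} (hg : ContDiff ℝ 1 g) (hmono : Monotone g) (hgm : ∀ s, g s ∈ Icc a b) :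
    ContDiff ℝ 1 (c ∘ g) ∧
    ∀ p q, ∫ s in p..q, Real.sqrt (v ((c ∘ g) s)) * ‖deriv (c ∘ g) s‖ =
      ∫ s in (g p)..(g q), Real.sqrt (v (c s)) * ‖derivWithin c (Icc a b) s‖ := by
  have h1 : ContDiff ℝ 1 (c ∘ g) := by
    rw [← contDiffOn_univ]
    exact hc.comp hg.contDiffOn (fun s _ => hgm s)
  have hgd : ∀ s, HasDerivAt g (deriv g s) s := fun s =>
    (hg.differentiable one_ne_zero s).hasDerivAt
  have h2 : ∀ s, deriv (c ∘ g) s = deriv g s • derivWithin c (Icc a b) (g s) := by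
    intro s
    have hd : HasDerivWithinAt c (derivWithin c (Icc a b) (g s)) (Icc a b) (g s) :=
      (hc.differentiableOn one_ne_zero (g s) (hgm s)).hasDerivWithinAt
    have := HasDerivWithinAt.scomp s hd (hgd s).hasDerivWithinAt
      (s := univ) (fun s _ => hgm s)
    exact (hasDerivWithinAt_univ.1 this).deriv
  refine ⟨h1, fun p q => ?_⟩
  have hcont : ContinuousOn (fun s => Real.sqrt (v (c s)) * ‖derivWithin c (Icc a b) s‖)
      (Icc a b) := by
    refine ContinuousOn.mul (Real.continuous_sqrt.comp_continuousOn
      (hv.comp hc.continuousOn (fun s hs => hcΩ s hs))) ?_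
    exact (hc.continuousOn_derivWithin (uniqueDiffOn_Icc hab) le_rfl).norm
  rw [← intervalIntegral.integral_comp_mul_deriv'' (f := g) (f' := deriv g)]
  · congr 1
    ext s
    have : 0 ≤ deriv g s := hmono.deriv_nonneg
    simp only [Function.comp, h2] at *
    rw [norm_smul, Real.norm_of_nonneg this]
    ring
  · exact hg.continuous.continuousOn
  · exact fun x _ => (hgd x).hasDerivWithinAt
  · exact (hg.continuous_deriv le_rfl).continuousOn
  · exact hcont.mono (by rintro _ ⟨s, _, rfl⟩; exact hgm s)

lemma smoothTransition_mem (x : ℝ) : Real.smoothTransition x ∈ Icc (0:ℝ) 1 :=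
  ⟨Real.smoothTransition.nonneg x, Real.smoothTransition.le_one x⟩

lemma C1Joined.refl {v : ℂ → ℝ} {Ω : Set ℂ} {x : ℂ} (hx : x ∈ Ω) : C1Joined v Ω x x 0 :=
  ⟨fun _ => x, contDiff_const, fun _ => hx, rfl, rfl, by simp⟩

lemma C1Joined.of_Icc {v : ℂ → ℝ} {Ω : Set ℂ} (hv : ContinuousOn v Ω) {a b : ℝ} (hab : a ≤ b)
    {c : ℝ → ℂ} (hc : ContDiffOn ℝ 1 c (Icc a b)) (hcΩ : ∀ s ∈ Icc a b, c s ∈ Ω) :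
    C1Joined v Ω (c a) (c b)
      (∫ s in a..b, Real.sqrt (v (c s)) * ‖derivWithin c (Icc a b) s‖) := by
  rcases hab.eq_or_lt with rfl | hab
  · rw [intervalIntegral.integral_same]
    exact C1Joined.refl (hcΩ a (by simp))
  · set g : ℝ → ℝ := fun s => a + (b - a) * Real.smoothTransition s with hg
    have hgc : ContDiff ℝ 1 g :=
      contDiff_const.add (contDiff_const.mul Real.smoothTransition.contDiff)
    have hgm : ∀ s, g s ∈ Icc a b := by
      intro s
      have := smoothTransition_mem s
      constructor
      · have := mul_nonneg (sub_nonneg.2 hab.le) this.1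
        simp only [hg]; linarith
      · have := mul_le_mul_of_nonneg_left this.2 (sub_nonneg.2 hab.le)
        simp only [hg]; linarith
    have hmono : Monotone g := fun s t hst => by
      have := mul_le_mul_of_nonneg_left (Real.smoothTransition.monotone hst)
        (sub_nonneg.2 hab.le)
      simp only [hg]; linarith
    obtain ⟨h1, h2⟩ := reparametrize hv hab hc hcΩ hgc hmono hgm
    have g0 : g 0 = a := by simp [hg]
    have g1 : g 1 = b := by simp [hg]
    refine ⟨c ∘ g, h1, fun s => hcΩ _ (hgm s), by simp [g0], by simp [g1], ?_⟩
    rw [h2, g0, g1]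

lemma C1Joined.trans {v : ℂ → ℝ} {Ω : Set ℂ} (hv : ContinuousOn v Ω) {x y z : ℂ} {L L' : ℝ}
    (h : C1Joined v Ω x y L) (h' : C1Joined v Ω y z L') : C1Joined v Ω x z (L + L') := by
  obtain ⟨c, hc, hcΩ, c0, c1, hL⟩ := h
  obtain ⟨d, hd, hdΩ, d0, d1, hL'⟩ := h'
  have key : ∀ (e : ℝ → ℂ), ContDiff ℝ 1 e → (∀ s, e s ∈ Ω) → ∀ k : ℝ,
      ContDiff ℝ 1 (e ∘ fun s => Real.smoothTransition (2 * s - k)) ∧ ∀ p q,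
      ∫ s in p..q, Real.sqrt (v ((e ∘ fun s => Real.smoothTransition (2 * s - k)) s)) *
        ‖deriv (e ∘ fun s => Real.smoothTransition (2 * s - k)) s‖ =
      ∫ s in (Real.smoothTransition (2 * p - k))..(Real.smoothTransition (2 * q - k)),
        Real.sqrt (v (e s)) * ‖deriv e s‖ := by
    intro e he heΩ k
    obtain ⟨h1, h2⟩ := reparametrize hv one_pos he.contDiffOn (fun s _ => heΩ s)
      (g := fun s => Real.smoothTransition (2 * s - k))
      (Real.smoothTransition.contDiff.comp
        ((contDiff_const.mul contDiff_id).sub contDiff_const))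
      (fun s t hst => Real.smoothTransition.monotone (by linarith))
      (fun s => smoothTransition_mem _)
    refine ⟨h1, fun p q => ?_⟩
    rw [h2]
    refine intervalIntegral.integral_congr fun s hs => ?_
    have hs' : s ∈ Icc (0:ℝ) 1 :=
      (uIcc_subset_Icc (smoothTransition_mem _) (smoothTransition_mem _)) hs
    rw [(he.differentiable one_ne_zero s).derivWithin (uniqueDiffOn_Icc one_pos s hs')]
  obtain ⟨e1, i1⟩ := key c hc hcΩ 0
  obtain ⟨e2, i2⟩ := key d hd hdΩ 1
  set f1 := c ∘ fun s => Real.smoothTransition (2 * s - 0) with hf1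
  set f2 := d ∘ fun s => Real.smoothTransition (2 * s - 1) with hf2
  have l1 : ∀ s, s ≤ 1 / 2 → f1 s + f2 s - y = f1 s := by
    intro s hs
    have : f2 s = y := by
      simp only [hf2, Function.comp]
      rw [Real.smoothTransition.zero_of_nonpos (by linarith), d0]
    rw [this]; ring
  have l2 : ∀ s, 1 / 2 ≤ s → f1 s + f2 s - y = f2 s := by
    intro s hs
    have : f1 s = y := by
      simp only [hf1, Function.comp]
      rw [Real.smoothTransition.one_of_one_le (by linarith), c1]
    rw [this]; ring
  have hC : ContDiff ℝ 1 (fun s => f1 s + f2 s - y) := (e1.add e2).sub contDiff_const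
  have hmem : ∀ s, f1 s + f2 s - y ∈ Ω := by
    intro s
    rcases le_total s (1/2) with hs | hs
    · rw [l1 s hs]; exact hcΩ _
    · rw [l2 s hs]; exact hdΩ _
  refine ⟨fun s => f1 s + f2 s - y, hC, hmem, ?_, ?_, ?_⟩
  · simp only
    rw [l1 0 (by norm_num)]; simp [hf1, c0]
  · simp only
    rw [l2 1 (by norm_num)]
    simp only [hf2, Function.comp]
    rw [Real.smoothTransition.one_of_one_le (by norm_num), d1]
  · have hint : ∀ p q : ℝ, IntervalIntegrable (fun s => Real.sqrt (v (f1 s + f2 s - y)) *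
        ‖deriv (fun s => f1 s + f2 s - y) s‖) volume p q := by
      intro p q
      refine Continuous.intervalIntegrable ?_ _ _
      exact (Real.continuous_sqrt.comp (hv.comp_continuous hC.continuous hmem)).mul
        (hC.continuous_deriv le_rfl).norm
    rw [← intervalIntegral.integral_add_adjacent_intervals (hint 0 (1/2)) (hint (1/2) 1)]
    congr 1
    · rw [← hL]
      have := i1 0 (1/2)
      rw [show (2 * (0:ℝ) - 0) = 0 by norm_num, show (2 * (1/2:ℝ) - 0) = 1 by norm_num,
        Real.smoothTransition.zero, Real.smoothTransition.one] at this
      rw [← this]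
      refine intervalIntegral.integral_congr_ae ?_
      have hne : ∀ᵐ s : ℝ, s ≠ 1/2 := by simp [ae_iff]
      filter_upwards [hne] with s hne hs
      rw [uIoc_of_le (by norm_num)] at hs
      have hs1 : s < 1/2 := lt_of_le_of_ne hs.2 hne
      have : (fun s => f1 s + f2 s - y) =ᶠ[nhds s] f1 := by
        filter_upwards [Iio_mem_nhds hs1] with r hr using l1 r (le_of_lt hr)
      rw [this.deriv_eq, l1 s hs1.le]
    · rw [← hL']
      have := i2 (1/2) 1
      rw [show (2 * (1/2:ℝ) - 1) = 0 by norm_num, show (2 * (1:ℝ) - 1) = 1 by norm_num,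
        Real.smoothTransition.zero, Real.smoothTransition.one] at this
      rw [← this]
      refine intervalIntegral.integral_congr_ae ?_
      filter_upwards with s hs
      rw [uIoc_of_le (by norm_num)] at hs
      have hs1 : 1/2 < s := hs.1
      have : (fun s => f1 s + f2 s - y) =ᶠ[nhds s] f2 := by
        filter_upwards [Ioi_mem_nhds hs1] with r hr using l2 r (le_of_lt hr)
      rw [this.deriv_eq, l2 s hs1.le]

lemma C1Joined.mem_component {v : ℂ → ℝ} {Ω : Set ℂ} {x y : ℂ} {L : ℝ}
    (h : C1Joined v Ω x y L) : y ∈ connectedComponentIn Ω x := by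
  obtain ⟨c, hc, hcΩ, c0, c1, hL⟩ := h
  have : IsPreconnected (range c) := isPreconnected_range hc.continuous
  refine this.subset_connectedComponentIn ⟨0, c0⟩ ?_ ⟨1, c1⟩
  rintro _ ⟨s, rfl⟩; exact hcΩ s

lemma C1Joined.confDist_le {v : ℂ → ℝ} {Ω : Set ℂ} {x y : ℂ} {L : ℝ}
    (h : C1Joined v Ω x y L) : confDist v Ω x y ≤ L := by
  obtain ⟨c, hc, hcΩ, c0, c1, hL⟩ := h
  refine csInf_le ⟨0, ?_⟩ ⟨c, hc.contDiffOn, fun s _ => hcΩ s, c0, c1, ?_⟩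
  · rintro _ ⟨γ, -, -, -, -, rfl⟩
    exact intervalIntegral.integral_nonneg zero_le_one fun s _ => by positivity
  · rw [← hL]
    refine intervalIntegral.integral_congr fun s hs => ?_
    rw [uIcc_of_le zero_le_one] at hs
    rw [(hc.differentiable one_ne_zero s).derivWithin (uniqueDiffOn_Icc one_pos s hs)]

lemma confDist_nonneg (v : ℂ → ℝ) (Ω : Set ℂ) (x y : ℂ) : 0 ≤ confDist v Ω x y := by
  refine Real.sInf_nonneg ?_
  rintro _ ⟨γ, -, -, -, -, rfl⟩
  exact intervalIntegral.integral_nonneg zero_le_one fun s _ => by positivity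

lemma C1Joined.segment {v : ℂ → ℝ} {Ω : Set ℂ} (hv : ContinuousOn v Ω) {x y : ℂ} {B : ℝ}
    (hs : segment ℝ x y ⊆ Ω) (hB : ∀ z ∈ segment ℝ x y, Real.sqrt (v z) ≤ B) :
    ∃ L ≤ B * ‖y - x‖, C1Joined v Ω x y L := by
  set c : ℝ → ℂ := fun s => x + s • (y - x) with hcdef
  have hc : ContDiff ℝ 1 c := contDiff_const.add (contDiff_id.smul contDiff_const)
  have hcs : ∀ s ∈ Icc (0:ℝ) 1, c s ∈ _root_.segment ℝ x y := by
    intro s hs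
    rw [segment_eq_image']
    exact ⟨s, hs, rfl⟩
  have h := C1Joined.of_Icc hv zero_le_one hc.contDiffOn (fun s h => hs (hcs s h))
  have c0 : c 0 = x := by simp [hcdef]
  have c1 : c 1 = y := by simp [hcdef]
  rw [c0, c1] at h
  refine ⟨_, ?_, h⟩
  have hd : ∀ s ∈ Icc (0:ℝ) 1, derivWithin c (Icc 0 1) s = y - x := by
    intro s hs
    rw [(hc.differentiable one_ne_zero s).derivWithin (uniqueDiffOn_Icc one_pos s hs)]
    have : HasDerivAt c (y - x) s := by
      have := ((hasDerivAt_id s).smul_const (y - x)).const_add x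
      rw [one_smul] at this
      exact this
    exact this.deriv
  have : ∫ s in (0:ℝ)..1, Real.sqrt (v (c s)) * ‖derivWithin c (Icc 0 1) s‖ ≤
      ∫ s in (0:ℝ)..1, B * ‖y - x‖ := by
    refine intervalIntegral.integral_mono_on zero_le_one ?_ (by simp) ?_
    · refine ContinuousOn.intervalIntegrable ?_
      rw [uIcc_of_le zero_le_one]
      refine ContinuousOn.mul (Real.continuous_sqrt.comp_continuousOn
        (hv.comp hc.continuous.continuousOn (fun s h => hs (hcs s h)))) ?_
      exact (hc.contDiffOn.continuousOn_derivWithin (uniqueDiffOn_Icc one_pos) le_rfl).norm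
    · intro s hs
      rw [hd s hs]
      exact mul_le_mul_of_nonneg_right (hB _ (hcs s hs)) (norm_nonneg _)
  simpa using this

lemma exists_ball_C1Joined {v : ℂ → ℝ} {Ω : Set ℂ} (hv : ContinuousOn v Ω) (hΩ : IsOpen Ω)
    {x : ℂ} (hx : x ∈ Ω) :
    ∃ δ > 0, ∃ B ≥ 0, ball x δ ⊆ Ω ∧ ∀ y ∈ ball x δ, ∀ z ∈ ball x δ,
      ∃ L ≤ B * ‖z - y‖, C1Joined v Ω y z L := by
  have hcont : ContinuousAt (fun z => Real.sqrt (v z)) x :=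
    (hv.continuousAt (hΩ.mem_nhds hx)).sqrt
  have hev : ∀ᶠ z in nhds x, Real.sqrt (v z) < Real.sqrt (v x) + 1 :=
    hcont.eventually_lt continuousAt_const (by linarith)
  obtain ⟨δ, hδ, hsub⟩ := Metric.mem_nhds_iff.1 (inter_mem (hΩ.mem_nhds hx) hev)
  refine ⟨δ, hδ, Real.sqrt (v x) + 1, by positivity, fun z hz => (hsub hz).1, ?_⟩
  intro y hy z hz
  have hseg := (convex_ball x δ).segment_subset hy hz
  exact C1Joined.segment hv (fun w hw => (hsub (hseg hw)).1)
    (fun w hw => le_of_lt (hsub (hseg hw)).2)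

lemma exists_C1Joined_of_mem_component {v : ℂ → ℝ} {Ω : Set ℂ} (hv : ContinuousOn v Ω)
    (hΩ : IsOpen Ω) {x y : ℂ} (hx : x ∈ Ω) (hy : y ∈ connectedComponentIn Ω x) :
    ∃ L, C1Joined v Ω x y L := by
  have hsub : connectedComponentIn Ω x ⊆ {y | ∃ L, C1Joined v Ω x y L} := by
    refine isPreconnected_connectedComponentIn.subset_of_closure_inter_subset ?_
      ⟨x, mem_connectedComponentIn hx, 0, C1Joined.refl hx⟩ ?_
    · rw [isOpen_iff_mem_nhds]
      rintro y ⟨L, hL⟩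
      have hyΩ : y ∈ Ω := connectedComponentIn_subset _ _ hL.mem_component
      obtain ⟨δ, hδ, B, -, -, h⟩ := exists_ball_C1Joined hv hΩ hyΩ
      filter_upwards [ball_mem_nhds y hδ] with z hz
      obtain ⟨L', -, h'⟩ := h y (mem_ball_self hδ) z hz
      exact ⟨_, hL.trans hv h'⟩
    · rintro y ⟨hy, hyx⟩
      have hyΩ : y ∈ Ω := connectedComponentIn_subset _ _ hyx
      obtain ⟨δ, hδ, B, -, -, h⟩ := exists_ball_C1Joined hv hΩ hyΩ
      obtain ⟨z, hz, hyz⟩ := Metric.mem_closure_iff.1 hy δ hδ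
      obtain ⟨L, hL⟩ := hz
      rw [dist_comm] at hyz
      obtain ⟨L', -, h'⟩ := h z hyz y (mem_ball_self hδ)
      exact ⟨_, hL.trans hv h'⟩
  exact hsub hy

lemma exists_C1Joined_lt {v : ℂ → ℝ} {Ω : Set ℂ} (hv : ContinuousOn v Ω)
    (hΩ : IsOpen Ω) {x y : ℂ} {r : ℝ} (hx : x ∈ Ω) (hy : y ∈ connectedComponentIn Ω x)
    (hr : confDist v Ω x y < r) : ∃ L < r, C1Joined v Ω x y L := by
  obtain ⟨L₀, c, hc, hcΩ, c0, c1, hL⟩ := exists_C1Joined_of_mem_component hv hΩ hx hy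
  unfold confDist at hr
  obtain ⟨L, ⟨γ, h1, h2, h3, h4, h5⟩, hLr⟩ := exists_lt_of_csInf_lt
    (by exact ⟨_, c, hc.contDiffOn, fun s _ => hcΩ s, c0, c1, rfl⟩) hr
  have := C1Joined.of_Icc hv zero_le_one h1 h2
  rw [h3, h4, ← h5] at this
  exact ⟨L, hLr, this⟩

lemma mem_confBall_iff {v : ℂ → ℝ} {Ω : Set ℂ} (hv : ContinuousOn v Ω)
    (hΩ : IsOpen Ω) {x y : ℂ} {r : ℝ} (hx : x ∈ Ω) :
    y ∈ confBall v Ω x r ↔ ∃ L < r, C1Joined v Ω x y L :=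
  ⟨fun h => exists_C1Joined_lt hv hΩ hx h.1 h.2,
    fun ⟨_, hL, h⟩ => ⟨h.mem_component, h.confDist_le.trans_lt hL⟩⟩

lemma isOpen_confBall {v : ℂ → ℝ} {Ω : Set ℂ} (hv : ContinuousOn v Ω)
    (hΩ : IsOpen Ω) {x : ℂ} {r : ℝ} (hx : x ∈ Ω) : IsOpen (confBall v Ω x r) := by
  rw [isOpen_iff_mem_nhds]
  intro y hy
  have hyΩ : y ∈ Ω := connectedComponentIn_subset _ _ hy.1
  obtain ⟨L, hLr, hL⟩ := (mem_confBall_iff hv hΩ hx).1 hy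
  obtain ⟨δ, hδ, B, hB, -, h⟩ := exists_ball_C1Joined hv hΩ hyΩ
  have : Tendsto (fun z => L + B * ‖z - y‖) (nhds y) (nhds (L + B * ‖y - y‖)) := by
    refine Continuous.tendsto ?_ y
    fun_prop
  have hev := this.eventually_lt_const (u := r) (by simpa using hLr)
  filter_upwards [hev, ball_mem_nhds y hδ] with z hz hzb
  obtain ⟨L', hL', h'⟩ := h y (mem_ball_self hδ) z hzb
  exact (mem_confBall_iff hv hΩ hx).2 ⟨_, by linarith, hL.trans hv h'⟩

open scoped ContDiff Topology

lemma uniform_taylor {E : Type*} [NormedAddCommGroup E] [NormedSpace ℝ E] {f : E → ℝ}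
    {M K : Set E} (hM : IsOpen M) (hf : ContDiffOn ℝ ∞ f M) (hK : IsCompact K) (hKM : K ⊆ M)
    {ε : ℝ} (hε : 0 < ε) :
    ∃ δ > 0, ∀ p ∈ K, ∀ h : E, ‖h‖ < δ → p + h ∈ M ∧
      |f (p + h) - f p - fderiv ℝ f p h - 1 / 2 * fderiv ℝ (fderiv ℝ f) p h h| ≤ ε * ‖h‖ ^ 2 := by
  have hf1 : ContDiffOn ℝ ∞ (fderiv ℝ f) M := hf.fderiv_of_isOpen hM (by norm_cast)
  have hf2 : ContinuousOn (fderiv ℝ (fderiv ℝ f)) M :=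
    hf1.continuousOn_fderiv_of_isOpen hM (by norm_cast)
  have hev : ∀ᶠ h in nhds (0 : E), ∀ p ∈ K,
      p + h ∈ M ∧ ‖fderiv ℝ (fderiv ℝ f) (p + h) - fderiv ℝ (fderiv ℝ f) p‖ < ε := by
    refine hK.eventually_forall_of_forall_eventually
      (P := fun h p => p + h ∈ M ∧
        ‖fderiv ℝ (fderiv ℝ f) (p + h) - fderiv ℝ (fderiv ℝ f) p‖ < ε) fun p hp => ?_
    have hc : ContinuousAt (fderiv ℝ (fderiv ℝ f)) p := hf2.continuousAt (hM.mem_nhds (hKM hp))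
    have t1 : Tendsto (fun z : E × E => z.2 + z.1) (nhds (0, p)) (nhds p) := by
      have : Continuous fun z : E × E => z.2 + z.1 := by fun_prop
      simpa using this.tendsto (0, p)
    have t2 : Tendsto (fun z : E × E => z.2) (nhds (0, p)) (nhds p) :=
      continuous_snd.tendsto (0, p)
    have t3 := (tendsto_iff_norm_sub_tendsto_zero (E := E →L[ℝ] E →L[ℝ] ℝ)).1
      (show Tendsto _ _ (nhds _) from hc.tendsto)
    have t4 := (t3.comp t1).eventually_lt_const (half_pos hε)
    have t5 := (t3.comp t2).eventually_lt_const (half_pos hε)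
    filter_upwards [t1.eventually (hM.mem_nhds (hKM hp)), t4, t5] with z h1 h4 h5
    refine ⟨h1, ?_⟩
    have := norm_sub_le_norm_sub_add_norm_sub (fderiv ℝ (fderiv ℝ f) (z.2 + z.1))
      (fderiv ℝ (fderiv ℝ f) p) (fderiv ℝ (fderiv ℝ f) z.2)
    rw [norm_sub_rev (fderiv ℝ (fderiv ℝ f) p)] at this
    simp only [Function.comp_apply] at h4 h5
    linarith
  obtain ⟨δ, hδ, hball⟩ := Metric.eventually_nhds_iff_ball.1 hev
  refine ⟨δ, hδ, fun p hp h hh => ⟨(hball h (by simpa using hh) p hp).1, ?_⟩⟩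
  have hsub : ∀ k ∈ ball (0:E) δ, p + k ∈ M := fun k hk => (hball k hk p hp).1
  set D2 := fderiv ℝ (fderiv ℝ f) p with hD2
  have hsymm : ∀ v w, D2 v w = D2 w v := by
    have : IsSymmSndFDerivAt ℝ f p :=
      (hf.contDiffAt (hM.mem_nhds (hKM hp))).isSymmSndFDerivAt
        (by simpa using WithTop.coe_le_coe.2 (le_top : (2 : ℕ∞) ≤ ⊤))
    exact fun v w => this v w
  have hDf : ∀ k ∈ ball (0:E) δ, HasFDerivAt (fun k => fderiv ℝ f (p + k))
      (fderiv ℝ (fderiv ℝ f) (p + k)) k := by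
    intro k hk
    have : DifferentiableAt ℝ (fderiv ℝ f) (p + k) :=
      (hf1.contDiffAt (hM.mem_nhds (hsub k hk))).differentiableAt (by simp)
    exact (hasFDerivAt_comp_add_left p).2 this.hasFDerivAt
  have hF : ∀ k ∈ ball (0:E) δ, HasFDerivAt (fun k => f (p + k)) (fderiv ℝ f (p + k)) k := by
    intro k hk
    have : DifferentiableAt ℝ f (p + k) :=
      (hf.contDiffAt (hM.mem_nhds (hsub k hk))).differentiableAt (by simp)
    exact (hasFDerivAt_comp_add_left p).2 this.hasFDerivAt
  have step1 : ∀ k ∈ ball (0:E) δ, ‖fderiv ℝ f (p + k) - fderiv ℝ f p - D2 k‖ ≤ ε * ‖k‖ := by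
    intro k hk
    have := (convex_ball (0:E) δ).norm_image_sub_le_of_norm_hasFDerivWithin_le
      (f := fun k => fderiv ℝ f (p + k) - D2 k)
      (f' := fun k => fderiv ℝ (fderiv ℝ f) (p + k) - D2) (C := ε)
      (fun x hx => ((hDf x hx).sub D2.hasFDerivAt).hasFDerivWithinAt)
      (fun x hx => (hball x hx p hp).2.le) (mem_ball_self hδ) hk
    simp only [add_zero, map_zero, sub_zero] at this
    rwa [sub_right_comm]
  have hh' : ‖h‖ < δ := hh
  have hcl : closedBall (0:E) ‖h‖ ⊆ ball 0 δ := closedBall_subset_ball hh'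
  have := (convex_closedBall (0:E) ‖h‖).norm_image_sub_le_of_norm_hasFDerivWithin_le
      (f := fun k => f (p + k) - fderiv ℝ f p k - 1 / 2 * D2 k k)
      (f' := fun k => fderiv ℝ f (p + k) - fderiv ℝ f p - D2 k) (C := ε * ‖h‖)
      (fun x hx => ?_)
      (fun x hx => (step1 x (hcl hx)).trans (by
        have : ‖x‖ ≤ ‖h‖ := by simpa using hx
        gcongr)) (mem_closedBall_self (norm_nonneg _)) (show h ∈ closedBall (0:E) ‖h‖ by simp)
  · simp only [add_zero, map_zero, sub_zero, mul_zero, Real.norm_eq_abs] at this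
    calc _ = |f (p + h) - fderiv ℝ f p h - 1 / 2 * D2 h h - f p| := by congr 1; ring
      _ ≤ _ := this
      _ = _ := by ring
  · have hq : HasFDerivAt (fun k => D2 k k) (D2 x + D2.flip x) x := by
      refine (HasFDerivAt.comp (f := fun k : E => (k, k)) x
        (D2.isBoundedBilinearMap.hasFDerivAt (x, x))
        ((hasFDerivAt_id x).prodMk (hasFDerivAt_id x))).congr_fderiv ?_
      ext v
      simp
    have h3 := (((hF x (hcl hx)).sub (fderiv ℝ f p).hasFDerivAt).sub
      (hq.const_mul (1/2))).hasFDerivWithinAt (s := closedBall (0:E) ‖h‖)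
    refine h3.congr_fderiv ?_
    ext v
    simp [hsymm v x]
    ring

lemma parabolic_taylor {f : ℂ × ℝ → ℝ} {M K : Set (ℂ × ℝ)} (hM : IsOpen M)
    (hf : ContDiffOn ℝ ∞ f M) (hK : IsCompact K) (hKM : K ⊆ M) {B ε : ℝ} (hB : 0 < B)
    (hε : 0 < ε) :
    ∃ ρ₀ > 0, ∀ ρ, 0 < ρ → ρ < ρ₀ → ∀ p ∈ K, ∀ h : ℂ, ‖h‖ ≤ B * ρ →
      (p.1 + h, p.2 - ρ ^ 2 / 4) ∈ M ∧
      |f (p.1 + h, p.2 - ρ ^ 2 / 4) - f p - fderiv ℝ f p (h, 0)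
        - 1 / 2 * fderiv ℝ (fderiv ℝ f) p (h, 0) (h, 0) + ρ ^ 2 / 4 * fderiv ℝ f p (0, 1)|
        ≤ ε * ρ ^ 2 := by
  have hf1 : ContDiffOn ℝ ∞ (fderiv ℝ f) M := hf.fderiv_of_isOpen hM (by norm_cast)
  have hf2 : ContinuousOn (fderiv ℝ (fderiv ℝ f)) M :=
    hf1.continuousOn_fderiv_of_isOpen hM (by norm_cast)
  obtain ⟨C, hC⟩ := hK.exists_bound_of_continuousOn (E := ℂ × ℝ →L[ℝ] ℂ × ℝ →L[ℝ] ℝ)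
    (show ContinuousOn _ _ from hf2.mono hKM)
  obtain ⟨δ, hδ, hT⟩ := uniform_taylor hM hf hK hKM (ε := ε / 2 / (B + 1) ^ 2) (by positivity)
  set C' := |C| + 1 with hC'
  have hC'0 : 0 < C' := by positivity
  refine ⟨min 1 (min (δ / (B + 1)) (ε / (2 * C' * (B + 1)))), by positivity, ?_⟩
  intro ρ hρ hρ0 p hp h hh
  have hρ1 : ρ < 1 := hρ0.trans_le (min_le_left _ _)
  have hρ2 : ρ * (B + 1) < δ := by
    have := hρ0.trans_le ((min_le_right _ _).trans (min_le_left _ _))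
    rwa [lt_div_iff₀ (by positivity)] at this
  have hρ3 : ρ * (2 * C' * (B + 1)) < ε := by
    have := hρ0.trans_le ((min_le_right _ _).trans (min_le_right _ _))
    rwa [lt_div_iff₀ (by positivity)] at this
  set τ := ρ ^ 2 / 4 with hτ
  have hτ0 : 0 < τ := by positivity
  have hτρ : τ ≤ ρ / 4 := by nlinarith
  have hn : ‖((h, -τ) : ℂ × ℝ)‖ ≤ (B + 1) * ρ := by
    rw [Prod.norm_def]
    refine max_le ?_ ?_
    · simp only; nlinarith
    · simp only [norm_neg, Real.norm_eq_abs, abs_of_pos hτ0]; nlinarith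
  obtain ⟨hmem, hest⟩ := hT p hp (h, -τ) (by linarith)
  have hpe : p + (h, -τ) = (p.1 + h, p.2 - τ) := by
    ext <;> simp [sub_eq_add_neg]
  rw [hpe] at hmem hest
  refine ⟨hmem, ?_⟩
  set D := fderiv ℝ f p
  set D2 := fderiv ℝ (fderiv ℝ f) p
  have hsplit : ((h, -τ) : ℂ × ℝ) = (h, 0) + (-τ) • ((0, 1) : ℂ × ℝ) := by
    ext <;> simp
  have e1 : D (h, -τ) = D (h, 0) - τ * D (0, 1) := by
    rw [hsplit, map_add, map_smul]; simp only [smul_eq_mul]; ring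
  have e2 : D2 (h, -τ) (h, -τ) = D2 (h, 0) (h, 0) - τ * D2 (h, 0) (0, 1) - τ * D2 (0, 1) (h, 0)
      + τ ^ 2 * D2 (0, 1) (0, 1) := by
    rw [hsplit]; simp only [map_add, map_smul, _root_.add_apply,
      _root_.smul_apply, smul_eq_mul]; ring
  rw [e1, e2] at hest
  have hb : ∀ v w : ℂ × ℝ, |D2 v w| ≤ C' * ‖v‖ * ‖w‖ := by
    intro v w
    have h1 := D2.le_opNorm₂ v w
    have h2 : ‖D2‖ ≤ C' := (hC p hp).trans ((le_abs_self C).trans (by linarith))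
    rw [Real.norm_eq_abs] at h1
    refine h1.trans ?_
    gcongr
  have n1 : ‖((0, 1) : ℂ × ℝ)‖ = 1 := by simp [Prod.norm_def]
  have n2 : ‖((h, 0) : ℂ × ℝ)‖ = ‖h‖ := by simp [Prod.norm_def]
  have b1 := hb (h, 0) (0, 1)
  have b2 := hb (0, 1) (h, 0)
  have b3 := hb (0, 1) (0, 1)
  rw [n1, n2] at b1 b2
  rw [n1] at b3
  have hE : ε / 2 / (B + 1) ^ 2 * ‖((h, -τ) : ℂ × ℝ)‖ ^ 2 ≤ ε / 2 * ρ ^ 2 := by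
    calc _ ≤ ε / 2 / (B + 1) ^ 2 * ((B + 1) * ρ) ^ 2 := by gcongr
      _ = _ := by field_simp
  have c1 : C' * ‖h‖ ≤ C' * (B * ρ) := by gcongr
  set X := D2 (h, 0) (0, 1)
  set Y := D2 (0, 1) (h, 0)
  set Z := D2 (0, 1) (0, 1)
  have hX : |X| ≤ C' * (B * ρ) := by linarith
  have hY : |Y| ≤ C' * (B * ρ) := by linarith
  have hZ : |Z| ≤ C' := by linarith
  have hrem : |1 / 2 * (- τ * X - τ * Y + τ ^ 2 * Z)| ≤ ε / 2 * ρ ^ 2 := by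
    have : |1 / 2 * (- τ * X - τ * Y + τ ^ 2 * Z)| ≤
        1 / 2 * (τ * (C' * (B * ρ)) + τ * (C' * (B * ρ))
        + τ * (ρ / 4) * C') := by
      rw [abs_mul, abs_of_pos (show (0:ℝ) < 1/2 by norm_num)]
      gcongr
      refine (abs_add_le _ _).trans (add_le_add ((abs_sub _ _).trans (add_le_add ?_ ?_)) ?_)
      · rw [abs_mul, abs_neg, abs_of_pos hτ0]; gcongr
      · rw [abs_mul, abs_of_pos hτ0]; gcongr
      · rw [abs_mul, abs_of_pos (by positivity), sq]; gcongr
    refine this.trans ?_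
    have : 1 / 2 * (τ * (C' * (B * ρ)) + τ * (C' * (B * ρ)) + τ * (ρ / 4) * C') ≤
        ρ ^ 2 / 4 * (ρ * (2 * C' * (B + 1))) := by
      rw [hτ]
      have : 0 < ρ ^ 2 * C' * ρ := by positivity
      nlinarith
    have h4 : ρ ^ 2 / 4 * (ρ * (2 * C' * (B + 1))) ≤ ρ ^ 2 / 4 * ε := by gcongr
    nlinarith
  have := hest.trans hE
  calc _ = |(f (p.1 + h, p.2 - τ) - f p - (D (h, 0) - τ * D (0, 1)) -
        1 / 2 * (D2 (h, 0) (h, 0) - τ * X - τ * Y + τ ^ 2 * Z))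
        + 1 / 2 * (- τ * X - τ * Y + τ ^ 2 * Z)| := by congr 1; ring
    _ ≤ ε / 2 * ρ ^ 2 + ε / 2 * ρ ^ 2 := (abs_add_le _ _).trans (add_le_add this hrem)
    _ = _ := by ring

/-- The spatial Laplacian of a function on `ℂ × ℝ`, in terms of its second derivative. -/
noncomputable def spaceLap (f : ℂ × ℝ → ℝ) (p : ℂ × ℝ) : ℝ :=
  fderiv ℝ (fderiv ℝ f) p (1, 0) (1, 0) + fderiv ℝ (fderiv ℝ f) p (Complex.I, 0) (Complex.I, 0)

lemma lap_slice {f : ℂ × ℝ → ℝ} {M : Set (ℂ × ℝ)} (hM : IsOpen M) (hf : ContDiffOn ℝ ∞ f M)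
    {p : ℂ × ℝ} (hp : p ∈ M) : lap (fun z => f (z, p.2)) p.1 = spaceLap f p := by
  have hf1 : ContDiffOn ℝ ∞ (fderiv ℝ f) M := hf.fderiv_of_isOpen hM (by norm_cast)
  have hinl : ∀ z : ℂ, HasFDerivAt (fun z : ℂ => (z, p.2)) (ContinuousLinearMap.inl ℝ ℂ ℝ) z := by
    intro z
    exact (hasFDerivAt_id z).prodMk (hasFDerivAt_const _ _)
  have hcont : Continuous fun z : ℂ => (z, p.2) := by fun_prop
  have hev : ∀ᶠ z in nhds p.1, (z, p.2) ∈ M := hcont.continuousAt.eventually (hM.mem_nhds hp)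
  have hfd : fderiv ℝ (fun z => f (z, p.2)) =ᶠ[nhds p.1]
      fun z => (fderiv ℝ f (z, p.2)).comp (ContinuousLinearMap.inl ℝ ℂ ℝ) := by
    filter_upwards [hev] with z hz
    have : DifferentiableAt ℝ f (z, p.2) :=
      (hf.contDiffAt (hM.mem_nhds hz)).differentiableAt (by simp)
    exact (this.hasFDerivAt.comp z (hinl z)).fderiv
  have hD : DifferentiableAt ℝ (fderiv ℝ f) p :=
    (hf1.contDiffAt (hM.mem_nhds hp)).differentiableAt (by simp)
  have h2 : HasFDerivAt (fun z => fderiv ℝ f (z, p.2))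
      ((fderiv ℝ (fderiv ℝ f) p).comp (ContinuousLinearMap.inl ℝ ℂ ℝ)) p.1 :=
    HasFDerivAt.comp p.1 (show HasFDerivAt (fderiv ℝ f) _ (p.1, p.2) from hD.hasFDerivAt)
      (hinl p.1)
  have h3 := h2.clm_comp (hasFDerivAt_const (ContinuousLinearMap.inl ℝ ℂ ℝ) p.1)
  have h4 : fderiv ℝ (fderiv ℝ fun z => f (z, p.2)) p.1 = _ := hfd.fderiv_eq.trans h3.fderiv
  unfold lap spaceLap
  rw [iteratedFDeriv_two_apply, iteratedFDeriv_two_apply, h4]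
  simp

lemma deriv_slice {f : ℂ × ℝ → ℝ} {p : ℂ × ℝ} (hf : DifferentiableAt ℝ f p) :
    deriv (fun t => f (p.1, t)) p.2 = fderiv ℝ f p (0, 1) := by
  have hinr : HasDerivAt (fun t : ℝ => (p.1, t)) (0, 1) p.2 :=
    (hasDerivAt_const _ _).prodMk (hasDerivAt_id _)
  have : HasFDerivAt f (fderiv ℝ f p) (p.1, p.2) := hf.hasFDerivAt
  exact (this.comp_hasDerivAt p.2 hinr).deriv

/-- The average of `F` over the four points `ρ, iρ, -ρ, -iρ`. -/
noncomputable def avgFour (F : ℂ → ℝ) (ρ : ℝ) : ℝ :=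
  (F ρ + F (Complex.I * ρ) + F (-ρ) + F (-(Complex.I * ρ))) / 4

lemma avgFour_mono {F G : ℂ → ℝ} {ρ : ℝ} (hρ : 0 < ρ) (h : ∀ w : ℂ, ‖w‖ = ρ → F w ≤ G w) :
    avgFour F ρ ≤ avgFour G ρ := by
  have h1 := h ρ (by simp [hρ.le])
  have h2 := h (Complex.I * ρ) (by simp [hρ.le])
  have h3 := h (-ρ) (by simp [hρ.le])
  have h4 := h (-(Complex.I * ρ)) (by simp [hρ.le])
  unfold avgFour
  linarith

lemma avgFour_hessian {f : ℂ × ℝ → ℝ} {p : ℂ × ℝ} (hf : ContDiffAt ℝ ∞ f p) (η : ℂ) (ρ : ℝ) :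
    avgFour (fun w => fderiv ℝ (fderiv ℝ f) p (w * η, 0) (w * η, 0)) ρ =
      ρ ^ 2 / 2 * ‖η‖ ^ 2 * spaceLap f p := by
  set D2 := fderiv ℝ (fderiv ℝ f) p with hD2
  have hsymm : ∀ v w, D2 v w = D2 w v := by
    have : IsSymmSndFDerivAt ℝ f p := hf.isSymmSndFDerivAt
        (by simpa using WithTop.coe_le_coe.2 (le_top : (2 : ℕ∞) ≤ ⊤))
    exact fun v w => this v w
  have hdec : ∀ z : ℂ, ((z, 0) : ℂ × ℝ) =
      z.re • ((1, 0) : ℂ × ℝ) + z.im • ((Complex.I, 0) : ℂ × ℝ) := by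
    intro z
    ext <;> simp
  have hq : ∀ z : ℂ, D2 (z, 0) (z, 0) = z.re ^ 2 * D2 (1, 0) (1, 0) + 2 * z.re * z.im *
      D2 (1, 0) (Complex.I, 0) + z.im ^ 2 * D2 (Complex.I, 0) (Complex.I, 0) := by
    intro z
    rw [hdec z]
    simp only [map_add, map_smul, _root_.add_apply,
      _root_.smul_apply, smul_eq_mul]
    rw [hsymm (Complex.I, 0) (1, 0)]
    ring
  have hη : ‖η‖ ^ 2 = η.re ^ 2 + η.im ^ 2 := by
    rw [← Complex.normSq_eq_norm_sq, Complex.normSq_apply]; ring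
  unfold avgFour spaceLap
  rw [← hD2, hη]
  generalize hX : D2 (1, 0) (1, 0) = X at hq ⊢
  generalize hY : D2 (Complex.I, 0) (Complex.I, 0) = Y at hq ⊢
  generalize hZ : D2 (1, 0) (Complex.I, 0) = Z at hq
  simp only [hq, Complex.mul_re, Complex.mul_im, Complex.neg_re, Complex.neg_im, Complex.ofReal_re,
    Complex.ofReal_im, Complex.I_re, Complex.I_im]
  ring

lemma avgFour_taylor {f : ℂ × ℝ → ℝ} {M : Set (ℂ × ℝ)} (hM : IsOpen M)
    (hf : ContDiffOn ℝ ∞ f M) {p : ℂ × ℝ} (hp : p ∈ M) (η : ℂ) {ε : ℝ} (hε : 0 < ε) :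
    ∃ ρ₀ > 0, ∀ ρ, 0 < ρ → ρ < ρ₀ →
      avgFour (fun w => f (p.1 + w * η, p.2 - ρ ^ 2 / 4)) ρ ≤
        f p + ρ ^ 2 / 4 * (‖η‖ ^ 2 * spaceLap f p - fderiv ℝ f p (0, 1)) + ε * ρ ^ 2 := by
  obtain ⟨ρ₀, hρ₀, h⟩ := parabolic_taylor hM hf (isCompact_singleton (x := p))
    (by simpa using hp) (B := ‖η‖ + 1) (by positivity) hε
  refine ⟨ρ₀, hρ₀, fun ρ h0 h1 => ?_⟩
  have hmono := avgFour_mono (F := fun w => f (p.1 + w * η, p.2 - ρ ^ 2 / 4))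
    (G := fun w => f p + fderiv ℝ f p (w * η, 0)
        + 1 / 2 * fderiv ℝ (fderiv ℝ f) p (w * η, 0) (w * η, 0) - ρ ^ 2 / 4 * fderiv ℝ f p (0, 1)
        + ε * ρ ^ 2) h0 (fun w hw => by
      have := (h ρ h0 h1 p rfl (w * η) (by rw [norm_mul, hw]; nlinarith [norm_nonneg η])).2
      have := (abs_le.1 this).2
      linarith)
  refine hmono.trans (le_of_eq ?_)
  have hH := avgFour_hessian (hf.contDiffAt (hM.mem_nhds hp)) η ρ
  unfold avgFour at hH ⊢
  beta_reduce at hH ⊢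
  have n1 : fderiv ℝ f p (-(ρ:ℂ) * η, 0) = - fderiv ℝ f p ((ρ:ℂ) * η, 0) := by
    rw [← map_neg]; simp
  have n2 : fderiv ℝ f p (-(Complex.I * (ρ:ℂ)) * η, 0)
      = - fderiv ℝ f p (Complex.I * (ρ:ℂ) * η, 0) := by
    rw [← map_neg]; simp
  rw [n1, n2]
  linear_combination (1/2) * hH

/-- The directional derivative of `f` in the direction `v`. -/
noncomputable def dirDeriv (f : ℂ × ℝ → ℝ) (v p : ℂ × ℝ) : ℝ := fderiv ℝ f p v

lemma contDiffOn_dirDeriv {f : ℂ × ℝ → ℝ} {M : Set (ℂ × ℝ)} (hM : IsOpen M)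
    (hf : ContDiffOn ℝ ∞ f M) (v : ℂ × ℝ) : ContDiffOn ℝ ∞ (dirDeriv f v) M :=
  (hf.fderiv_of_isOpen hM (by norm_cast)).clm_apply contDiffOn_const

lemma fderiv_fderiv_apply {f : ℂ × ℝ → ℝ} {M : Set (ℂ × ℝ)} (hM : IsOpen M)
    (hf : ContDiffOn ℝ ∞ f M) {p : ℂ × ℝ} (hp : p ∈ M) (v w : ℂ × ℝ) :
    fderiv ℝ (fderiv ℝ f) p v w = dirDeriv (dirDeriv f w) v p := by
  have hf1 : ContDiffOn ℝ ∞ (fderiv ℝ f) M := hf.fderiv_of_isOpen hM (by norm_cast)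
  have hD : DifferentiableAt ℝ (fderiv ℝ f) p :=
    (hf1.contDiffAt (hM.mem_nhds hp)).differentiableAt (by simp)
  have := (hD.hasFDerivAt.clm_apply (hasFDerivAt_const w p)).fderiv
  unfold dirDeriv
  rw [this]
  simp

lemma dirDeriv_comm {f : ℂ × ℝ → ℝ} {M : Set (ℂ × ℝ)} (hM : IsOpen M)
    (hf : ContDiffOn ℝ ∞ f M) {p : ℂ × ℝ} (hp : p ∈ M) (v w : ℂ × ℝ) :
    dirDeriv (dirDeriv f w) v p = dirDeriv (dirDeriv f v) w p := by
  rw [← fderiv_fderiv_apply hM hf hp, ← fderiv_fderiv_apply hM hf hp]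
  have : IsSymmSndFDerivAt ℝ f p := (hf.contDiffAt (hM.mem_nhds hp)).isSymmSndFDerivAt
    (by simpa using WithTop.coe_le_coe.2 (le_top : (2 : ℕ∞) ≤ ⊤))
  exact this v w

lemma dirDeriv_congr {f g : ℂ × ℝ → ℝ} {M : Set (ℂ × ℝ)} (hM : IsOpen M) (h : EqOn f g M)
    {p : ℂ × ℝ} (hp : p ∈ M) (v : ℂ × ℝ) : dirDeriv f v p = dirDeriv g v p := by
  unfold dirDeriv
  rw [(h.eventuallyEq_of_mem (hM.mem_nhds hp)).fderiv_eq]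

lemma spaceLap_eq_dirDeriv {f : ℂ × ℝ → ℝ} {M : Set (ℂ × ℝ)} (hM : IsOpen M)
    (hf : ContDiffOn ℝ ∞ f M) {p : ℂ × ℝ} (hp : p ∈ M) :
    spaceLap f p = dirDeriv (dirDeriv f (1, 0)) (1, 0) p +
      dirDeriv (dirDeriv f (Complex.I, 0)) (Complex.I, 0) p := by
  unfold spaceLap
  rw [fderiv_fderiv_apply hM hf hp, fderiv_fderiv_apply hM hf hp]

lemma dirDeriv_neg (f : ℂ × ℝ → ℝ) (v : ℂ × ℝ) :
    dirDeriv (fun p => -f p) v = fun p => -dirDeriv f v p := by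
  funext p
  simp [dirDeriv, fderiv_fun_neg]

lemma dirDeriv_dirDeriv_comm {f : ℂ × ℝ → ℝ} {M : Set (ℂ × ℝ)} (hM : IsOpen M)
    (hf : ContDiffOn ℝ ∞ f M) {p : ℂ × ℝ} (hp : p ∈ M) (v w : ℂ × ℝ) :
    dirDeriv (dirDeriv (dirDeriv f w) v) v p = dirDeriv (dirDeriv (dirDeriv f v) v) w p := by
  rw [dirDeriv_congr hM (fun q hq => dirDeriv_comm hM hf hq v w) hp v,
    dirDeriv_comm hM (contDiffOn_dirDeriv hM hf v) hp]

/-- The logarithm of the conformal factor, as a function on space-time. -/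
noncomputable def logFactor (u : ℂ → ℝ → ℝ) (p : ℂ × ℝ) : ℝ := Real.log (u p.1 p.2)

/-- Minus the time derivative of the logarithm of the conformal factor; along a conformal Ricci
flow this is the scalar curvature. -/
noncomputable def scalarCurv (u : ℂ → ℝ → ℝ) (p : ℂ × ℝ) : ℝ := -dirDeriv (logFactor u) (0, 1) p

section flow

variable {T : ℝ} {M : Set (ℂ × ℝ)} {u : ℂ → ℝ → ℝ}

lemma ConfRFS.contDiffOn_logFactor (h : ConfRFS T M u) : ContDiffOn ℝ ∞ (logFactor u) M :=
  h.smooth.log fun p hp => (h.pos p hp).ne'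

lemma ConfRFS.contDiffOn_scalarCurv (h : ConfRFS T M u) : ContDiffOn ℝ ∞ (scalarCurv u) M :=
  (contDiffOn_dirDeriv h.opn h.contDiffOn_logFactor _).neg

lemma ConfRFS.exp_logFactor (h : ConfRFS T M u) {p : ℂ × ℝ} (hp : p ∈ M) :
    Real.exp (logFactor u p) = u p.1 p.2 := Real.exp_log (h.pos p hp)

lemma ConfRFS.spaceLap_logFactor (h : ConfRFS T M u) {p : ℂ × ℝ} (hp : p ∈ M) :
    spaceLap (logFactor u) p = u p.1 p.2 * dirDeriv (logFactor u) (0, 1) p := by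
  have hd : DifferentiableAt ℝ (fun p : ℂ × ℝ => u p.1 p.2) p :=
    (h.smooth.contDiffAt (h.opn.mem_nhds hp)).differentiableAt (by simp)
  have h1 := deriv_slice hd
  have h2 := h.lfde p hp
  have h3 := lap_slice h.opn h.contDiffOn_logFactor hp
  have h4 := (hd.hasFDerivAt.log (h.pos p hp).ne').fderiv
  have h5 : dirDeriv (logFactor u) (0, 1) p
      = (u p.1 p.2)⁻¹ * fderiv ℝ (fun p : ℂ × ℝ => u p.1 p.2) p (0, 1) := by
    unfold dirDeriv logFactor
    rw [h4]; simp
  rw [← h3, h5, ← h1, mul_inv_cancel_left₀ (h.pos p hp).ne']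
  exact h2.symm

lemma ConfRFS.scalarCurv_eq (h : ConfRFS T M u) {p : ℂ × ℝ} (hp : p ∈ M) :
    -(lap (fun w => Real.log (u w p.2)) p.1) / u p.1 p.2 = scalarCurv u p := by
  have h3 := lap_slice h.opn h.contDiffOn_logFactor hp
  have : lap (fun w => Real.log (u w p.2)) p.1 = spaceLap (logFactor u) p := h3
  rw [this, h.spaceLap_logFactor hp, scalarCurv]
  field_simp [ne_of_gt (h.pos p hp)]

/-- The evolution equation of the scalar curvature along a conformal Ricci flow. -/
lemma ConfRFS.evolution (h : ConfRFS T M u) {p : ℂ × ℝ} (hp : p ∈ M) :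
    fderiv ℝ (scalarCurv u) p (0, 1) =
      spaceLap (scalarCurv u) p / u p.1 p.2 + scalarCurv u p ^ 2 := by
  have hN := h.contDiffOn_logFactor
  set N := logFactor u with hNdef
  have hW := contDiffOn_dirDeriv h.opn hN (0, 1)
  set W := dirDeriv N (0, 1) with hWdef
  have hs : scalarCurv u = fun p => -W p := rfl
  have hdN : DifferentiableAt ℝ N p :=
    (hN.contDiffAt (h.opn.mem_nhds hp)).differentiableAt (by simp)
  have hdW : DifferentiableAt ℝ W p :=
    (hW.contDiffAt (h.opn.mem_nhds hp)).differentiableAt (by simp)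
  have hx := contDiffOn_dirDeriv h.opn (contDiffOn_dirDeriv h.opn hN (1, 0)) (1, 0)
  have hy := contDiffOn_dirDeriv h.opn (contDiffOn_dirDeriv h.opn hN (Complex.I, 0)) (Complex.I, 0)
  have hdx := (hx.contDiffAt (h.opn.mem_nhds hp)).differentiableAt (by simp)
  have hdy := (hy.contDiffAt (h.opn.mem_nhds hp)).differentiableAt (by simp)
  have e1 : spaceLap W p = dirDeriv (fun q => Real.exp (N q) * W q) (0, 1) p := by
    rw [spaceLap_eq_dirDeriv h.opn hW hp, hWdef, dirDeriv_dirDeriv_comm h.opn hN hp,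
      dirDeriv_dirDeriv_comm h.opn hN hp]
    rw [dirDeriv_congr h.opn (f := fun q => Real.exp (N q) * dirDeriv N (0, 1) q)
      (g := fun q => dirDeriv (dirDeriv N (1, 0)) (1, 0) q +
      dirDeriv (dirDeriv N (Complex.I, 0)) (Complex.I, 0) q) ?_ hp]
    · exact (congrArg (fun L : ℂ × ℝ →L[ℝ] ℝ => L (0, 1)) (fderiv_fun_add hdx hdy)).symm
    · intro q hq
      beta_reduce
      rw [← spaceLap_eq_dirDeriv h.opn hN hq, h.spaceLap_logFactor hq, hNdef, h.exp_logFactor hq]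
  have e2 : dirDeriv (fun q => Real.exp (N q) * W q) (0, 1) p
      = u p.1 p.2 * (fderiv ℝ W p (0, 1) + W p ^ 2) := by
    have := (hdN.hasFDerivAt.exp.fun_mul hdW.hasFDerivAt).fderiv
    conv_lhs => unfold dirDeriv
    rw [this, ← h.exp_logFactor hp]
    simp only [_root_.add_apply, _root_.smul_apply, smul_eq_mul]
    rw [show fderiv ℝ N p (0, 1) = W p from rfl]
    ring
  have e3 : spaceLap (scalarCurv u) p = -spaceLap W p := by
    rw [spaceLap_eq_dirDeriv h.opn hW hp, spaceLap_eq_dirDeriv h.opn h.contDiffOn_scalarCurv hp, hs]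
    simp only [dirDeriv_neg]
    ring
  have e4 : fderiv ℝ (scalarCurv u) p (0, 1) = -fderiv ℝ W p (0, 1) := by
    rw [hs, fderiv_fun_neg]; rfl
  rw [e3, e4, e1, e2, hs]
  field_simp [ne_of_gt (h.pos p hp)]
  ring

lemma ConfRFS.avgFour_scalarCurv (h : ConfRFS T M u) {p : ℂ × ℝ} (hp : p ∈ M) {a : ℂ}
    (ha : ‖a‖ ^ 2 * u p.1 p.2 = 1) {ε : ℝ} (hε : 0 < ε) :
    ∃ ρ₀ > 0, ∀ ρ, 0 < ρ → ρ < ρ₀ →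
      avgFour (fun w => scalarCurv u (p.1 + w * a, p.2 - ρ ^ 2 / 4)) ρ ≤
        scalarCurv u p - ρ ^ 2 / 4 * scalarCurv u p ^ 2 + ε * ρ ^ 2 := by
  obtain ⟨ρ₀, h0, h1⟩ := avgFour_taylor h.opn h.contDiffOn_scalarCurv hp a hε
  refine ⟨ρ₀, h0, fun ρ hρ hρ' => (h1 ρ hρ hρ').trans (le_of_eq ?_)⟩
  have hu := h.pos p hp
  have : ‖a‖ ^ 2 = 1 / u p.1 p.2 := by field_simp; linarith
  rw [h.evolution hp, this]
  ring

end flow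

lemma norm_one_add_le {ζ : ℂ} {σ : ℝ} (hσ : σ ≤ 1 / 4) (ha : |ζ.re| ≤ σ) (hb : |ζ.im| ≤ σ) :
    ‖1 + ζ‖ ≤ 1 + ζ.re + ζ.im ^ 2 / 2 + σ ^ 3 := by
  have h0 : 0 ≤ σ := (abs_nonneg _).trans ha
  have ha1 := (abs_le.1 ha).1
  have ha2 := (abs_le.1 ha).2
  have hb2 : ζ.im ^ 2 ≤ σ ^ 2 := sq_le_sq' (abs_le.1 hb).1 (abs_le.1 hb).2
  have hpos : 0 < 1 + ζ.re := by linarith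
  have hbb := sq_nonneg ζ.im
  have hX : 0 ≤ 1 + ζ.re + ζ.im ^ 2 / 2 + σ ^ 3 := by positivity
  have hprod : -(σ ^ 3) ≤ ζ.re * ζ.im ^ 2 := by nlinarith
  refine le_of_sq_le_sq ?_ hX
  rw [← Complex.normSq_eq_norm_sq, Complex.normSq_apply]
  simp only [Complex.add_re, Complex.one_re, Complex.add_im, Complex.one_im, zero_add]
  have h3 : 0 ≤ σ ^ 3 := by positivity
  nlinarith [mul_nonneg h3 hpos.le, sq_nonneg (ζ.im ^ 2 / 2 + σ ^ 3)]

lemma exp_mul_norm_expansion {ζ : ℂ} {σ r Y : ℝ} (hσ : σ ≤ 1 / 4) (ha : |ζ.re| ≤ σ)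
    (hb : |ζ.im| ≤ σ) (hr : |r| ≤ σ) (hY : |Y| ≤ σ ^ 2) :
    Real.exp (r + Y) * ‖1 + ζ‖ ≤
        1 + ζ.re + r + Y + r ^ 2 / 2 + ζ.re * r + ζ.im ^ 2 / 2 + 10 * σ ^ 3 ∧
      |Real.exp (r + Y) * ‖1 + ζ‖ - 1| ≤ |ζ.re + r| + 6 * σ ^ 2 := by
  have h0 : 0 ≤ σ := (abs_nonneg _).trans ha
  have hn := norm_one_add_le hσ ha hb
  have hn' : 1 + ζ.re ≤ ‖1 + ζ‖ := by simpa using Complex.re_le_norm (1 + ζ)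
  set a := ζ.re
  set b := ζ.im
  set n := ‖1 + ζ‖
  have hm : ∀ {x y X Z : ℝ}, |x| ≤ X → |y| ≤ Z → |x * y| ≤ X * Z := fun hx hy => by
    rw [abs_mul]; exact mul_le_mul hx hy (abs_nonneg _) ((abs_nonneg _).trans hx)
  have hY1 : |Y| ≤ σ := hY.trans (by nlinarith)
  have hX : |r + Y| ≤ 5 / 4 * σ := (abs_add_le _ _).trans (by nlinarith)
  have hX1 : |r + Y| ≤ 1 := by linarith
  have hexp := Real.exp_bound hX1 (n := 3) (by norm_num)
  simp only [Finset.sum_range_succ, Finset.sum_range_zero] at hexp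
  norm_num [Nat.factorial] at hexp
  have hX3 : |r + Y| ^ 3 ≤ 2 * σ ^ 3 := by
    calc |r + Y| ^ 3 ≤ (5 / 4 * σ) ^ 3 := by gcongr
      _ ≤ 2 * σ ^ 3 := by nlinarith [pow_nonneg h0 3]
  have hs3 : 0 ≤ σ ^ 3 := by positivity
  have hs2 : 0 ≤ σ ^ 2 := by positivity
  have hss : σ * σ ≤ 1 / 4 := by nlinarith
  have hs32 : σ ^ 3 ≤ σ ^ 2 / 4 := by nlinarith
  have hrY := hm hr hY
  have hYY := hm hY1 hY
  have haY := hm ha hY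
  have hbb := hm hb hb
  have hrr := hm hr hr
  have har := hm ha hr
  have hrbb := hm hr hbb
  have hYbb := hm hY1 hbb
  have hrra := hm hrr ha
  have hrrb := hm hrr hb
  have hrrbb := hm hrrb hb
  have e1 : Real.exp (r + Y) ≤ 1 + r + Y + r ^ 2 / 2 + 2 * σ ^ 3 := by
    have := (abs_le.1 hexp).2
    have := (abs_le.1 hrY).2
    have := (abs_le.1 hYY).2
    linarith
  have e2 : 1 + (r + Y) ≤ Real.exp (r + Y) := by linarith [Real.add_one_le_exp (r + Y)]
  have ha1 := abs_le.1 ha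
  have hX2 := abs_le.1 hX
  have hN : 0 ≤ 1 + a + b ^ 2 / 2 + σ ^ 3 := by nlinarith [sq_nonneg b]
  have hup : Real.exp (r + Y) * n ≤
      1 + a + r + Y + r ^ 2 / 2 + a * r + b ^ 2 / 2 + 10 * σ ^ 3 := by
    calc Real.exp (r + Y) * n ≤ Real.exp (r + Y) * (1 + a + b ^ 2 / 2 + σ ^ 3) := by gcongr
      _ ≤ (1 + r + Y + r ^ 2 / 2 + 2 * σ ^ 3) * (1 + a + b ^ 2 / 2 + σ ^ 3) := by gcongr
      _ ≤ _ := by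
        have k1 := (abs_le.1 haY).2
        have k2 := (abs_le.1 hrbb).2
        have k3 := (abs_le.1 hYbb).2
        have k4 := (abs_le.1 hrra).2
        have k5 := (abs_le.1 hrrbb).2
        have k6 : a * σ ^ 3 ≤ 1 / 4 * σ ^ 3 := by gcongr; linarith
        have k7 : r * σ ^ 3 ≤ 1 / 4 * σ ^ 3 := by gcongr; linarith [(abs_le.1 hr).2]
        have k8 : Y * σ ^ 3 ≤ 1 / 4 * σ ^ 3 := by gcongr; linarith [(abs_le.1 hY1).2]
        have k9 : (r * r) * σ ^ 3 ≤ 1 / 4 * σ ^ 3 := by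
          gcongr; linarith [(abs_le.1 hrr).2]
        have k10 : (b * b) * σ ^ 3 ≤ 1 / 4 * σ ^ 3 := by
          gcongr; linarith [(abs_le.1 hbb).2]
        have k11 : σ ^ 3 * σ ^ 3 ≤ 1 / 4 * σ ^ 3 := by
          gcongr; linarith
        have k12 : σ * σ * σ * σ ≤ σ ^ 3 := by
          calc σ * σ * σ * σ = σ * σ ^ 3 := by ring
            _ ≤ 1 * σ ^ 3 := by gcongr; linarith
            _ = σ ^ 3 := one_mul _
        linarith
  refine ⟨hup, abs_le.2 ⟨?_, ?_⟩⟩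
  · have hXa := hm hX ha
    have : (1 + (r + Y)) * (1 + a) ≤ Real.exp (r + Y) * n := by
      refine mul_le_mul e2 hn' (by linarith) (Real.exp_pos _).le
    have := (abs_le.1 hXa).1
    have := neg_abs_le (a + r)
    have := (abs_le.1 hY).1
    linarith
  · have := le_abs_self (a + r)
    have := (abs_le.1 hY).2
    have := (abs_le.1 hrr).2
    have := (abs_le.1 hbb).2
    have := (abs_le.1 har).2
    linarith

/-- The complex number `g` for which the spatial differential at `p` of half the logarithm of the
conformal factor is `h ↦ Re (g h)`. -/
noncomputable def connForm (u : ℂ → ℝ → ℝ) (p : ℂ × ℝ) : ℂ :=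
  ⟨dirDeriv (logFactor u) (1, 0) p / 2, -(dirDeriv (logFactor u) (Complex.I, 0) p / 2)⟩

lemma re_connForm_mul (u : ℂ → ℝ → ℝ) (p : ℂ × ℝ) (h : ℂ) :
    (connForm u p * h).re = fderiv ℝ (logFactor u) p (h, 0) / 2 := by
  have hdec : ((h, 0) : ℂ × ℝ) = h.re • ((1, 0) : ℂ × ℝ) + h.im • ((Complex.I, 0) : ℂ × ℝ) := by
    ext <;> simp
  rw [hdec]
  simp only [map_add, map_smul, smul_eq_mul, Complex.mul_re, connForm, dirDeriv]
  ring

set_option maxHeartbeats 1000000 in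
lemma ConfRFS.pointwise_variation {T : ℝ} {M Kc : Set (ℂ × ℝ)} {u : ℂ → ℝ → ℝ}
    (h : ConfRFS T M u) (hK : IsCompact Kc) (hKM : Kc ⊆ M) {B ε : ℝ} (hB : 0 < B) (hε : 0 < ε) :
    ∃ ρ₀ > 0, ∀ ρ, 0 < ρ → ρ < ρ₀ → ∀ p ∈ Kc, ∀ (μ ν : ℂ) (F F' : ℝ),
      ‖μ‖ ^ 2 * u p.1 p.2 = 1 → ‖ν‖ = 1 → 0 ≤ F → F ≤ 1 → 0 ≤ F' → F' ≤ B →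
      (∀ w : ℂ, ‖w‖ = ρ → (p.1 + w * (F * μ), p.2 - ρ ^ 2 / 4) ∈ M ∧
        |Real.exp ((logFactor u (p.1 + w * (F * μ), p.2 - ρ ^ 2 / 4) - logFactor u p) / 2) *
          ‖1 + w * (F' * ν - F * connForm u p * μ)‖ - 1| ≤ ρ * (F' + ε)) ∧
      avgFour (fun w =>
        Real.exp ((logFactor u (p.1 + w * (F * μ), p.2 - ρ ^ 2 / 4) - logFactor u p) / 2) *
          ‖1 + w * (F' * ν - F * connForm u p * μ)‖) ρ ≤
        1 + ρ ^ 2 / 4 * (F' ^ 2 + scalarCurv u p / 2 * (1 - F ^ 2) + ε) := by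
  have hN := h.contDiffOn_logFactor
  set N := logFactor u with hNdef
  have hN1 : ContDiffOn ℝ ∞ (fderiv ℝ N) M := hN.fderiv_of_isOpen h.opn (by norm_cast)
  have hN2 : ContinuousOn (fderiv ℝ (fderiv ℝ N)) M :=
    hN1.continuousOn_fderiv_of_isOpen h.opn (by norm_cast)
  obtain ⟨C₁, hC₁⟩ := hK.exists_bound_of_continuousOn (E := ℂ × ℝ →L[ℝ] ℝ)
    (show ContinuousOn _ _ from hN1.continuousOn.mono hKM)
  obtain ⟨C₂, hC₂⟩ := hK.exists_bound_of_continuousOn (E := ℂ × ℝ →L[ℝ] ℂ × ℝ →L[ℝ] ℝ)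
    (show ContinuousOn _ _ from hN2.mono hKM)
  obtain ⟨C₃, hC₃⟩ := hK.exists_bound_of_continuousOn
    ((h.smooth.continuousOn.mono hKM).inv₀ fun p hp => (h.pos p (hKM hp)).ne')
  set E₁ := |C₁| + 1
  set E₂ := |C₂| + 1
  set E₃ := |C₃| + 1
  have hE₁ : 1 ≤ E₁ := by simp [E₁]
  have hE₂ : 1 ≤ E₂ := by simp [E₂]
  have hE₃ : 1 ≤ E₃ := by simp [E₃]
  obtain ⟨ρ₁, hρ₁, hT⟩ := parabolic_taylor h.opn hN hK hKM (B := E₃) (by positivity)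
    (ε := min 1 (ε / 4)) (by positivity)
  set D := B + 2 * E₁ * E₃ + E₂ * E₃ ^ 2 + E₁ + 1 with hD
  have hD0 : 0 < D := by positivity
  have hD1 : 1 ≤ D := by
    have : 0 ≤ B + 2 * E₁ * E₃ + E₂ * E₃ ^ 2 + E₁ := by positivity
    linarith
  refine ⟨min ρ₁ (min (1 / (4 * D)) (ε / (80 * D ^ 3))), by positivity, ?_⟩
  intro ρ hρ hρ0 p hp μ ν F F' hμ hν hF0 hF1 hF'0 hF'B
  have hρa : ρ < ρ₁ := hρ0.trans_le (min_le_left _ _)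
  have hρb : ρ * (4 * D) < 1 := by
    have := hρ0.trans_le ((min_le_right _ _).trans (min_le_left _ _))
    rwa [lt_div_iff₀ (by positivity)] at this
  have hρc : ρ * (80 * D ^ 3) < ε := by
    have := hρ0.trans_le ((min_le_right _ _).trans (min_le_right _ _))
    rwa [lt_div_iff₀ (by positivity)] at this
  have hpM := hKM hp
  have hu := h.pos p hpM
  set g := connForm u p with hg
  set q : ℂ := F' * ν - F * g * μ with hq
  set G : ℂ := g * (F * μ) with hG
  set τ := ρ ^ 2 / 4 with hτ
  have hDN : ‖fderiv ℝ N p‖ ≤ E₁ := (hC₁ p hp).trans ((le_abs_self C₁).trans (by simp [E₁]))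
  have hDDN : ‖fderiv ℝ (fderiv ℝ N) p‖ ≤ E₂ :=
    (hC₂ p hp).trans ((le_abs_self C₂).trans (by simp [E₂]))
  have hμ2 : ‖μ‖ ^ 2 ≤ E₃ := by
    have h1 : ‖μ‖ ^ 2 = (u p.1 p.2)⁻¹ := by field_simp; linarith
    have h2 := hC₃ p hp
    rw [Real.norm_eq_abs] at h2
    rw [h1]
    exact (le_abs_self _).trans (h2.trans ((le_abs_self C₃).trans (by simp [E₃])))
  have hμ1 : ‖μ‖ ≤ E₃ := by
    by_contra hc
    push Not at hc
    nlinarith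
  have hη : ‖(F : ℂ) * μ‖ ≤ E₃ := by
    rw [norm_mul, Complex.norm_real, Real.norm_eq_abs, abs_of_nonneg hF0]
    nlinarith [norm_nonneg μ]
  have hgn : ‖g‖ ≤ E₁ := by
    have hx : |g.re| ≤ E₁ / 2 := by
      have := ((fderiv ℝ N p).le_opNorm (1, 0)).trans
        (mul_le_mul_of_nonneg_right hDN (norm_nonneg _))
      have n1 : ‖((1, 0) : ℂ × ℝ)‖ = 1 := by simp [Prod.norm_def]
      rw [n1, Real.norm_eq_abs] at this
      simp only [hg, connForm, dirDeriv, abs_div, abs_two]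
      linarith
    have hy : |g.im| ≤ E₁ / 2 := by
      have := ((fderiv ℝ N p).le_opNorm (Complex.I, 0)).trans
        (mul_le_mul_of_nonneg_right hDN (norm_nonneg _))
      have n1 : ‖((Complex.I, 0) : ℂ × ℝ)‖ = 1 := by simp [Prod.norm_def]
      rw [n1, Real.norm_eq_abs] at this
      simp only [hg, connForm, dirDeriv, abs_neg, abs_div, abs_two]
      linarith
    linarith [Complex.norm_le_abs_re_add_abs_im g]
  have hGn : ‖G‖ ≤ E₁ * E₃ := by
    rw [hG, norm_mul]
    exact mul_le_mul hgn hη (norm_nonneg _) (by positivity)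
  have hqn : ‖q‖ ≤ B + E₁ * E₃ := by
    have e : q = F' * ν - G := by rw [hq, hG]; ring
    rw [e]
    refine (norm_sub_le _ _).trans (add_le_add ?_ hGn)
    rw [norm_mul, Complex.norm_real, hν, mul_one, Real.norm_eq_abs, abs_of_nonneg hF'0]
    exact hF'B
  have hNt : |fderiv ℝ N p (0, 1)| ≤ E₁ := by
    have := ((fderiv ℝ N p).le_opNorm (0, 1)).trans
      (mul_le_mul_of_nonneg_right hDN (norm_nonneg _))
    have n1 : ‖((0, 1) : ℂ × ℝ)‖ = 1 := by simp [Prod.norm_def]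
    rwa [n1, Real.norm_eq_abs, mul_one] at this
  have hsum : G + q = F' * ν := by rw [hq, hG]; ring
  have hEE : 0 ≤ E₁ * E₃ := by positivity
  have hEE2 : 0 ≤ E₂ * E₃ ^ 2 := by positivity
  have key : ∀ w : ℂ, ‖w‖ = ρ → (p.1 + w * (F * μ), p.2 - τ) ∈ M ∧
      Real.exp ((N (p.1 + w * (F * μ), p.2 - τ) - N p) / 2) * ‖1 + w * q‖ ≤
        1 + (w * q).re + (w * G).re + (w * G).re ^ 2 / 2 + (w * q).re * (w * G).re +
          (w * q).im ^ 2 / 2 + 1 / 4 * fderiv ℝ (fderiv ℝ N) p (w * (F * μ), 0) (w * (F * μ), 0) -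
          τ / 2 * fderiv ℝ N p (0, 1) + ε * ρ ^ 2 / 4 ∧
      |Real.exp ((N (p.1 + w * (F * μ), p.2 - τ) - N p) / 2) * ‖1 + w * q‖ - 1|
        ≤ ρ * (F' + ε) := by
    intro w hw
    have hwη : ‖w * ((F : ℂ) * μ)‖ ≤ E₃ * ρ := by
      rw [norm_mul, hw, mul_comm]; gcongr
    obtain ⟨hmem, htay⟩ := hT ρ hρ hρa p hp _ hwη
    refine ⟨hmem, ?_⟩
    have hlin : fderiv ℝ N p (w * (F * μ), 0) = 2 * (w * G).re := by
      have := re_connForm_mul u p (w * (F * μ))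
      rw [show w * G = connForm u p * (w * (F * μ)) by rw [hG, ← hg]; ring]
      linarith
    rw [hlin] at htay
    set Q := fderiv ℝ (fderiv ℝ N) p (w * (F * μ), 0) (w * (F * μ), 0) with hQ
    have hQb : |Q| ≤ E₂ * E₃ ^ 2 * ρ ^ 2 := by
      have h1 := (fderiv ℝ (fderiv ℝ N) p).le_opNorm₂ (w * (F * μ), 0) (w * (F * μ), 0)
      have n2 : ∀ z : ℂ, ‖((z, 0) : ℂ × ℝ)‖ = ‖z‖ := fun z => by simp [Prod.norm_def]
      rw [n2, Real.norm_eq_abs] at h1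
      calc |Q| ≤ _ := h1
        _ ≤ E₂ * (E₃ * ρ) * (E₃ * ρ) := by gcongr
        _ = _ := by ring
    set Y := (N (p.1 + w * (F * μ), p.2 - τ) - N p) / 2 - (w * G).re with hYdef
    have hYapprox : |Y - (1 / 4 * Q - τ / 2 * fderiv ℝ N p (0, 1))| ≤
        min 1 (ε / 4) * ρ ^ 2 / 2 := by
      have e : Y - (1 / 4 * Q - τ / 2 * fderiv ℝ N p (0, 1)) =
        (N (p.1 + w * (F * μ), p.2 - τ) - N p - 2 * (w * G).re - 1 / 2 * Q +
          τ * fderiv ℝ N p (0, 1)) / 2 := by rw [hYdef]; ring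
      rw [e, abs_div, abs_two]
      linarith
    have hYb : |Y| ≤ (D * ρ) ^ 2 := by
      have h1 : |Y| ≤ |Y - (1 / 4 * Q - τ / 2 * fderiv ℝ N p (0, 1))| + |1 / 4 * Q| +
          |τ / 2 * fderiv ℝ N p (0, 1)| := by
        calc |Y| = |(Y - (1 / 4 * Q - τ / 2 * fderiv ℝ N p (0, 1))) + 1 / 4 * Q
              - τ / 2 * fderiv ℝ N p (0, 1)| := by congr 1; ring
          _ ≤ _ := (abs_sub _ _).trans (by gcongr; exact abs_add_le _ _)
      rw [abs_mul, abs_mul, abs_of_pos (show (0:ℝ) < 1/4 by norm_num),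
        abs_of_pos (show 0 < τ / 2 by positivity)] at h1
      have h2 : min 1 (ε / 4) ≤ 1 := min_le_left _ _
      have h3 : min 1 (ε / 4) * ρ ^ 2 ≤ 1 * ρ ^ 2 := by gcongr
      have h4 : τ / 2 * |fderiv ℝ N p (0, 1)| ≤ τ / 2 * E₁ := by gcongr
      have h5 : D * ρ ^ 2 ≤ (D * ρ) ^ 2 := by
        rw [mul_pow]; gcongr; exact le_self_pow₀ hD1 two_ne_zero
      have h6 : (E₂ * E₃ ^ 2 + E₁ + 1) * ρ ^ 2 ≤ D * ρ ^ 2 := by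
        gcongr; rw [hD]; linarith
      have h7 : 0 ≤ E₂ * E₃ ^ 2 * ρ ^ 2 := by positivity
      have h8 : 0 ≤ E₁ * ρ ^ 2 := by positivity
      have h9 : 0 ≤ ρ ^ 2 := by positivity
      rw [hτ] at h4
      rw [hτ] at h1
      linarith
    have hqw : ‖w * q‖ ≤ D * ρ := by
      rw [norm_mul, hw, mul_comm]
      gcongr
      refine hqn.trans ?_
      rw [hD]; linarith
    have hGw : ‖w * G‖ ≤ D * ρ := by
      rw [norm_mul, hw, mul_comm]
      gcongr
      refine hGn.trans ?_
      rw [hD]; linarith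
    obtain ⟨c1, c2⟩ := exp_mul_norm_expansion (ζ := w * q) (σ := D * ρ) (r := (w * G).re) (Y := Y)
      (by linarith) ((Complex.abs_re_le_norm _).trans hqw) ((Complex.abs_im_le_norm _).trans hqw)
      ((Complex.abs_re_le_norm _).trans hGw) hYb
    have hXY : (w * G).re + Y = (N (p.1 + w * (F * μ), p.2 - τ) - N p) / 2 := by
      rw [hYdef]; ring
    rw [hXY] at c1 c2
    constructor
    · have h1 := (abs_le.1 hYapprox).2
      have h2 : min 1 (ε / 4) * ρ ^ 2 ≤ ε / 4 * ρ ^ 2 := by gcongr; exact min_le_right _ _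
      have h3 : 10 * (D * ρ) ^ 3 ≤ ε / 8 * ρ ^ 2 := by
        have : ρ ^ 2 * (ρ * (80 * D ^ 3)) ≤ ρ ^ 2 * ε := by gcongr
        linarith
      linarith
    · refine c2.trans ?_
      have h1 : |(w * q).re + (w * G).re| ≤ ρ * F' := by
        have e : (w * q).re + (w * G).re = (w * (F' * ν)).re := by
          rw [← hsum, mul_add, Complex.add_re]; ring
        rw [e]
        refine (Complex.abs_re_le_norm _).trans (le_of_eq ?_)
        rw [norm_mul, norm_mul, hw, hν, Complex.norm_real, Real.norm_eq_abs, abs_of_nonneg hF'0,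
          mul_one]
      have h2 : 6 * (D * ρ) ^ 2 ≤ ρ * ε := by
        have h3 : D ^ 2 ≤ D ^ 3 := pow_le_pow_right₀ hD1 (by norm_num)
        have h3' : 0 ≤ D ^ 2 := by positivity
        have h4 : ρ * (6 * D ^ 2) ≤ ε :=
          (mul_le_mul_of_nonneg_left (show 6 * D ^ 2 ≤ 80 * D ^ 3 by linarith) hρ.le).trans hρc.le
        have h5 := mul_le_mul_of_nonneg_left h4 hρ.le
        linarith
      linarith
  refine ⟨fun w hw => ⟨(key w hw).1, (key w hw).2.2⟩, ?_⟩
  refine (avgFour_mono hρ fun w hw => (key w hw).2.1).trans (le_of_eq ?_)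
  have hH := avgFour_hessian (hN.contDiffAt (h.opn.mem_nhds hpM)) (F * μ) ρ
  have hlap := h.spaceLap_logFactor hpM
  have hFν : (G.re + q.re) ^ 2 + (G.im + q.im) ^ 2 = F' ^ 2 := by
    have := congrArg (fun z : ℂ => ‖z‖ ^ 2) hsum
    simp only [norm_mul, hν, mul_one, Complex.norm_real, Real.norm_eq_abs, sq_abs] at this
    rw [← this, ← Complex.normSq_eq_norm_sq, Complex.normSq_apply]
    simp only [Complex.add_re, Complex.add_im]
    ring
  have hnη : ‖(F : ℂ) * μ‖ ^ 2 = F ^ 2 * ‖μ‖ ^ 2 := by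
    rw [norm_mul, mul_pow, Complex.norm_real, Real.norm_eq_abs, sq_abs]
  rw [← hNdef] at hlap
  rw [hlap, hnη] at hH
  have hH' : avgFour (fun w => fderiv ℝ (fderiv ℝ N) p (w * (F * μ), 0) (w * (F * μ), 0)) ρ =
      ρ ^ 2 / 2 * F ^ 2 * fderiv ℝ N p (0, 1) := by
    rw [hH]
    unfold dirDeriv
    linear_combination (ρ ^ 2 / 2 * F ^ 2 * fderiv ℝ N p (0, 1)) * hμ
  have hS : scalarCurv u p = -fderiv ℝ N p (0, 1) := rfl
  rw [hS]
  clear_value q G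
  unfold avgFour at hH' ⊢
  beta_reduce at hH' ⊢
  simp only [Complex.mul_re, Complex.mul_im, Complex.neg_re, Complex.neg_im, Complex.ofReal_re,
    Complex.ofReal_im, Complex.I_re, Complex.I_im]
  rw [hτ]
  linear_combination (1 / 4) * hH' + (ρ ^ 2 / 4) * hFν

lemma hasDerivAt_max_zero_pow (n : ℕ) (x : ℝ) :
    HasDerivAt (fun x : ℝ => max x 0 ^ (n + 2)) ((n + 2) * max x 0 ^ (n + 1)) x := by
  rcases lt_trichotomy x 0 with hx | hx | hx
  · have : (fun _ : ℝ => (0 : ℝ)) =ᶠ[nhds x] fun x : ℝ => max x 0 ^ (n + 2) := by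
      filter_upwards [Iio_mem_nhds hx] with y hy
      rw [max_eq_right (le_of_lt hy)]; simp
    have h2 := (hasDerivAt_const x (0 : ℝ)).congr_of_eventuallyEq this.symm
    simpa [max_eq_right hx.le] using h2
  · subst hx
    rw [hasDerivAt_iff_isLittleO_nhds_zero]
    simp only [zero_add, max_self, ne_eq, Nat.add_eq_zero_iff, OfNat.ofNat_ne_zero, and_false,
      not_false_eq_true, zero_pow, sub_zero, one_ne_zero, mul_zero, smul_zero]
    have h1 : (fun h : ℝ => max h 0 ^ (n + 2)) =O[nhds 0] fun h : ℝ => h ^ (n + 2) := by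
      refine Asymptotics.isBigO_of_le _ fun h => ?_
      rw [norm_pow, norm_pow, Real.norm_eq_abs, Real.norm_eq_abs, abs_of_nonneg (le_max_right _ _)]
      gcongr
      exact max_le (le_abs_self h) (abs_nonneg h)
    have h2 : (fun h : ℝ => h ^ (n + 2)) =o[nhds 0] fun h : ℝ => h := by
      simpa using Asymptotics.isLittleO_pow_pow (𝕜 := ℝ) (m := 1) (n := n + 2) (by omega)
    exact h1.trans_isLittleO h2
  · have : (fun x : ℝ => x ^ (n + 2)) =ᶠ[nhds x] fun x : ℝ => max x 0 ^ (n + 2) := by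
      filter_upwards [Ioi_mem_nhds hx] with y hy
      rw [max_eq_left (le_of_lt hy)]
    have h2 := (hasDerivAt_pow (n + 2) x).congr_of_eventuallyEq this.symm
    rw [max_eq_left hx.le]
    simpa using h2

lemma ConfRFS.continuousOn_connForm {T : ℝ} {M : Set (ℂ × ℝ)} {u : ℂ → ℝ → ℝ}
    (h : ConfRFS T M u) : ContinuousOn (connForm u) M := by
  have h1 := (contDiffOn_dirDeriv h.opn h.contDiffOn_logFactor (1, 0)).continuousOn
  have h2 := (contDiffOn_dirDeriv h.opn h.contDiffOn_logFactor (Complex.I, 0)).continuousOn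
  have : connForm u = fun p => ((dirDeriv (logFactor u) (1, 0) p / 2 : ℝ) : ℂ) +
      ((-(dirDeriv (logFactor u) (Complex.I, 0) p / 2) : ℝ) : ℂ) * Complex.I := by
    funext p
    exact Complex.mk_eq_add_mul_I _ _
  rw [this]
  exact (Complex.continuous_ofReal.comp_continuousOn (h1.div_const 2)).add
    ((Complex.continuous_ofReal.comp_continuousOn (h2.div_const 2).neg).mul continuousOn_const)

/-- Parallel transport along a path for the conformal metric. -/
lemma ConfRFS.exists_parallel {T : ℝ} {M : Set (ℂ × ℝ)} {u : ℂ → ℝ → ℝ}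
    (h : ConfRFS T M u) {t : ℝ} {c : ℝ → ℂ} (hc : ContDiff ℝ 1 c) (hcM : ∀ s, (c s, t) ∈ M)
    {a : ℂ} (ha : ‖a‖ ^ 2 * u (c 1) t = 1) :
    ∃ μ : ℝ → ℂ, μ 1 = a ∧ (∀ s, ‖μ s‖ ^ 2 * u (c s) t = 1) ∧
      ∀ s, HasDerivAt μ (-(connForm u (c s, t) * deriv c s * μ s)) s := by
  have hct : Continuous fun s => (c s, t) := hc.continuous.prodMk continuous_const
  have hg : Continuous fun s => connForm u (c s, t) * deriv c s :=
    (h.continuousOn_connForm.comp_continuous hct hcM).mul (hc.continuous_deriv le_rfl)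
  set I : ℝ → ℂ := fun s => ∫ σ in (1 : ℝ)..s, connForm u (c σ, t) * deriv c σ with hI
  have hId : ∀ s, HasDerivAt I (connForm u (c s, t) * deriv c s) s := fun s =>
    hg.integral_hasStrictDerivAt 1 s |>.hasDerivAt
  have hI1 : I 1 = 0 := by simp [hI]
  refine ⟨fun s => a * Complex.exp (-I s), by simp [hI1], fun s => ?_, fun s => ?_⟩
  · set k : ℝ → ℝ := fun s => logFactor u (c s, t) / 2 - (I s).re with hk
    have hkd : ∀ s, HasDerivAt k 0 s := by
      intro s
      have hd : DifferentiableAt ℝ (logFactor u) (c s, t) :=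
        (h.contDiffOn_logFactor.contDiffAt (h.opn.mem_nhds (hcM s))).differentiableAt (by simp)
      have hcd : HasDerivAt (fun s => (c s, t)) (deriv c s, 0) s :=
        (hc.differentiable one_ne_zero s).hasDerivAt.prodMk (hasDerivAt_const _ _)
      have h1 : HasDerivAt (fun s => logFactor u (c s, t)) _ s :=
        HasFDerivAt.comp_hasDerivAt (l := logFactor u) (f := fun s => (c s, t)) s
          hd.hasFDerivAt hcd
      have h2 : HasDerivAt (fun s => (I s).re) (connForm u (c s, t) * deriv c s).re s :=
        Complex.reCLM.hasFDerivAt.comp_hasDerivAt s (hId s)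
      refine ((h1.div_const 2).sub h2).congr_deriv ?_
      rw [re_connForm_mul]; ring
    have hconst : k s = k 1 := is_const_of_deriv_eq_zero
      (fun s => (hkd s).differentiableAt) (fun s => (hkd s).deriv) s 1
    simp only [hk, hI1, Complex.zero_re, sub_zero] at hconst
    rw [norm_mul, Complex.norm_exp, Complex.neg_re, mul_pow, ← Real.exp_nat_mul,
      ← h.exp_logFactor (hcM s), mul_assoc, ← Real.exp_add, ← ha, ← h.exp_logFactor (hcM 1)]
    congr 2
    push_cast
    linarith
  · have := ((hId s).neg.cexp).const_mul a
    refine this.congr_deriv ?_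
    simp only [Pi.neg_apply]
    ring

/-- The length parameter along a path for the metric at time `t`. -/
noncomputable def pathLength (u : ℂ → ℝ → ℝ) (t : ℝ) (c : ℝ → ℂ) (s : ℝ) : ℝ :=
  ∫ σ in (0 : ℝ)..s, √(u (c σ) t) * ‖deriv c σ‖

lemma ConfRFS.continuous_speed {T : ℝ} {M : Set (ℂ × ℝ)} {u : ℂ → ℝ → ℝ}
    (h : ConfRFS T M u) {t : ℝ} {c : ℝ → ℂ} (hc : ContDiff ℝ 1 c) (hcM : ∀ s, (c s, t) ∈ M) :
    Continuous fun s => √(u (c s) t) * ‖deriv c s‖ := by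
  have hct : Continuous fun s => (c s, t) := hc.continuous.prodMk continuous_const
  exact (Real.continuous_sqrt.comp (h.smooth.continuousOn.comp_continuous hct hcM)).mul
    (hc.continuous_deriv le_rfl).norm

lemma ConfRFS.hasDerivAt_pathLength {T : ℝ} {M : Set (ℂ × ℝ)} {u : ℂ → ℝ → ℝ}
    (h : ConfRFS T M u) {t : ℝ} {c : ℝ → ℂ} (hc : ContDiff ℝ 1 c) (hcM : ∀ s, (c s, t) ∈ M)
    (s : ℝ) : HasDerivAt (pathLength u t c) (√(u (c s) t) * ‖deriv c s‖) s :=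
  ((h.continuous_speed hc hcM).integral_hasStrictDerivAt 0 s).hasDerivAt

lemma pathLength_nonneg (u : ℂ → ℝ → ℝ) (t : ℝ) (c : ℝ → ℂ) {s : ℝ} (hs : 0 ≤ s) :
    0 ≤ pathLength u t c s :=
  intervalIntegral.integral_nonneg hs fun _ _ => by positivity

lemma avgFour_integral {f : ℂ → ℝ → ℝ} {a b ρ : ℝ}
    (hf : ∀ w : ℂ, ‖w‖ = ρ → IntervalIntegrable (f w) volume a b) (hρ : 0 ≤ ρ) :
    avgFour (fun w => ∫ s in a..b, f w s) ρ = ∫ s in a..b, avgFour (fun w => f w s) ρ := by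
  have h1 := hf ρ (by simp [hρ])
  have h2 := hf (Complex.I * ρ) (by simp [hρ])
  have h3 := hf (-ρ) (by simp [hρ])
  have h4 := hf (-(Complex.I * ρ)) (by simp [hρ])
  unfold avgFour
  rw [intervalIntegral.integral_div, intervalIntegral.integral_add ((h1.add h2).add h3) h4,
    intervalIntegral.integral_add (h1.add h2) h3, intervalIntegral.integral_add h1 h2]

set_option maxHeartbeats 1000000 in
lemma ConfRFS.path_variation {T : ℝ} {M Kc : Set (ℂ × ℝ)} {u : ℂ → ℝ → ℝ}
    (h : ConfRFS T M u) (hK : IsCompact Kc) (hKM : Kc ⊆ M) {r₀ ε : ℝ} (hr₀ : 0 < r₀)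
    (hε : 0 < ε) :
    ∃ ρ₀ > 0, ∀ ρ, 0 < ρ → ρ < ρ₀ → ∀ (t : ℝ) (c : ℝ → ℂ), ContDiff ℝ 1 c →
      (∀ s, (c s, t) ∈ M) → (∀ s ∈ Icc (0 : ℝ) 1, (c s, t) ∈ Kc) →
      (∀ s ∈ Icc (0 : ℝ) 1, pathLength u t c s < r₀ →
        scalarCurv u (c s, t) / 2 ≤ (r₀ ^ 2)⁻¹) →
      r₀ ≤ pathLength u t c 1 → ∀ a : ℂ, ‖a‖ ^ 2 * u (c 1) t = 1 →
      ∃ Lw : ℂ → ℝ, (∀ w : ℂ, ‖w‖ = ρ →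
          C1Joined (fun z => u z (t - ρ ^ 2 / 4)) (timeSlice M (t - ρ ^ 2 / 4)) (c 0) (c 1 + w * a)
            (Lw w) ∧
          |Lw w - pathLength u t c 1| ≤ ρ * (1 + ε * pathLength u t c 1)) ∧
        avgFour Lw ρ ≤ pathLength u t c 1 +
          ρ ^ 2 / 4 * (9 / 5 / r₀ + ε * pathLength u t c 1) := by
  obtain ⟨ρ₀, hρ₀, hvar⟩ := h.pointwise_variation hK hKM (B := 2 / r₀) (by positivity) hε
  refine ⟨ρ₀, hρ₀, fun ρ hρ hρ1 t c hc hcM hcK hcurv hL a ha => ?_⟩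
  obtain ⟨μ, hμ1, hμn, hμd⟩ := h.exists_parallel hc hcM ha
  set ℓ := pathLength u t c with hℓ
  set τ := ρ ^ 2 / 4 with hτ
  have hℓd := h.hasDerivAt_pathLength hc hcM
  have hℓ0 : ℓ 0 = 0 := by simp [hℓ, pathLength]
  set m : ℝ → ℝ := fun s => max (1 - ℓ s / r₀) 0 with hm
  have hm1 : m 1 = 0 := by
    rw [hm]
    refine max_eq_right ?_
    rw [sub_nonpos, le_div_iff₀ hr₀]
    linarith
  have hm0 : m 0 = 1 := by simp [hm, hℓ0]
  have hmnn : ∀ s, 0 ≤ m s := fun s => le_max_right _ _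
  have hmle : ∀ s ∈ Icc (0 : ℝ) 1, m s ≤ 1 := by
    intro s hs
    refine max_le ?_ zero_le_one
    have : 0 ≤ ℓ s / r₀ := div_nonneg (pathLength_nonneg u t c hs.1) hr₀.le
    linarith
  set v : ℝ → ℝ := fun s => √(u (c s) t) * ‖deriv c s‖ with hv
  have hvc : Continuous v := h.continuous_speed hc hcM
  have hvnn : ∀ s, 0 ≤ v s := fun s => by positivity
  have hmpow : ∀ (n : ℕ) (s : ℝ), HasDerivAt (fun s => m s ^ (n + 2))
      ((n + 2) * m s ^ (n + 1) * -(v s / r₀)) s := by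
    intro n s
    have h1 : HasDerivAt (fun s => 1 - ℓ s / r₀) (-(v s / r₀)) s :=
      ((hℓd s).div_const r₀).const_sub 1
    exact HasDerivAt.comp (h₂ := fun x : ℝ => max x 0 ^ (n + 2)) s
      (hasDerivAt_max_zero_pow n _) h1
  have hℓc : Continuous ℓ := continuous_iff_continuousAt.2 fun s => (hℓd s).continuousAt
  have hmc : Continuous m := by
    exact (continuous_const.sub (hℓc.div_const _)).max continuous_const
  have hμc : Continuous μ := continuous_iff_continuousAt.2 fun s => (hμd s).continuousAt
  have hct : Continuous fun s => (c s, t) := hc.continuous.prodMk continuous_const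
  have hdc : Continuous (deriv c) := hc.continuous_deriv le_rfl
  have hgc : Continuous fun s => connForm u (c s, t) :=
    h.continuousOn_connForm.comp_continuous hct hcM
  set F : ℝ → ℝ := fun s => 1 - m s ^ 2 with hF
  set F' : ℝ → ℝ := fun s => 2 * m s / r₀ with hF'
  have hFd : ∀ s, HasDerivAt F (F' s * v s) s := by
    intro s
    refine ((hmpow 0 s).const_sub 1).congr_deriv ?_
    simp only [hF']
    push_cast
    ring
  set η : ℝ → ℂ := fun s => (F s : ℂ) * μ s with hη
  have hηd : ∀ s, HasDerivAt η ((F' s * v s : ℝ) * μ s -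
      F s * connForm u (c s, t) * deriv c s * μ s) s := by
    intro s
    refine ((hFd s).ofReal_comp.mul (hμd s)).congr_deriv ?_
    ring
  set ν : ℝ → ℂ := fun s => if deriv c s = 0 then (√(u (c s) t) : ℂ) * μ s else
    (v s : ℂ) * μ s / deriv c s with hν
  have hμs : ∀ s, √(u (c s) t) * ‖μ s‖ = 1 := by
    intro s
    have h1 : (√(u (c s) t) * ‖μ s‖) ^ 2 = 1 := by
      rw [mul_pow, Real.sq_sqrt (h.pos _ (hcM s)).le, mul_comm]; exact hμn s
    exact (pow_eq_one_iff_of_nonneg (by positivity) two_ne_zero).1 h1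
  have hνn : ∀ s, ‖ν s‖ = 1 := by
    intro s
    simp only [hν]
    split_ifs with hd
    · rw [norm_mul, Complex.norm_real, Real.norm_eq_abs, abs_of_nonneg (Real.sqrt_nonneg _), hμs]
    · have hd' : ‖deriv c s‖ ≠ 0 := by simpa using hd
      rw [norm_div, norm_mul, Complex.norm_real, Real.norm_eq_abs, abs_of_nonneg (hvnn s),
        div_eq_one_iff_eq hd', hv]
      calc √(u (c s) t) * ‖deriv c s‖ * ‖μ s‖ = √(u (c s) t) * ‖μ s‖ * ‖deriv c s‖ := by ring
        _ = _ := by rw [hμs, one_mul]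
  set q : ℝ → ℂ := fun s => F' s * ν s - F s * connForm u (c s, t) * μ s with hq
  have hηq : ∀ s, (F' s * v s : ℝ) * μ s - F s * connForm u (c s, t) * deriv c s * μ s =
      deriv c s * q s := by
    intro s
    simp only [hq, hν]
    split_ifs with hd
    · have : v s = 0 := by simp [hv, hd]
      rw [this, hd]; simp
    · push_cast
      field_simp
  set cw : ℂ → ℝ → ℂ := fun w s => c s + w * η s with hcw
  have hcwd : ∀ w s, HasDerivAt (cw w) (deriv c s * (1 + w * q s)) s := by
    intro w s
    refine ((hc.differentiable one_ne_zero s).hasDerivAt.add ((hηd s).const_mul w)).congr_deriv ?_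
    rw [hηq]; ring
  have hcwc : ∀ w, ContDiff ℝ 1 (cw w) := by
    intro w
    rw [contDiff_one_iff_deriv]
    refine ⟨fun s => (hcwd w s).differentiableAt, ?_⟩
    have : deriv (cw w) = fun s => deriv c s + w * ((F' s * v s : ℝ) * μ s -
      F s * connForm u (c s, t) * deriv c s * μ s) := by
      funext s
      rw [(hcwd w s).deriv, hηq]; ring
    rw [this]
    simp only [hF', hF]
    fun_prop
  have hbound : ∀ s ∈ Icc (0 : ℝ) 1, _ := fun s hs =>
    hvar ρ hρ hρ1 (c s, t) (hcK s hs) (μ s) (ν s) (F s) (F' s) (hμn s) (hνn s)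
      (by have := hmle s hs; have := hmnn s; simp only [hF]; nlinarith)
      (by simp only [hF]; nlinarith [sq_nonneg (m s)])
      (by have := hmnn s; simp only [hF']; positivity)
      (by have := hmle s hs; simp only [hF']; gcongr; linarith)
  have hcwM : ∀ w : ℂ, ‖w‖ = ρ → ∀ s ∈ Icc (0 : ℝ) 1, (cw w s, t - τ) ∈ M :=
    fun w hw s hs => ((hbound s hs).1 w hw).1
  set Θ : ℂ → ℝ → ℝ := fun w s =>
    Real.exp ((logFactor u (cw w s, t - τ) - logFactor u (c s, t)) / 2) * ‖1 + w * q s‖ with hΘ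
  have hΘb : ∀ w : ℂ, ‖w‖ = ρ → ∀ s ∈ Icc (0 : ℝ) 1, |Θ w s - 1| ≤ ρ * (F' s + ε) :=
    fun w hw s hs => ((hbound s hs).1 w hw).2
  have hΘavg : ∀ s ∈ Icc (0 : ℝ) 1, avgFour (fun w => Θ w s) ρ ≤
      1 + τ * (F' s ^ 2 + scalarCurv u (c s, t) / 2 * (1 - F s ^ 2) + ε) :=
    fun s hs => (hbound s hs).2
  have hspeed : ∀ w : ℂ, ‖w‖ = ρ → ∀ s ∈ Icc (0 : ℝ) 1,
      √(u (cw w s) (t - τ)) * ‖deriv (cw w) s‖ = v s * Θ w s := by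
    intro w hw s hs
    have h1 := h.exp_logFactor (hcwM w hw s hs)
    have h2 := h.exp_logFactor (hcM s)
    simp only [hv, hΘ]
    rw [(hcwd w s).deriv, norm_mul, ← h1, ← h2, ← Real.exp_half, ← Real.exp_half, sub_div,
      Real.exp_sub]
    have := Real.exp_pos (logFactor u (c s, t) / 2)
    field_simp
  have hint : ∀ w : ℂ, ‖w‖ = ρ → IntervalIntegrable (fun s => v s * Θ w s) volume 0 1 := by
    intro w hw
    have hco : ContinuousOn (fun s => √(u (cw w s) (t - τ)) * ‖deriv (cw w) s‖) (uIcc 0 1) := by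
      rw [uIcc_of_le zero_le_one]
      have hcc : Continuous fun s => (cw w s, t - τ) := (hcwc w).continuous.prodMk continuous_const
      refine ContinuousOn.mul (Real.continuous_sqrt.comp_continuousOn ?_)
        ((hcwc w).continuous_deriv le_rfl).norm.continuousOn
      exact h.smooth.continuousOn.comp hcc.continuousOn fun s hs => hcwM w hw s hs
    refine hco.intervalIntegrable.congr ?_
    rw [uIoc_of_le zero_le_one]
    intro s hs
    exact hspeed w hw s ⟨hs.1.le, hs.2⟩
  have hL1 : ∫ s in (0 : ℝ)..1, v s = ℓ 1 := rfl
  have hvi : IntervalIntegrable v volume 0 1 := hvc.intervalIntegrable _ _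
  refine ⟨fun w => ∫ s in (0 : ℝ)..1, v s * Θ w s, fun w hw => ⟨?_, ?_⟩, ?_⟩
  · have hvw : ContinuousOn (fun z => u z (t - τ)) (timeSlice M (t - τ)) :=
      h.smooth.continuousOn.comp (f := fun z : ℂ => (z, t - τ)) (by fun_prop) fun z hz => hz
    have := C1Joined.of_Icc hvw (c := cw w) zero_le_one (hcwc w).contDiffOn (hcwM w hw)
    have e0 : cw w 0 = c 0 := by simp [hcw, hη, hF, hm0]
    have e1 : cw w 1 = c 1 + w * a := by simp [hcw, hη, hF, hm1, hμ1]
    rw [e0, e1] at this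
    convert this using 1
    refine intervalIntegral.integral_congr fun s hs => ?_
    rw [uIcc_of_le zero_le_one] at hs
    rw [← hspeed w hw s hs, ((hcwc w).differentiable one_ne_zero s).derivWithin
      (uniqueDiffOn_Icc zero_lt_one s hs)]
  · rw [← hL1, ← intervalIntegral.integral_sub (hint w hw) hvi]
    have hFi : IntervalIntegrable (fun s => F' s * v s) volume 0 1 := by
      refine Continuous.intervalIntegrable ?_ _ _
      simp only [hF']
      fun_prop
    have hFint : ∫ s in (0 : ℝ)..1, F' s * v s = 1 := by
      rw [intervalIntegral.integral_eq_sub_of_hasDerivAt (fun s _ => hFd s) hFi]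
      simp [hF, hm0, hm1]
    have hrhs : ρ * (1 + ε * ∫ s in (0 : ℝ)..1, v s) =
        ∫ s in (0 : ℝ)..1, ρ * (F' s * v s + ε * v s) := by
      rw [intervalIntegral.integral_const_mul, intervalIntegral.integral_add hFi
        (hvi.const_mul ε), intervalIntegral.integral_const_mul, hFint]
    rw [hrhs]
    refine (intervalIntegral.norm_integral_le_of_norm_le (f := fun s => v s * Θ w s - v s)
      zero_le_one ?_ ((hFi.add (hvi.const_mul ε)).const_mul ρ))
    refine ae_of_all _ fun s hs => ?_
    have h1 := hΘb w hw s ⟨hs.1.le, hs.2⟩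
    calc ‖v s * Θ w s - v s‖ = v s * |Θ w s - 1| := by
          rw [← mul_sub_one, norm_mul, Real.norm_eq_abs, Real.norm_eq_abs, abs_of_nonneg (hvnn s)]
      _ ≤ v s * (ρ * (F' s + ε)) := mul_le_mul_of_nonneg_left h1 (hvnn s)
      _ = _ := by ring
  · rw [avgFour_integral hint hρ.le]
    set P : ℝ → ℝ := fun s => -(r₀ * (2 * m s ^ 3 - m s ^ 5 / 5)) with hP
    have hPd : ∀ s, HasDerivAt P (v s * (6 * m s ^ 2 - m s ^ 4)) s := by
      intro s
      refine ((((hmpow 1 s).const_mul 2).sub ((hmpow 3 s).div_const 5)).const_mul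
        r₀).neg.congr_deriv ?_
      push_cast
      field_simp
      ring
    have hPc : Continuous fun s => v s * (6 * m s ^ 2 - m s ^ 4) := by fun_prop
    have hPi := hPc.intervalIntegrable (μ := volume) 0 1
    have hPint : ∫ s in (0 : ℝ)..1, v s * (6 * m s ^ 2 - m s ^ 4) = 9 / 5 * r₀ := by
      rw [intervalIntegral.integral_eq_sub_of_hasDerivAt (fun s _ => hPd s) hPi]
      simp [hP, hm0, hm1]
      ring
    have hrhs : ℓ 1 + τ * (9 / 5 / r₀ + ε * ℓ 1) = ∫ s in (0 : ℝ)..1,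
        (v s + τ * (v s * (6 * m s ^ 2 - m s ^ 4) / r₀ ^ 2 + ε * v s)) := by
      rw [intervalIntegral.integral_add hvi (((hPi.div_const _).add (hvi.const_mul ε)).const_mul τ),
        intervalIntegral.integral_const_mul, intervalIntegral.integral_add (hPi.div_const _)
        (hvi.const_mul ε), intervalIntegral.integral_const_mul, intervalIntegral.integral_div,
        hPint, hL1]
      field_simp
    rw [hrhs]
    refine intervalIntegral.integral_mono_on zero_le_one ?_
      (hvi.add (((hPi.div_const _).add (hvi.const_mul ε)).const_mul τ)) fun s hs => ?_
    · have h1 := hint ρ (by simp [hρ.le])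
      have h2 := hint (Complex.I * ρ) (by simp [hρ.le])
      have h3 := hint (-ρ) (by simp [hρ.le])
      have h4 := hint (-(Complex.I * ρ)) (by simp [hρ.le])
      exact (((h1.add h2).add h3).add h4).div_const 4
    · have e : avgFour (fun w => v s * Θ w s) ρ = v s * avgFour (fun w => Θ w s) ρ := by
        unfold avgFour; ring
      rw [e]
      have h1 := mul_le_mul_of_nonneg_left (hΘavg s hs) (hvnn s)
      refine h1.trans ?_
      have h2 : F' s ^ 2 + scalarCurv u (c s, t) / 2 * (1 - F s ^ 2) ≤
          (6 * m s ^ 2 - m s ^ 4) / r₀ ^ 2 := by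
        have hF2 : F' s ^ 2 = 4 * m s ^ 2 / r₀ ^ 2 := by simp only [hF']; ring
        have hF3 : 1 - F s ^ 2 = m s ^ 2 * (2 - m s ^ 2) := by simp only [hF]; ring
        have hm2 : m s ^ 2 ≤ 1 := pow_le_one₀ (hmnn s) (hmle s hs)
        rw [hF2, hF3]
        rcases lt_or_ge (ℓ s) r₀ with hlt | hge
        · have := hcurv s hs hlt
          have h5 : 0 ≤ m s ^ 2 * (2 - m s ^ 2) := mul_nonneg (sq_nonneg _) (by linarith)
          have h6 := mul_le_mul_of_nonneg_right this h5
          calc _ ≤ 4 * m s ^ 2 / r₀ ^ 2 + (r₀ ^ 2)⁻¹ * (m s ^ 2 * (2 - m s ^ 2)) := by linarith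
            _ = _ := by field_simp; ring
        · have : m s = 0 := by
            refine max_eq_right ?_
            rw [sub_nonpos, le_div_iff₀ hr₀]; linarith
          rw [this]; simp
      have h3 : 0 ≤ v s * τ := mul_nonneg (hvnn s) (by positivity)
      have h4 := mul_le_mul_of_nonneg_left h2 h3
      calc _ = v s + v s * τ * (F' s ^ 2 + scalarCurv u (c s, t) / 2 * (1 - F s ^ 2))
            + v s * τ * ε := by ring
        _ ≤ v s + v s * τ * ((6 * m s ^ 2 - m s ^ 4) / r₀ ^ 2) + v s * τ * ε := by linarith
        _ = _ := by ring

lemma C1Joined.symm {v : ℂ → ℝ} {Ω : Set ℂ} {x y : ℂ} {L : ℝ} (hJ : C1Joined v Ω x y L) :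
    C1Joined v Ω y x L := by
  obtain ⟨c, hc, hcΩ, h0, h1, hL⟩ := hJ
  have hd : ∀ s, deriv (fun s => c (1 - s)) s = -deriv c (1 - s) := fun s =>
    deriv_comp_const_sub c 1 s
  refine ⟨fun s => c (1 - s), hc.comp (contDiff_const.sub contDiff_id), fun s => hcΩ _,
    by simpa using h1, by simpa using h0, ?_⟩
  simp only [hd, norm_neg]
  rw [intervalIntegral.integral_comp_sub_left (fun s => √(v (c s)) * ‖deriv c s‖) 1]
  simpa using hL

lemma ConfRFS.continuousOn_slice {T : ℝ} {M : Set (ℂ × ℝ)} {u : ℂ → ℝ → ℝ} (h : ConfRFS T M u)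
    (t : ℝ) : ContinuousOn (fun z => u z t) (timeSlice M t) :=
  h.smooth.continuousOn.comp (f := fun z : ℂ => (z, t)) (by fun_prop) fun _ hz => hz

lemma ConfRFS.isOpen_timeSlice {T : ℝ} {M : Set (ℂ × ℝ)} {u : ℂ → ℝ → ℝ} (h : ConfRFS T M u)
    (t : ℝ) : IsOpen (timeSlice M t) :=
  h.opn.preimage (f := fun z : ℂ => (z, t)) (by fun_prop)

/-- On a compact subset of a time slice, nearby metrics are uniformly comparable. -/
lemma ConfRFS.eventually_comparable {T : ℝ} {M : Set (ℂ × ℝ)} {u : ℂ → ℝ → ℝ}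
    (h : ConfRFS T M u) {t : ℝ} {K : Set ℂ} (hK : IsCompact K) (hKM : K ⊆ timeSlice M t) {ε : ℝ}
    (hε : 0 < ε) : ∀ᶠ t' in 𝓝 t, ∀ p ∈ K, (p, t') ∈ M ∧ √(u p t) ≤ (1 + ε) * √(u p t') ∧
      √(u p t') ≤ (1 + ε) * √(u p t) := by
  refine hK.eventually_forall_of_forall_eventually (P := fun t' p => (p, t') ∈ M ∧
    √(u p t) ≤ (1 + ε) * √(u p t') ∧ √(u p t') ≤ (1 + ε) * √(u p t)) fun p hp => ?_
  have hpM : (p, t) ∈ M := hKM hp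
  have hu := h.pos _ hpM
  have hcont : ContinuousAt (fun q : ℂ × ℝ => √(u q.1 q.2)) (p, t) :=
    Real.continuous_sqrt.continuousAt.comp (h.smooth.continuousOn.continuousAt
      (h.opn.mem_nhds hpM))
  have t1 : Tendsto (fun z : ℝ × ℂ => (z.2, z.1)) (𝓝 (t, p)) (𝓝 (p, t)) :=
    (show Continuous fun z : ℝ × ℂ => (z.2, z.1) by fun_prop).tendsto (t, p)
  have t2 : Tendsto (fun z : ℝ × ℂ => (z.2, t)) (𝓝 (t, p)) (𝓝 (p, t)) :=
    (show Continuous fun z : ℝ × ℂ => (z.2, t) by fun_prop).tendsto (t, p)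
  have c1 := hcont.tendsto.comp t1
  have c2 := hcont.tendsto.comp t2
  have hpos : 0 < √(u p t) := Real.sqrt_pos.2 hu
  have e1 := (c2.sub (c1.const_mul (1 + ε))).eventually_lt_const
    (show √(u p t) - (1 + ε) * √(u p t) < 0 by nlinarith)
  have e2 := (c1.sub (c2.const_mul (1 + ε))).eventually_lt_const
    (show √(u p t) - (1 + ε) * √(u p t) < 0 by nlinarith)
  filter_upwards [t1.eventually (h.opn.mem_nhds hpM), e1, e2] with z h1 h2 h3
  simp only [Function.comp_apply] at h2 h3
  exact ⟨h1, by linarith, by linarith⟩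

/-- A conformal Ricci flow with a moving base point of bounded speed. -/
structure BasedFlow (T : ℝ) (M : Set (ℂ × ℝ)) (u : ℂ → ℝ → ℝ) (t₁ t₂ : ℝ) (γ : ℝ → ℂ)
    (r₀ : ℝ) : Prop where
  flow : ConfRFS T M u
  lt : t₁ < t₂
  smooth : ContDiffOn ℝ 1 γ (Icc t₁ t₂)
  mem : ∀ t ∈ Icc t₁ t₂, (γ t, t) ∈ M
  r₀_pos : 0 < r₀
  speed : ∀ t ∈ Icc t₁ t₂, √(u (γ t) t) * ‖derivWithin γ (Icc t₁ t₂) t‖ ≤ r₀⁻¹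

/-- The metric ball at time `t` around the base point. -/
def basedBall (M : Set (ℂ × ℝ)) (u : ℂ → ℝ → ℝ) (γ : ℝ → ℂ) (t r : ℝ) : Set ℂ :=
  confBall (fun z => u z t) (timeSlice M t) (γ t) r

section based

variable {T : ℝ} {M : Set (ℂ × ℝ)} {u : ℂ → ℝ → ℝ} {t₁ t₂ : ℝ} {γ : ℝ → ℂ} {r₀ : ℝ}

lemma BasedFlow.mem_basedBall_iff (H : BasedFlow T M u t₁ t₂ γ r₀) {t : ℝ} (ht : t ∈ Icc t₁ t₂)
    {r : ℝ} {z : ℂ} : z ∈ basedBall M u γ t r ↔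
      ∃ L < r, C1Joined (fun z => u z t) (timeSlice M t) (γ t) z L :=
  mem_confBall_iff (H.flow.continuousOn_slice t) (H.flow.isOpen_timeSlice t) (H.mem t ht)

lemma BasedFlow.base_joined (H : BasedFlow T M u t₁ t₂ γ r₀) {t₀ : ℝ} (ht₀ : t₀ ∈ Icc t₁ t₂)
    {ε : ℝ} (hε : 0 < ε) :
    ∃ η > 0, ∀ t ∈ Icc t₁ t₂, ∀ t' ∈ Icc t₁ t₂, |t - t₀| < η → |t' - t₀| < η →
      ∀ t'', |t'' - t₀| < η →
      ∃ L ≤ |t - t'| * ((1 + ε) / r₀),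
        C1Joined (fun z => u z t'') (timeSlice M t'') (γ t) (γ t') L := by
  have hM0 := H.mem t₀ ht₀
  have hu := H.flow.pos _ hM0
  have hcont : ContinuousAt (fun q : ℂ × ℝ => √(u q.1 q.2)) (γ t₀, t₀) :=
    Real.continuous_sqrt.continuousAt.comp (H.flow.smooth.continuousOn.continuousAt
      (H.flow.opn.mem_nhds hM0))
  have hγ : Tendsto (fun q : ℝ × ℝ => γ q.1) (𝓝[Icc t₁ t₂ ×ˢ univ] (t₀, t₀)) (𝓝 (γ t₀)) :=
    ContinuousWithinAt.comp (t := Icc t₁ t₂) (g := γ) (f := fun q : ℝ × ℝ => q.1) (x := (t₀, t₀))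
      (H.smooth.continuousOn t₀ ht₀) continuousWithinAt_fst fun q hq => hq.1
  have hf : Tendsto (fun q : ℝ × ℝ => (γ q.1, q.2)) (𝓝[Icc t₁ t₂ ×ˢ univ] (t₀, t₀))
      (𝓝 (γ t₀, t₀)) := hγ.prodMk_nhds continuousWithinAt_snd
  have hg : Tendsto (fun q : ℝ × ℝ => (γ q.1, q.1)) (𝓝[Icc t₁ t₂ ×ˢ univ] (t₀, t₀))
      (𝓝 (γ t₀, t₀)) := hγ.prodMk_nhds continuousWithinAt_fst
  have c1 := hcont.tendsto.comp hf
  have c2 := hcont.tendsto.comp hg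
  have hpos : 0 < √(u (γ t₀) t₀) := Real.sqrt_pos.2 hu
  have e1 := (c1.sub (c2.const_mul (1 + ε))).eventually_lt_const
    (show √(u (γ t₀) t₀) - (1 + ε) * √(u (γ t₀) t₀) < 0 by nlinarith)
  have e2 := (hf.eventually (H.flow.opn.mem_nhds hM0)).and e1
  obtain ⟨η, hη, hball⟩ := Metric.mem_nhdsWithin_iff.1 e2
  refine ⟨η, hη, ?_⟩
  have key : ∀ t ∈ Icc t₁ t₂, ∀ t' ∈ Icc t₁ t₂, t < t' → |t - t₀| < η → |t' - t₀| < η →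
      ∀ t'', |t'' - t₀| < η → ∃ L ≤ |t - t'| * ((1 + ε) / r₀),
        C1Joined (fun z => u z t'') (timeSlice M t'') (γ t) (γ t') L := by
    intro t ht t' ht' htt h1 h2 t'' h3
    have hsub : Icc t t' ⊆ Icc t₁ t₂ := Icc_subset_Icc ht.1 ht'.2
    have hs : ∀ s ∈ Icc t t', (γ s, t'') ∈ M ∧ √(u (γ s) t'') < (1 + ε) * √(u (γ s) s) := by
      intro s hs
      have habs : |s - t₀| < η := by
        rw [abs_lt] at h1 h2 ⊢
        exact ⟨by linarith [hs.1], by linarith [hs.2]⟩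
      have := hball (show (s, t'') ∈ _ from
        ⟨by rw [mem_ball, Prod.dist_eq]; exact max_lt habs h3, hsub hs, mem_univ _⟩)
      exact ⟨this.1, by have := this.2; simp only [Function.comp_apply] at this; linarith⟩
    have hJ := C1Joined.of_Icc (H.flow.continuousOn_slice t'') htt.le (H.smooth.mono hsub)
      fun s hs' => (hs s hs').1
    refine ⟨_, ?_, hJ⟩
    have hle : ∀ s ∈ Icc t t', √(u (γ s) t'') * ‖derivWithin γ (Icc t t') s‖ ≤ (1 + ε) / r₀ := by
      intro s hs'
      have hdw : derivWithin γ (Icc t t') s = derivWithin γ (Icc t₁ t₂) s :=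
        (((H.smooth.differentiableOn one_ne_zero s (hsub hs')).hasDerivWithinAt).mono
          hsub).derivWithin (uniqueDiffOn_Icc htt s hs')
      rw [hdw]
      calc _ ≤ (1 + ε) * √(u (γ s) s) * ‖derivWithin γ (Icc t₁ t₂) s‖ := by
            gcongr; exact (hs s hs').2.le
        _ = (1 + ε) * (√(u (γ s) s) * ‖derivWithin γ (Icc t₁ t₂) s‖) := by ring
        _ ≤ (1 + ε) * r₀⁻¹ := by gcongr; exact H.speed s (hsub hs')
        _ = _ := by rw [div_eq_mul_inv]
    have hnorm := intervalIntegral.norm_integral_le_of_norm_le_const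
      (f := fun s => √(u (γ s) t'') * ‖derivWithin γ (Icc t t') s‖) (a := t) (b := t')
      (C := (1 + ε) / r₀) fun s hs' => by
        rw [uIoc_of_le htt.le] at hs'
        rw [Real.norm_eq_abs, abs_of_nonneg (by positivity)]
        exact hle s ⟨hs'.1.le, hs'.2⟩
    rw [abs_sub_comm]
    calc _ ≤ _ := (Real.le_norm_self _).trans hnorm
      _ = _ := mul_comm _ _
  intro t ht t' ht' h1 h2 t'' h3
  rcases lt_trichotomy t t' with hlt | heq | hgt
  · exact key t ht t' ht' hlt h1 h2 t'' h3
  · subst heq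
    refine ⟨0, by simp, C1Joined.refl ?_⟩
    have := hball (show (t, t'') ∈ _ from
      ⟨by rw [mem_ball, Prod.dist_eq]; exact max_lt h1 h3, ht, mem_univ _⟩)
    exact this.1
  · obtain ⟨L, hL, hJ⟩ := key t' ht' t ht hgt h2 h1 t'' h3
    exact ⟨L, by rwa [abs_sub_comm], hJ.symm⟩

lemma BasedFlow.eventually_base_joined (H : BasedFlow T M u t₁ t₂ γ r₀) {t₀ : ℝ}
    (ht₀ : t₀ ∈ Icc t₁ t₂) {ε : ℝ} (hε : 0 < ε) :
    ∀ᶠ t in 𝓝[Icc t₁ t₂] t₀,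
      (∃ L < ε, C1Joined (fun z => u z t₀) (timeSlice M t₀) (γ t₀) (γ t) L) ∧
      ∃ L < ε, C1Joined (fun z => u z t) (timeSlice M t) (γ t) (γ t₀) L := by
  obtain ⟨η, hη, hJ⟩ := H.base_joined ht₀ one_pos
  have hr := H.r₀_pos
  have h2 : ∀ᶠ t in 𝓝[Icc t₁ t₂] t₀, |t - t₀| < min η (ε * r₀ / 2) := by
    refine mem_nhdsWithin_of_mem_nhds ?_
    exact Metric.ball_mem_nhds t₀ (by positivity)
  filter_upwards [h2, self_mem_nhdsWithin] with t ht htI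
  have hη' : |t - t₀| < η := ht.trans_le (min_le_left _ _)
  have h3 : |t - t₀| < ε * r₀ / 2 := ht.trans_le (min_le_right _ _)
  have h4 : |t - t₀| * ((1 + 1) / r₀) < ε := by
    rw [mul_div_assoc', div_lt_iff₀ hr]; linarith
  obtain ⟨L, hL, hJ1⟩ := hJ t₀ ht₀ t htI (by simpa using hη) hη' t₀ (by simpa using hη)
  obtain ⟨L', hL', hJ2⟩ := hJ t htI t₀ ht₀ hη' (by simpa using hη) t hη'
  rw [abs_sub_comm] at hL
  exact ⟨⟨L, by linarith, hJ1⟩, L', by linarith, hJ2⟩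

lemma BasedFlow.eventually_basedBall_subset (H : BasedFlow T M u t₁ t₂ γ r₀) {t₀ : ℝ}
    (ht₀ : t₀ ∈ Icc t₁ t₂) {R r ε : ℝ} (hcomp : IsCompact (closure (basedBall M u γ t₀ R)))
    (hsub : closure (basedBall M u γ t₀ R) ⊆ timeSlice M t₀) (hε : 0 < ε) (hr : 0 ≤ r)
    (hrR : r + ε ≤ R) :
    ∀ᶠ t in 𝓝[Icc t₁ t₂] t₀, basedBall M u γ t r ⊆ basedBall M u γ t₀ (r + ε) := by
  set B := basedBall M u γ t₀ R with hB
  have hBo : IsOpen B := isOpen_confBall (H.flow.continuousOn_slice t₀)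
    (H.flow.isOpen_timeSlice t₀) (H.mem t₀ ht₀)
  set e := ε / (2 * (r + 1)) with he
  have he0 : 0 < e := by positivity
  have her : r * e ≤ ε / 2 := by
    rw [he, mul_div_assoc', div_le_div_iff₀ (by positivity) two_pos]
    nlinarith
  have h1 := (H.flow.eventually_comparable hcomp hsub he0).filter_mono
    (nhdsWithin_le_nhds (s := Icc t₁ t₂))
  filter_upwards [h1, H.eventually_base_joined ht₀ (half_pos hε), self_mem_nhdsWithin]
    with t hcmp hbase htI z hz
  obtain ⟨L, hLr, c, hc, hcΩ, hc0, hc1, hcL⟩ := (H.mem_basedBall_iff htI).1 hz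
  obtain ⟨⟨L₀, hL₀, hJ₀⟩, -⟩ := hbase
  have hv₀ := H.flow.continuousOn_slice t₀
  have hspeed := H.flow.continuous_speed hc hcΩ
  have key : ∀ s₁ ∈ Icc (0 : ℝ) 1, (∀ s ∈ Icc 0 s₁, c s ∈ closure B) →
      c s₁ ∈ basedBall M u γ t₀ (r + ε) := by
    intro s₁ hs₁ hin
    have hJ := C1Joined.of_Icc hv₀ hs₁.1 hc.contDiffOn fun s hs => hsub (hin s hs)
    rw [hc0] at hJ
    refine (H.mem_basedBall_iff ht₀).2 ⟨_, ?_, hJ₀.trans hv₀ hJ⟩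
    rcases hs₁.1.eq_or_lt with h0 | h0
    · rw [← h0]
      simp only [intervalIntegral.integral_same]
      linarith
    have e1 : ∫ s in (0 : ℝ)..s₁, √(u (c s) t₀) * ‖derivWithin c (Icc 0 s₁) s‖ ≤
        ∫ s in (0 : ℝ)..s₁, (1 + e) * (√(u (c s) t) * ‖deriv c s‖) := by
      have hcongr : ∫ s in (0 : ℝ)..s₁, √(u (c s) t₀) * ‖derivWithin c (Icc 0 s₁) s‖ =
          ∫ s in (0 : ℝ)..s₁, √(u (c s) t₀) * ‖deriv c s‖ := by
        refine intervalIntegral.integral_congr fun s hs => ?_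
        rw [uIcc_of_le hs₁.1] at hs
        rw [(hc.differentiable one_ne_zero s).derivWithin (uniqueDiffOn_Icc h0 s hs)]
      rw [hcongr]
      refine intervalIntegral.integral_mono_on hs₁.1 ?_
        ((hspeed.const_mul (1 + e)).intervalIntegrable _ _) fun s hs => ?_
      · refine ContinuousOn.intervalIntegrable ?_
        rw [uIcc_of_le hs₁.1]
        exact (Real.continuous_sqrt.comp_continuousOn (hv₀.comp hc.continuous.continuousOn
          fun s hs => hsub (hin s hs))).mul (hc.continuous_deriv le_rfl).norm.continuousOn
      · rw [← mul_assoc]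
        gcongr
        exact (hcmp _ (hin s hs)).2.1
    have e2 : ∫ s in (0 : ℝ)..s₁, √(u (c s) t) * ‖deriv c s‖ ≤ L := by
      rw [← hcL]
      exact intervalIntegral.integral_mono_interval le_rfl hs₁.1 hs₁.2
        (ae_of_all _ fun s => by positivity) (hspeed.intervalIntegrable _ _)
    rw [intervalIntegral.integral_const_mul] at e1
    have e3 : (1 + e) * ∫ s in (0 : ℝ)..s₁, √(u (c s) t) * ‖deriv c s‖ ≤ (1 + e) * r := by
      gcongr; linarith
    linarith
  have hall : ∀ s ∈ Icc (0 : ℝ) 1, c s ∈ B := by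
    by_contra hcon
    push Not at hcon
    set Z := {s ∈ Icc (0 : ℝ) 1 | c s ∉ B} with hZ
    have hZc : IsClosed Z := isClosed_Icc.inter (hBo.isClosed_compl.preimage hc.continuous)
    have hZne : Z.Nonempty := hcon
    have hZb : BddBelow Z := ⟨0, fun s hs => hs.1.1⟩
    have hmem : sInf Z ∈ Z := hZc.csInf_mem hZne hZb
    set s₁ := sInf Z
    have hbefore : ∀ s ∈ Ico 0 s₁, c s ∈ B := by
      intro s hs
      by_contra hsB
      exact absurd (csInf_le hZb (show s ∈ Z from ⟨⟨hs.1, hs.2.le.trans hmem.1.2⟩, hsB⟩))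
        (not_le.2 hs.2)
    have h0B : c 0 ∈ B := by
      rw [hc0]
      exact (H.mem_basedBall_iff ht₀).2 ⟨L₀, by linarith, hJ₀⟩
    have hs₁ : 0 < s₁ := by
      refine lt_of_le_of_ne hmem.1.1 fun h => hmem.2 ?_
      rw [← h]; exact h0B
    have hcl : c s₁ ∈ closure B := by
      have : s₁ ∈ closure (Ico 0 s₁) := by
        rw [closure_Ico hs₁.ne]; exact right_mem_Icc.2 hs₁.le
      exact map_mem_closure hc.continuous this hbefore
    have := key s₁ hmem.1 fun s hs => by
      rcases hs.2.eq_or_lt with heq | hlt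
      · rw [heq]; exact hcl
      · exact subset_closure (hbefore s ⟨hs.1, hlt⟩)
    obtain ⟨L', hL', hJ'⟩ := (H.mem_basedBall_iff ht₀).1 this
    exact hmem.2 ((H.mem_basedBall_iff ht₀).2 ⟨L', by linarith, hJ'⟩)
  rw [← hc1]
  exact key 1 (right_mem_Icc.2 zero_le_one) fun s hs => subset_closure (hall s hs)

lemma BasedFlow.eventually_mem_basedBall (H : BasedFlow T M u t₁ t₂ γ r₀) {t₀ : ℝ}
    (ht₀ : t₀ ∈ Icc t₁ t₂) {r : ℝ} {z : ℂ} (hz : z ∈ basedBall M u γ t₀ r) :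
    ∀ᶠ q : ℂ × ℝ in 𝓝 z ×ˢ 𝓝[Icc t₁ t₂] t₀, q.1 ∈ basedBall M u γ q.2 r := by
  obtain ⟨L, hLr, c, hc, hcΩ, hc0, hc1, hcL⟩ := (H.mem_basedBall_iff ht₀).1 hz
  have hzS : z ∈ timeSlice M t₀ := hc1 ▸ hcΩ 1
  obtain ⟨δ, hδ, hδS⟩ := Metric.nhds_basis_closedBall.mem_iff.1
    ((H.flow.isOpen_timeSlice t₀).mem_nhds hzS)
  set K := c '' Icc 0 1 ∪ closedBall z δ with hK
  have hKc : IsCompact K := (isCompact_Icc.image hc.continuous).union (isCompact_closedBall z δ)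
  have hKS : K ⊆ timeSlice M t₀ := union_subset (image_subset_iff.2 fun s _ => hcΩ s) hδS
  have hLnn : 0 ≤ L := by
    rw [← hcL]; exact intervalIntegral.integral_nonneg zero_le_one fun _ _ => by positivity
  set d := r - L with hd
  have hd0 : 0 < d := by linarith
  set e := d / (4 * (L + 1)) with he
  have he0 : 0 < e := by positivity
  have heL : e * L ≤ d / 4 := by
    rw [he, div_mul_eq_mul_div, div_le_div_iff₀ (by positivity) (by norm_num)]
    nlinarith
  obtain ⟨C, hC⟩ := (isCompact_closedBall z δ).exists_bound_of_continuousOn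
    (Real.continuous_sqrt.comp_continuousOn ((H.flow.continuousOn_slice t₀).mono hδS))
  set E := (1 + e) * (|C| + 1) with hE
  have hE0 : 0 < E := by positivity
  have h1 := (H.flow.eventually_comparable hKc hKS he0).filter_mono
    (nhdsWithin_le_nhds (s := Icc t₁ t₂))
  have h2 := H.eventually_base_joined ht₀ (show 0 < d / 4 by positivity)
  have h3 : ∀ᶠ w in 𝓝 z, w ∈ ball z (min δ (d / (4 * E))) :=
    Metric.ball_mem_nhds z (by positivity)
  filter_upwards [h3.prod_mk ((h1.and h2).and self_mem_nhdsWithin)] with q hq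
  obtain ⟨hw, ⟨hcmp, -, L₀, hL₀, hJ₀⟩, hqI⟩ := hq
  obtain ⟨w, t⟩ := q
  simp only at hw hcmp hL₀ hJ₀ hqI ⊢
  have hwδ : dist w z < δ := (mem_ball.1 hw).trans_le (min_le_left _ _)
  have hwd : dist w z < d / (4 * E) := (mem_ball.1 hw).trans_le (min_le_right _ _)
  have hv := H.flow.continuousOn_slice t
  have hin : ∀ s ∈ Icc (0 : ℝ) 1, c s ∈ timeSlice M t := fun s hs =>
    (hcmp _ (Or.inl (mem_image_of_mem _ hs))).1
  have hJ1 := C1Joined.of_Icc hv zero_le_one hc.contDiffOn hin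
  have hseg : segment ℝ z w ⊆ closedBall z δ :=
    (convex_closedBall z δ).segment_subset (mem_closedBall_self hδ.le) hwδ.le
  obtain ⟨L₂, hL₂, hJ2⟩ := C1Joined.segment (x := z) (y := w) (B := E) hv
    (fun p hp => (hcmp p (Or.inr (hseg hp))).1) (fun p hp => by
      refine (hcmp p (Or.inr (hseg hp))).2.2.trans ?_
      have := hC p (hseg hp)
      rw [Real.norm_eq_abs] at this
      rw [hE]
      gcongr
      have h5 := (le_abs_self _).trans this
      simp only [Function.comp_apply] at h5
      linarith [le_abs_self C])
  rw [hc0, hc1] at hJ1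
  refine (H.mem_basedBall_iff hqI).2 ⟨_, ?_, (hJ₀.trans hv hJ1).trans hv hJ2⟩
  have e2 : L₂ < d / 4 := by
    refine hL₂.trans_lt ?_
    rw [lt_div_iff₀ (by positivity), dist_eq_norm] at hwd
    linarith
  have e1 : ∫ s in (0 : ℝ)..1, √(u (c s) t) * ‖derivWithin c (Icc 0 1) s‖ ≤ (1 + e) * L := by
    rw [← hcL, ← intervalIntegral.integral_const_mul]
    have hcongr : ∫ s in (0 : ℝ)..1, √(u (c s) t) * ‖derivWithin c (Icc 0 1) s‖ =
        ∫ s in (0 : ℝ)..1, √(u (c s) t) * ‖deriv c s‖ := by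
      refine intervalIntegral.integral_congr fun s hs => ?_
      rw [uIcc_of_le zero_le_one] at hs
      rw [(hc.differentiable one_ne_zero s).derivWithin (uniqueDiffOn_Icc zero_lt_one s hs)]
    rw [hcongr]
    refine intervalIntegral.integral_mono_on zero_le_one ?_
      (((H.flow.continuous_speed hc hcΩ).const_mul (1 + e)).intervalIntegrable _ _) fun s hs => ?_
    · refine ContinuousOn.intervalIntegrable ?_
      rw [uIcc_of_le zero_le_one]
      exact (Real.continuous_sqrt.comp_continuousOn (hv.comp hc.continuous.continuousOn
          fun s hs => hin s hs)).mul (hc.continuous_deriv le_rfl).norm.continuousOn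
    · rw [← mul_assoc]
      gcongr
      exact (hcmp _ (Or.inl (mem_image_of_mem _ hs))).2.2
  linarith

end based

section region

variable {T : ℝ} {M : Set (ℂ × ℝ)} {u : ℂ → ℝ → ℝ} {t₁ t₂ : ℝ} {γ : ℝ → ℂ} {r₀ : ℝ}

/-- The distance of a space-time point to the base point at the same time. -/
noncomputable def basedDist (M : Set (ℂ × ℝ)) (u : ℂ → ℝ → ℝ) (γ : ℝ → ℂ) (p : ℂ × ℝ) : ℝ :=
  confDist (fun z => u z p.2) (timeSlice M p.2) (γ p.2) p.1

/-- The space-time region where the distance to the base point plus a drift term is bounded. -/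
def controlRegion (M : Set (ℂ × ℝ)) (u : ℂ → ℝ → ℝ) (γ : ℝ → ℂ) (t₁ t₂ κ ρ : ℝ) :
    Set (ℂ × ℝ) :=
  {p | p.2 ∈ Icc t₁ t₂ ∧ p.1 ∈ connectedComponentIn (timeSlice M p.2) (γ p.2) ∧
    basedDist M u γ p + κ * (p.2 - t₁) ≤ ρ}

lemma BasedFlow.eventually_mem_center (H : BasedFlow T M u t₁ t₂ γ r₀) {t₀ : ℝ}
    (ht₀ : t₀ ∈ Icc t₁ t₂) {R r ε : ℝ} (hcomp : IsCompact (closure (basedBall M u γ t₀ R)))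
    (hsub : closure (basedBall M u γ t₀ R) ⊆ timeSlice M t₀) (hε : 0 < ε) (hr : 0 ≤ r)
    (hrR : r + ε ≤ R) {z : ℂ} (hz : z ∈ timeSlice M t₀) :
    ∀ᶠ q : ℂ × ℝ in 𝓝 z ×ˢ 𝓝[Icc t₁ t₂] t₀, q.1 ∈ basedBall M u γ q.2 r →
      z ∈ basedBall M u γ t₀ (r + 2 * ε) := by
  have h1 := H.eventually_basedBall_subset ht₀ hcomp hsub hε hr hrR
  obtain ⟨δ, hδ, B, hB, hball, hJ⟩ := exists_ball_C1Joined (H.flow.continuousOn_slice t₀)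
    (H.flow.isOpen_timeSlice t₀) hz
  have hlim : Tendsto (fun y => B * ‖z - y‖) (𝓝 z) (𝓝 (B * ‖z - z‖)) :=
    (continuous_const.mul (continuous_const.sub continuous_id).norm).tendsto z
  have h2 := hlim.eventually_lt_const (show B * ‖z - z‖ < ε by simpa using hε)
  filter_upwards [(h2.and (ball_mem_nhds z hδ)).prod_mk h1] with q ⟨⟨hq1, hq2⟩, hq3⟩ hq
  obtain ⟨L, hL, hJL⟩ := (H.mem_basedBall_iff ht₀).1 (hq3 hq)
  obtain ⟨L', hL', hJL'⟩ := hJ q.1 hq2 z (mem_ball_self hδ)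
  exact (H.mem_basedBall_iff ht₀).2
    ⟨L + L', by linarith, hJL.trans (H.flow.continuousOn_slice t₀) hJL'⟩

lemma BasedFlow.lowerSemicontinuousWithinAt_basedDist (H : BasedFlow T M u t₁ t₂ γ r₀)
    {p : ℂ × ℝ} (ht₀ : p.2 ∈ Icc t₁ t₂) {R : ℝ}
    (hp : p.1 ∈ connectedComponentIn (timeSlice M p.2) (γ p.2))
    (hcomp : IsCompact (closure (basedBall M u γ p.2 R)))
    (hsub : closure (basedBall M u γ p.2 R) ⊆ timeSlice M p.2) (hR : basedDist M u γ p ≤ R)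
    {d : ℝ} (hd : d < basedDist M u γ p) :
    ∀ᶠ q in 𝓝 p.1 ×ˢ 𝓝[Icc t₁ t₂] p.2,
      q.1 ∈ connectedComponentIn (timeSlice M q.2) (γ q.2) → d < basedDist M u γ q := by
  rcases lt_or_ge d 0 with h0 | h0
  · exact Eventually.of_forall fun q _ => h0.trans_le (confDist_nonneg _ _ _ _)
  · set ε := (basedDist M u γ p - d) / 3 with hε
    have hε0 : 0 < ε := by rw [hε]; linarith
    filter_upwards [H.eventually_mem_center ht₀ hcomp hsub hε0 (r := d + ε) (by linarith)
      (by linarith) (connectedComponentIn_subset _ _ hp)] with q hq hqc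
    by_contra! hle
    have := (hq ⟨hqc, lt_of_le_of_lt hle (by linarith)⟩).2
    change basedDist M u γ p < d + ε + 2 * ε at this
    linarith

lemma BasedFlow.isCompact_controlRegion (H : BasedFlow T M u t₁ t₂ γ r₀) {R κ ρ : ℝ}
    (hκ : 0 ≤ κ) (hρ : 0 ≤ ρ) (hρR : ρ < R)
    (hcomp : ∀ t ∈ Icc t₁ t₂, IsCompact (closure (basedBall M u γ t R)) ∧
      closure (basedBall M u γ t R) ⊆ timeSlice M t) :
    IsCompact (controlRegion M u γ t₁ t₂ κ ρ) := by
  rw [isCompact_iff_ultrafilter_le_nhds']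
  intro f hf
  have hfI : Icc t₁ t₂ ∈ f.map Prod.snd := by
    rw [Ultrafilter.mem_map]
    filter_upwards [hf] with q hq using hq.1
  obtain ⟨t, ht, hft⟩ := isCompact_Icc.ultrafilter_le_nhds' _ hfI
  have hft' : Tendsto Prod.snd (f : Filter (ℂ × ℝ)) (𝓝[Icc t₁ t₂] t) :=
    tendsto_nhdsWithin_iff.2 ⟨hft, hfI⟩
  obtain ⟨hc, hs⟩ := hcomp t ht
  set ε := (R - ρ) / 4 with hε
  have hε0 : 0 < ε := by rw [hε]; linarith
  have hsub := hft'.eventually (H.eventually_basedBall_subset ht hc hs hε0 (r := ρ + ε)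
    (by linarith) (by linarith))
  have hfz : closure (basedBall M u γ t R) ∈ f.map Prod.fst := by
    rw [Ultrafilter.mem_map]
    filter_upwards [hf, hsub] with q hq hqs
    refine subset_closure ?_
    have : q.1 ∈ basedBall M u γ t (ρ + ε + ε) := by
      refine hqs ⟨hq.2.1, ?_⟩
      have h1 := hq.2.2
      have h2 : 0 ≤ κ * (q.2 - t₁) := mul_nonneg hκ (by linarith [hq.1.1])
      change basedDist M u γ q < ρ + ε
      linarith
    exact ⟨this.1, this.2.trans_le (by linarith)⟩
  obtain ⟨z, hz, hfz'⟩ := hc.ultrafilter_le_nhds' _ hfz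
  have hz' : Tendsto Prod.fst (f : Filter (ℂ × ℝ)) (𝓝 z) := hfz'
  have hpair : Tendsto id (f : Filter (ℂ × ℝ)) (𝓝 z ×ˢ 𝓝[Icc t₁ t₂] t) := hz'.prodMk hft'
  have key : ∀ r, ρ - κ * (t - t₁) < r → r < R → z ∈ basedBall M u γ t r := by
    intro r hr hrR
    set e := (r - (ρ - κ * (t - t₁))) / 4 with he
    have he0 : 0 < e := by rw [he]; linarith
    have hlim : Tendsto (fun q : ℂ × ℝ => ρ - κ * (q.2 - t₁)) f (𝓝 (ρ - κ * (t - t₁))) :=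
      tendsto_const_nhds.sub (tendsto_const_nhds.mul
        ((hft'.mono_right nhdsWithin_le_nhds).sub tendsto_const_nhds))
    have h1 := hlim.eventually_lt_const (show ρ - κ * (t - t₁) < r - 3 * e by linarith)
    have hnn : 0 ≤ r - 3 * e := by
      obtain ⟨q, hq1, hq2⟩ := (h1.and hf).exists
      have := confDist_nonneg (fun z => u z q.2) (timeSlice M q.2) (γ q.2) q.1
      have h3 := hq2.2.2
      unfold basedDist at h3
      linarith
    have h2 := hpair.eventually (H.eventually_mem_center ht hc hs he0 (r := r - 3 * e) hnn
      (by linarith) (hs hz))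
    obtain ⟨q, hq1, hq2, hq3⟩ := (h1.and (h2.and hf)).exists
    have : z ∈ basedBall M u γ t (r - 3 * e + 2 * e) := by
      refine hq2 ⟨hq3.2.1, ?_⟩
      have h3 := hq3.2.2
      change basedDist M u γ q < _
      linarith
    exact ⟨this.1, this.2.trans_le (by linarith)⟩
  have hκt : 0 ≤ κ * (t - t₁) := mul_nonneg hκ (by linarith [ht.1])
  refine ⟨(z, t), ⟨ht, (key ((ρ + R) / 2) (by linarith) (by linarith)).1, ?_⟩, ?_⟩
  · by_contra! hlt
    have hlt' : ρ - κ * (t - t₁) < basedDist M u γ (z, t) := by linarith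
    have h1 := (key (min (basedDist M u γ (z, t)) ((ρ + R) / 2))
      (lt_min hlt' (by linarith)) ((min_le_right _ _).trans_lt (by linarith))).2
    have h2 := h1.trans_le (min_le_left _ _)
    exact lt_irrefl _ h2
  · rw [nhds_prod_eq]
    exact hpair.mono_right (Filter.prod_mono le_rfl nhdsWithin_le_nhds)

end region

/-- A decreasing cutoff function, equal to `1` on `(-∞, 7/8]` and to `0` on `[15/16, ∞)`. -/
noncomputable def cutoff (x : ℝ) : ℝ := max (1 - max (16 * x - 14) 0 ^ 2) 0 ^ 2

lemma continuous_cutoff : Continuous cutoff := by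
  unfold cutoff
  fun_prop

lemma cutoff_nonneg (x : ℝ) : 0 ≤ cutoff x := sq_nonneg _

lemma antitone_cutoff : Antitone cutoff := by
  intro x y hxy
  unfold cutoff
  gcongr

lemma cutoff_eq_one {x : ℝ} (hx : x ≤ 7 / 8) : cutoff x = 1 := by
  unfold cutoff
  rw [max_eq_right (show 16 * x - 14 ≤ 0 by linarith)]
  norm_num

lemma cutoff_le_one (x : ℝ) : cutoff x ≤ 1 := by
  rw [← cutoff_eq_one (min_le_right x (7 / 8))]
  exact antitone_cutoff (min_le_left _ _)

lemma lt_of_cutoff_pos {x : ℝ} (hx : 0 < cutoff x) : x < 15 / 16 := by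
  by_contra! h
  have h1 : (1 : ℝ) ≤ max (16 * x - 14) 0 := le_max_of_le_left (by linarith)
  have h2 : 1 - max (16 * x - 14) 0 ^ 2 ≤ 0 := by nlinarith
  unfold cutoff at hx
  rw [max_eq_right h2] at hx
  norm_num at hx

lemma inv_sq_sub_le {p r : ℝ} (hp : 0 < p) (hr : r ≤ p / 2) :
    1 / (p - r) ^ 2 ≤ 1 / p ^ 2 + 2 * r / p ^ 3 + 8 * r ^ 2 / p ^ 4 := by
  have h : 0 < p - r := by linarith
  rw [div_add_div _ _ (by positivity) (by positivity), div_add_div _ _ (by positivity)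
    (by positivity), div_le_div_iff₀ (by positivity) (by positivity)]
  have e : ((1 * p ^ 3 + p ^ 2 * (2 * r)) * p ^ 4 + p ^ 2 * p ^ 3 * (8 * r ^ 2)) * (p - r) ^ 2 -
      1 * (p ^ 2 * p ^ 3 * p ^ 4) = p ^ 5 * (r ^ 2 * ((p - 2 * r) * (5 * p - 4 * r))) := by ring
  have : 0 ≤ p ^ 5 * (r ^ 2 * ((p - 2 * r) * (5 * p - 4 * r))) := by
    have h1 : 0 ≤ p - 2 * r := by linarith
    have h2 : 0 ≤ 5 * p - 4 * r := by linarith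
    positivity
  linarith

lemma cutoff_inv_le {x₀ : ℝ} (hx₀ : 0 < cutoff x₀) :
    ∃ e₀ > 0, ∃ d ≥ 0, ∀ e, |e| < e₀ → 0 < cutoff (x₀ + e) ∧
      1 / cutoff (x₀ + e) ≤ 1 / cutoff x₀ + d * e + 8704 * (1 / cutoff x₀) ^ 2 * e ^ 2 := by
  have hx := lt_of_cutoff_pos hx₀
  set s := max (16 * x₀ - 14) 0 with hs
  have hs0 : 0 ≤ s := le_max_right _ _
  have hs1 : s < 1 := max_lt (by linarith) one_pos
  set p := 1 - s ^ 2 with hp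
  have hp0 : 0 < p := by nlinarith
  have hp1 : p ≤ 1 := by nlinarith
  have hc₀ : cutoff x₀ = p ^ 2 := by
    unfold cutoff
    rw [← hs, ← hp, max_eq_left hp0.le]
  have hlim : Tendsto (fun e : ℝ => 2 * s * (16 * e) + (16 * e) ^ 2) (𝓝 0) (𝓝 0) := by
    have : Continuous fun e : ℝ => 2 * s * (16 * e) + (16 * e) ^ 2 := by fun_prop
    simpa using this.tendsto 0
  have hlim2 : Tendsto (fun e : ℝ => |2 * s + 16 * e|) (𝓝 0) (𝓝 (2 * s)) := by
    have : Continuous fun e : ℝ => |2 * s + 16 * e| := by fun_prop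
    simpa [abs_of_nonneg hs0] using this.tendsto 0
  have hev := (hlim.eventually_lt_const (half_pos hp0)).and
    (hlim2.eventually_lt_const (show 2 * s < 2 by linarith))
  obtain ⟨e₀, he₀, hball⟩ := Metric.eventually_nhds_iff.1 hev
  refine ⟨e₀, he₀, 64 * s / p ^ 3, by positivity, fun e he => ?_⟩
  obtain ⟨h1, h2⟩ := hball (show dist e 0 < e₀ by simpa using he)
  set f := 16 * e with hf
  set r := 2 * s * f + f ^ 2 with hr
  have hpr : 0 < p - r := by linarith
  have hle : (p - r) ^ 2 ≤ cutoff (x₀ + e) := by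
    unfold cutoff
    have hmax : max (16 * (x₀ + e) - 14) 0 ^ 2 ≤ (s + f) ^ 2 := by
      rcases le_total (16 * (x₀ + e) - 14) 0 with h | h
      · rw [max_eq_right h]
        simpa using sq_nonneg (s + f)
      · rw [max_eq_left h]
        have : 16 * x₀ - 14 ≤ s := le_max_left _ _
        exact pow_le_pow_left₀ h (by linarith) 2
    refine pow_le_pow_left₀ hpr.le (le_max_of_le_left ?_) 2
    have : p - r = 1 - (s + f) ^ 2 := by rw [hp, hr]; ring
    linarith
  have hcp : 0 < cutoff (x₀ + e) := lt_of_lt_of_le (by positivity) hle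
  refine ⟨hcp, ?_⟩
  rw [hc₀]
  have i1 := one_div_le_one_div_of_le (by positivity) hle
  have i2 := inv_sq_sub_le hp0 h1.le
  have i3 : 2 * f ^ 2 / p ^ 3 ≤ 2 * f ^ 2 / p ^ 4 :=
    div_le_div_of_nonneg_left (by positivity) (by positivity)
      (pow_le_pow_of_le_one hp0.le hp1 (by norm_num))
  have i4 : r ^ 2 ≤ 4 * f ^ 2 := by
    have : r = f * (2 * s + f) := by rw [hr]; ring
    rw [this, mul_pow, mul_comm]
    have h3 : (2 * s + f) ^ 2 ≤ 2 ^ 2 := sq_le_sq' (by linarith [(abs_lt.1 h2).1])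
      (abs_lt.1 h2).2.le
    have := mul_le_mul_of_nonneg_right h3 (sq_nonneg f)
    linarith
  have i5 : 8 * r ^ 2 / p ^ 4 ≤ 8 * (4 * f ^ 2) / p ^ 4 := by gcongr
  have e1 : 2 * r / p ^ 3 = 64 * s / p ^ 3 * e + 2 * f ^ 2 / p ^ 3 := by
    rw [hr, hf]; ring
  have e2 : 8704 * (1 / p ^ 2) ^ 2 * e ^ 2 = 2 * f ^ 2 / p ^ 4 + 8 * (4 * f ^ 2) / p ^ 4 := by
    rw [hf]
    field_simp
    ring
  rw [e2]
  linarith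

section maximum

variable {T : ℝ} {M : Set (ℂ × ℝ)} {u : ℂ → ℝ → ℝ} {t₁ t₂ : ℝ} {γ : ℝ → ℂ} {r₀ : ℝ}

lemma UpperSemicontinuousOn.mul_continuousOn_of_nonneg {X : Type*} [TopologicalSpace X]
    {s : Set X} {f g : X → ℝ} (hf : UpperSemicontinuousOn f s) (hg : ContinuousOn g s)
    (hf0 : ∀ x, 0 ≤ f x) (hg0 : ∀ x ∈ s, 0 ≤ g x) :
    UpperSemicontinuousOn (fun x => f x * g x) s := by
  intro x hx y hy
  have hlim : Tendsto (fun e : ℝ => (f x + e) * (g x + e)) (𝓝[>] 0) (𝓝 (f x * g x)) := by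
    have : Continuous fun e : ℝ => (f x + e) * (g x + e) := by fun_prop
    simpa using (this.tendsto 0).mono_left nhdsWithin_le_nhds
  obtain ⟨e, he, he0⟩ := ((hlim.eventually_lt_const hy).and self_mem_nhdsWithin).exists
  have he0 : 0 < e := he0
  filter_upwards [hf x hx (f x + e) (by linarith),
    (hg x hx).eventually_lt_const (show g x < g x + e by linarith), self_mem_nhdsWithin]
    with z h1 h2 hz
  exact (mul_le_mul h1.le h2.le (hg0 z hz) ((hf0 z).trans h1.le)).trans_lt he

lemma BasedFlow.exists_max (H : BasedFlow T M u t₁ t₂ γ r₀) {R κ : ℝ}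
    (hκ : 0 ≤ κ) (hR : 0 < R)
    (hcomp : ∀ t ∈ Icc t₁ t₂, IsCompact (closure (basedBall M u γ t R)) ∧
      closure (basedBall M u γ t R) ⊆ timeSlice M t)
    {η : ℝ → ℝ} (hη : ContinuousOn η (Icc t₁ t₂)) (hη0 : ∀ t ∈ Icc t₁ t₂, 0 < η t)
    {q : ℂ × ℝ} (hq : q ∈ controlRegion M u γ t₁ t₂ κ (15 / 16 * R))
    (hq1 : cutoff ((basedDist M u γ q + κ * (q.2 - t₁)) / R) * -scalarCurv u q > η q.2) :
    ∃ m > 1, ∃ p ∈ controlRegion M u γ t₁ t₂ κ (15 / 16 * R),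
      0 < cutoff ((basedDist M u γ p + κ * (p.2 - t₁)) / R) ∧
      cutoff ((basedDist M u γ p + κ * (p.2 - t₁)) / R) * -scalarCurv u p = m * η p.2 ∧
      ∀ p' ∈ controlRegion M u γ t₁ t₂ κ (15 / 16 * R),
        cutoff ((basedDist M u γ p' + κ * (p'.2 - t₁)) / R) * -scalarCurv u p' ≤ m * η p'.2 := by
  set D := controlRegion M u γ t₁ t₂ κ (15 / 16 * R) with hD
  set X : ℂ × ℝ → ℝ := fun p => (basedDist M u γ p + κ * (p.2 - t₁)) / R with hX
  have hκnn : ∀ p ∈ D, 0 ≤ κ * (p.2 - t₁) := fun p hp => mul_nonneg hκ (by linarith [hp.1.1])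
  have hDM : D ⊆ M := fun p hp =>
    show p.1 ∈ timeSlice M p.2 from connectedComponentIn_subset _ _ hp.2.1
  have hcD : IsCompact D := H.isCompact_controlRegion hκ (by positivity) (by linarith) hcomp
  have hlsc : LowerSemicontinuousOn X D := by
    intro p hp y hy
    have hY : y * R - κ * (p.2 - t₁) < basedDist M u γ p := by
      have := (lt_div_iff₀ hR).1 hy
      linarith
    obtain ⟨d, hd1, hd2⟩ := exists_between hY
    have hle : basedDist M u γ p ≤ R := by linarith [hp.2.2, hκnn p hp]
    have h1 := H.lowerSemicontinuousWithinAt_basedDist hp.1 hp.2.1 (hcomp p.2 hp.1).1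
      (hcomp p.2 hp.1).2 hle hd2
    have hfil : 𝓝[D] p ≤ 𝓝 p.1 ×ˢ 𝓝[Icc t₁ t₂] p.2 := by
      rw [← nhdsWithin_univ p.1, ← nhdsWithin_prod_eq]
      exact nhdsWithin_mono _ fun q hq => ⟨mem_univ _, hq.1⟩
    have hlim : Tendsto (fun q : ℂ × ℝ => y * R - κ * (q.2 - t₁)) (𝓝[D] p)
        (𝓝 (y * R - κ * (p.2 - t₁))) := by
      have : Continuous fun q : ℂ × ℝ => y * R - κ * (q.2 - t₁) := by fun_prop
      exact (this.tendsto p).mono_left nhdsWithin_le_nhds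
    filter_upwards [h1.filter_mono hfil, hlim.eventually_lt_const hd1, self_mem_nhdsWithin]
      with q hq1 hq2 hq3
    have := hq1 hq3.2.1
    exact (lt_div_iff₀ hR).2 (by linarith)
  have hgc : ContinuousOn (fun p => max (-scalarCurv u p) 0 / η p.2) D := by
    refine ContinuousOn.div (((H.flow.contDiffOn_scalarCurv.continuousOn.mono hDM).neg).sup
      continuousOn_const) (hη.comp continuous_snd.continuousOn fun p hp => hp.1)
      fun p hp => (hη0 p.2 hp.1).ne'
  have husc : UpperSemicontinuousOn (fun p => cutoff (X p) * (max (-scalarCurv u p) 0 / η p.2)) D :=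
    UpperSemicontinuousOn.mul_continuousOn_of_nonneg
      (continuous_cutoff.comp_lowerSemicontinuousOn_antitone hlsc antitone_cutoff) hgc
      (fun _ => cutoff_nonneg _) fun p hp => div_nonneg (le_max_right _ _) (hη0 p.2 hp.1).le
  obtain ⟨p, hp, hmax⟩ := husc.exists_isMaxOn ⟨q, hq⟩ hcD
  have hle : ∀ p' ∈ D, cutoff (X p') * -scalarCurv u p' ≤
      cutoff (X p') * (max (-scalarCurv u p') 0 / η p'.2) * η p'.2 := by
    intro p' hp'
    rw [mul_assoc, div_mul_cancel₀ _ (hη0 p'.2 hp'.1).ne']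
    exact mul_le_mul_of_nonneg_left (le_max_left _ _) (cutoff_nonneg _)
  set m := cutoff (X p) * (max (-scalarCurv u p) 0 / η p.2) with hm
  have hm1 : 1 < m := by
    have h1 : η q.2 < m * η q.2 := (hq1.trans_le (hle q hq)).trans_le
      (mul_le_mul_of_nonneg_right (hmax hq) (hη0 q.2 hq.1).le)
    have h2 := hη0 q.2 hq.1
    by_contra! h3
    have := mul_le_mul_of_nonneg_right h3 h2.le
    linarith
  have hc0 : 0 < cutoff (X p) := by
    refine lt_of_le_of_ne (cutoff_nonneg _) fun h => ?_
    rw [hm, ← h, zero_mul] at hm1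
    linarith
  have hpos : 0 < -scalarCurv u p := by
    by_contra! h
    rw [hm, max_eq_right h] at hm1
    norm_num at hm1
  refine ⟨m, hm1, p, hp, hc0, ?_, fun p' hp' => (hle p' hp').trans
    (mul_le_mul_of_nonneg_right (hmax hp') (hη0 p'.2 hp'.1).le)⟩
  rw [hm, max_eq_left hpos.le, mul_assoc, div_mul_cancel₀ _ (hη0 p.2 hp.1).ne']

end maximum

lemma ConfRFS.C1Joined_pathLength {T : ℝ} {M : Set (ℂ × ℝ)} {u : ℂ → ℝ → ℝ} (h : ConfRFS T M u)
    {t : ℝ} {c : ℝ → ℂ} (hc : ContDiff ℝ 1 c) (hcM : ∀ s, (c s, t) ∈ M) {s : ℝ} (hs : 0 ≤ s) :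
    C1Joined (fun z => u z t) (timeSlice M t) (c 0) (c s) (pathLength u t c s) := by
  have hJ := C1Joined.of_Icc (h.continuousOn_slice t) hs hc.contDiffOn fun s _ => hcM s
  rcases hs.eq_or_lt with h0 | h0
  · subst h0
    simpa [pathLength] using hJ
  · have hcongr : ∫ σ in (0 : ℝ)..s, √(u (c σ) t) * ‖derivWithin c (Icc 0 s) σ‖ =
        pathLength u t c s := by
      refine intervalIntegral.integral_congr fun σ hσ => ?_
      rw [uIcc_of_le hs] at hσ
      rw [(hc.differentiable one_ne_zero σ).derivWithin (uniqueDiffOn_Icc h0 σ hσ)]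
    rw [← hcongr]
    exact hJ

lemma pathLength_le {T : ℝ} {M : Set (ℂ × ℝ)} {u : ℂ → ℝ → ℝ} (h : ConfRFS T M u)
    {t : ℝ} {c : ℝ → ℂ} (hc : ContDiff ℝ 1 c) (hcM : ∀ s, (c s, t) ∈ M) {s : ℝ}
    (hs : s ∈ Icc (0 : ℝ) 1) : pathLength u t c s ≤ pathLength u t c 1 :=
  intervalIntegral.integral_mono_interval le_rfl hs.1 hs.2
    (Eventually.of_forall fun _ => by positivity)
    ((h.continuous_speed hc hcM).intervalIntegrable _ _)

lemma avgFour_const_add (F : ℂ → ℝ) (c ρ : ℝ) :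
    avgFour (fun w => c + F w) ρ = c + avgFour F ρ := by
  unfold avgFour; ring

section comparison

variable {T : ℝ} {M : Set (ℂ × ℝ)} {u : ℂ → ℝ → ℝ} {t₁ t₂ : ℝ} {γ : ℝ → ℂ} {r₀ : ℝ}

lemma BasedFlow.far_comparison (H : BasedFlow T M u t₁ t₂ γ r₀) {p : ℂ × ℝ}
    (ht : p.2 ∈ Icc t₁ t₂) (ht₁ : t₁ < p.2)
    (hp : p.1 ∈ connectedComponentIn (timeSlice M p.2) (γ p.2)) {R : ℝ}
    (hcomp : IsCompact (closure (basedBall M u γ p.2 R)))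
    (hsub : closure (basedBall M u γ p.2 R) ⊆ timeSlice M p.2)
    (hcurv : ∀ z ∈ basedBall M u γ p.2 r₀, scalarCurv u (z, p.2) / 2 ≤ (r₀ ^ 2)⁻¹)
    (hfar : r₀ ≤ basedDist M u γ p) (hR : basedDist M u γ p < R) {a : ℂ}
    (ha : ‖a‖ ^ 2 * u p.1 p.2 = 1) :
    ∃ ρ₀ > 0, ∀ ρ, 0 < ρ → ρ < ρ₀ → ∃ L : ℂ → ℝ,
      (∀ w : ℂ, ‖w‖ = ρ → C1Joined (fun z => u z (p.2 - ρ ^ 2 / 4))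
        (timeSlice M (p.2 - ρ ^ 2 / 4)) (γ (p.2 - ρ ^ 2 / 4)) (p.1 + w * a) (L w) ∧
        |L w - 3 / r₀ * (ρ ^ 2 / 4) - basedDist M u γ p| ≤ 2 * ρ) ∧
      avgFour L ρ ≤ basedDist M u γ p + 3 / r₀ * (ρ ^ 2 / 4) := by
  have hr₀ := H.r₀_pos
  have hRpos : 0 < R := hr₀.trans_le (hfar.trans hR.le)
  set D := basedDist M u γ p with hD
  set ε := min (1 / (20 * r₀ * R)) (1 / (2 * R)) with hε
  have hε0 : 0 < ε := by positivity
  have hε1 : ε * R ≤ 1 / 20 / r₀ := by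
    calc ε * R ≤ 1 / (20 * r₀ * R) * R := by gcongr; exact min_le_left _ _
      _ = 1 / 20 / r₀ := by field_simp
  have hε2 : ε * R ≤ 1 / 2 := by
    calc ε * R ≤ 1 / (2 * R) * R := by gcongr; exact min_le_right _ _
      _ = 1 / 2 := by field_simp
  obtain ⟨ρ₁, hρ₁, hvar⟩ := H.flow.path_variation
    (hcomp.prod (isCompact_singleton (x := p.2))) (fun q hq => by
      have h1 := hsub hq.1
      have h2 : q.2 = p.2 := hq.2
      change (q.1, p.2) ∈ M at h1
      rwa [← h2] at h1) hr₀ hε0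
  obtain ⟨η, hη, hbase⟩ := H.base_joined ht (show (0 : ℝ) < 1 / 10 by norm_num)
  have hcont : ∀ c : ℝ, Tendsto (fun ρ : ℝ => c * ρ ^ 2) (𝓝[>] 0) (𝓝 0) := fun c => by
    have : Continuous fun ρ : ℝ => c * ρ ^ 2 := by fun_prop
    simpa using (this.tendsto 0).mono_left nhdsWithin_le_nhds
  have hcont1 : ∀ c : ℝ, Tendsto (fun ρ : ℝ => c * ρ) (𝓝[>] 0) (𝓝 0) := fun c => by
    have : Continuous fun ρ : ℝ => c * ρ := by fun_prop
    simpa using (this.tendsto 0).mono_left nhdsWithin_le_nhds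
  have hev := ((hcont (1 / 4)).eventually_lt_const hη).and
    (((hcont (1 / 4)).eventually_lt_const (sub_pos.2 ht₁)).and
    (((hcont1 1).eventually_lt_const (show 0 < 1 / 80 / r₀ by positivity)).and
    (((hcont1 (1 / r₀)).eventually_lt_const (show (0 : ℝ) < 1 / 10 by norm_num)).and
    (((hcont 1).eventually_lt_const (show (0 : ℝ) < 1 / 10 by norm_num)).and
    ((hcont1 1).eventually_lt_const (sub_pos.2 hR))))))
  obtain ⟨ρ₂, hρ₂, hsmall⟩ := (mem_nhdsGT_iff_exists_Ioo_subset.1 hev)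
  refine ⟨min ρ₁ (min ρ₂ 1), lt_min hρ₁ (lt_min hρ₂ one_pos), fun ρ hρ hρlt => ?_⟩
  have hρa : ρ < ρ₁ := hρlt.trans_le (min_le_left _ _)
  have hρb : ρ < ρ₂ := hρlt.trans_le ((min_le_right _ _).trans (min_le_left _ _))
  have hρc : ρ < 1 := hρlt.trans_le ((min_le_right _ _).trans (min_le_right _ _))
  obtain ⟨s1, s2, s3, s5, s6, s7⟩ := hsmall ⟨hρ, hρb⟩
  have hρ3 : ρ ^ 3 ≤ ρ := by
    calc ρ ^ 3 ≤ ρ ^ 1 := pow_le_pow_of_le_one hρ.le hρc.le (by norm_num)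
      _ = ρ := pow_one ρ
  obtain ⟨ℓ, hℓ, c, hc, hcΩ, hc0, hc1, hcL⟩ := exists_C1Joined_lt (H.flow.continuousOn_slice p.2)
    (H.flow.isOpen_timeSlice p.2) (H.mem p.2 ht) hp (r := D + ρ ^ 3)
    (show D < D + ρ ^ 3 by linarith [pow_pos hρ 3])
  have hL : pathLength u p.2 c 1 = ℓ := hcL
  have hcM : ∀ s, (c s, p.2) ∈ M := hcΩ
  have hDℓ : D ≤ ℓ := by
    have := (H.flow.C1Joined_pathLength hc hcM zero_le_one).confDist_le
    rw [hc0, hc1, hL] at this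
    exact this
  have hℓR : ℓ < R := by linarith
  have hinball : ∀ s ∈ Icc (0 : ℝ) 1, ∀ r, pathLength u p.2 c s < r →
      c s ∈ basedBall M u γ p.2 r := by
    intro s hs r hr
    have := H.flow.C1Joined_pathLength hc hcM hs.1
    rw [hc0] at this
    exact (H.mem_basedBall_iff ht).2 ⟨_, hr, this⟩
  obtain ⟨Lw, hLw, havg⟩ := hvar ρ hρ hρa p.2 c hc hcM
    (fun s hs => ⟨subset_closure (hinball s hs R
      ((pathLength_le H.flow hc hcM hs).trans_lt (hL ▸ hℓR))), rfl⟩)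
    (fun s hs hlt => hcurv _ (hinball s hs r₀ hlt)) (by rw [hL]; exact hfar.trans hDℓ) a
    (by rw [hc1]; exact ha)
  rw [hL] at hLw havg
  set τ := ρ ^ 2 / 4 with hτ
  have hτ0 : 0 < τ := by positivity
  have htτ : p.2 - τ ∈ Icc t₁ t₂ := ⟨by linarith, by linarith [ht.2]⟩
  obtain ⟨b, hb, hbJ⟩ := hbase (p.2 - τ) htτ p.2 ht
    (by rw [sub_sub_cancel_left, abs_neg, abs_of_pos hτ0]; linarith) (by simpa using hη)
    (p.2 - τ) (by rw [sub_sub_cancel_left, abs_neg, abs_of_pos hτ0]; linarith)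
  have hb0 : 0 ≤ b := (confDist_nonneg _ _ _ _).trans hbJ.confDist_le
  rw [sub_sub_cancel_left, abs_neg, abs_of_pos hτ0] at hb
  have hεℓ : ε * ℓ ≤ ε * R := mul_le_mul_of_nonneg_left hℓR.le hε0.le
  have hb' : b ≤ 11 / 10 * (τ * (1 / r₀)) := by
    have : τ * ((1 + 1 / 10) / r₀) = 11 / 10 * (τ * (1 / r₀)) := by ring
    linarith
  have hτr : τ * (1 / r₀) ≤ ρ / 40 := by
    have : τ * (1 / r₀) = ρ / 4 * (1 / r₀ * ρ) := by rw [hτ]; ring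
    rw [this]
    have := mul_le_mul_of_nonneg_left s5.le (show 0 ≤ ρ / 4 by positivity)
    linarith
  have h3r : 3 / r₀ * τ = 3 * (τ * (1 / r₀)) := by ring
  have hρ33 : ρ ^ 3 ≤ ρ / 10 := by
    have := mul_le_mul_of_nonneg_left s6.le hρ.le
    have e : ρ * (1 * ρ ^ 2) = ρ ^ 3 := by ring
    linarith
  refine ⟨fun w => b + Lw w, fun w hw => ⟨?_, ?_⟩, ?_⟩
  · exact hbJ.trans (H.flow.continuousOn_slice _) (by
      have := (hLw w hw).1
      rw [hc0, hc1] at this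
      exact this)
  · have h1 := (hLw w hw).2
    have h2 : ρ * (1 + ε * ℓ) ≤ ρ * (3 / 2) :=
      mul_le_mul_of_nonneg_left (by linarith) hρ.le
    rw [abs_le] at h1 ⊢
    rw [h3r]
    constructor <;> linarith [h1.1, h1.2, pow_pos hρ 3]
  · rw [avgFour_const_add, h3r]
    have h1 : τ * (9 / 5 / r₀ + ε * ℓ) ≤ τ * (9 / 5 / r₀ + 1 / 20 / r₀) := by
      gcongr
      linarith
    have e1 : τ * (9 / 5 / r₀ + 1 / 20 / r₀) = 37 / 20 * (τ * (1 / r₀)) := by ring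
    have h2 : ρ ^ 3 ≤ 1 / 20 * (τ * (1 / r₀)) := by
      have e2 : ρ ^ 3 = ρ ^ 2 * (1 * ρ) := by ring
      have e3 : 1 / 20 * (τ * (1 / r₀)) = ρ ^ 2 * (1 / 80 / r₀) := by rw [hτ]; ring
      rw [e2, e3]
      gcongr
    linarith

lemma BasedFlow.near_comparison (H : BasedFlow T M u t₁ t₂ γ r₀) {p : ℂ × ℝ}
    (ht : p.2 ∈ Icc t₁ t₂) (ht₁ : t₁ < p.2) {r : ℝ} (hp : p.1 ∈ basedBall M u γ p.2 r) (a : ℂ) :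
    ∃ ρ₀ > 0, ∀ ρ, 0 < ρ → ρ < ρ₀ → ∀ w : ℂ, ‖w‖ = ρ →
      p.1 + w * a ∈ basedBall M u γ (p.2 - ρ ^ 2 / 4) r := by
  obtain ⟨U, hU, V, hV, hUV⟩ := mem_prod_iff.1 (H.eventually_mem_basedBall ht hp)
  obtain ⟨δ, hδ, hδU⟩ := Metric.mem_nhds_iff.1 hU
  obtain ⟨δ', hδ', hδV⟩ := Metric.mem_nhdsWithin_iff.1 hV
  have hc1 : Tendsto (fun ρ : ℝ => ρ * ‖a‖) (𝓝[>] 0) (𝓝 0) := by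
    have : Continuous fun ρ : ℝ => ρ * ‖a‖ := by fun_prop
    simpa using (this.tendsto 0).mono_left nhdsWithin_le_nhds
  have hc2 : Tendsto (fun ρ : ℝ => ρ ^ 2 / 4) (𝓝[>] 0) (𝓝 0) := by
    have : Continuous fun ρ : ℝ => ρ ^ 2 / 4 := by fun_prop
    simpa using (this.tendsto 0).mono_left nhdsWithin_le_nhds
  obtain ⟨ρ₀, hρ₀, hsmall⟩ := mem_nhdsGT_iff_exists_Ioo_subset.1
    ((hc1.eventually_lt_const hδ).and ((hc2.eventually_lt_const hδ').and
      (hc2.eventually_lt_const (sub_pos.2 ht₁))))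
  refine ⟨ρ₀, hρ₀, fun ρ hρ hlt w hw => ?_⟩
  obtain ⟨h1, h2, h3⟩ := hsmall ⟨hρ, hlt⟩
  have hτ : 0 < ρ ^ 2 / 4 := by positivity
  refine hUV (a := (p.1 + w * a, p.2 - ρ ^ 2 / 4)) ⟨hδU ?_, hδV ⟨?_, ?_⟩⟩
  · simpa [mem_ball_iff_norm, hw] using h1
  · rw [mem_ball_iff_norm, sub_sub_cancel_left, norm_neg, Real.norm_of_nonneg hτ.le]
    exact h2
  · exact ⟨by linarith, by linarith [ht.2]⟩

lemma BasedFlow.comparison (H : BasedFlow T M u t₁ t₂ γ r₀) {R : ℝ} (hR : 0 < R)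
    (hRr : r₀ + 3 / r₀ * (t₂ - t₁) ≤ 7 / 8 * R) {p : ℂ × ℝ}
    (hp : p ∈ controlRegion M u γ t₁ t₂ (3 / r₀) (15 / 16 * R)) (ht₁ : t₁ < p.2)
    (hcomp : IsCompact (closure (basedBall M u γ p.2 R)))
    (hsub : closure (basedBall M u γ p.2 R) ⊆ timeSlice M p.2)
    (hcurv : ∀ z ∈ basedBall M u γ p.2 r₀, scalarCurv u (z, p.2) / 2 ≤ (r₀ ^ 2)⁻¹)
    (hcut : 0 < cutoff ((basedDist M u γ p + 3 / r₀ * (p.2 - t₁)) / R)) {a : ℂ}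
    (ha : ‖a‖ ^ 2 * u p.1 p.2 = 1) :
    ∃ ρ₀ > 0, ∀ ρ, 0 < ρ → ρ < ρ₀ → ∃ Z : ℂ → ℝ, (∀ w : ℂ, ‖w‖ = ρ →
        (p.1 + w * a, p.2 - ρ ^ 2 / 4) ∈ controlRegion M u γ t₁ t₂ (3 / r₀) (15 / 16 * R) ∧
        0 < Z w ∧ 1 ≤ cutoff ((basedDist M u γ (p.1 + w * a, p.2 - ρ ^ 2 / 4) +
          3 / r₀ * (p.2 - ρ ^ 2 / 4 - t₁)) / R) * Z w) ∧
      avgFour Z ρ ≤ 1 / cutoff ((basedDist M u γ p + 3 / r₀ * (p.2 - t₁)) / R) +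
        34816 * (1 / cutoff ((basedDist M u γ p + 3 / r₀ * (p.2 - t₁)) / R)) ^ 2 *
          (ρ ^ 2 / R ^ 2) := by
  have hr₀ := H.r₀_pos
  set κ := 3 / r₀ with hκ
  have hκ0 : 0 < κ := by positivity
  set X := (basedDist M u γ p + κ * (p.2 - t₁)) / R with hX
  set ζ := 1 / cutoff X with hζ
  have hc2 : Tendsto (fun ρ : ℝ => ρ ^ 2 / 4) (𝓝[>] 0) (𝓝 0) := by
    have : Continuous fun ρ : ℝ => ρ ^ 2 / 4 := by fun_prop
    simpa using (this.tendsto 0).mono_left nhdsWithin_le_nhds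
  obtain ⟨ρ₁, hρ₁, htime⟩ := mem_nhdsGT_iff_exists_Ioo_subset.1
    (hc2.eventually_lt_const (sub_pos.2 ht₁))
  have htI : ∀ ρ, 0 < ρ → ρ < ρ₁ → p.2 - ρ ^ 2 / 4 ∈ Icc t₁ t₂ := fun ρ hρ hlt => by
    have h1 : ρ ^ 2 / 4 < p.2 - t₁ := htime ⟨hρ, hlt⟩
    have h2 : 0 < ρ ^ 2 / 4 := by positivity
    exact ⟨by linarith, by linarith [hp.1.2]⟩
  rcases lt_or_ge (basedDist M u γ p) r₀ with hD | hD
  · obtain ⟨ρ₂, hρ₂, hnear⟩ := H.near_comparison hp.1 ht₁ (r := r₀) ⟨hp.2.1, hD⟩ a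
    refine ⟨min ρ₁ ρ₂, lt_min hρ₁ hρ₂, fun ρ hρ hlt => ⟨fun _ => 1, fun w hw => ?_, ?_⟩⟩
    · have h1 := htI ρ hρ (hlt.trans_le (min_le_left _ _))
      have h2 := hnear ρ hρ (hlt.trans_le (min_le_right _ _)) w hw
      have h3 : basedDist M u γ (p.1 + w * a, p.2 - ρ ^ 2 / 4) < r₀ := h2.2
      have h4 : κ * (p.2 - ρ ^ 2 / 4 - t₁) ≤ κ * (t₂ - t₁) :=
        mul_le_mul_of_nonneg_left (by linarith [h1.2]) hκ0.le
      refine ⟨⟨h1, h2.1, ?_⟩, one_pos, ?_⟩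
      · change basedDist M u γ (p.1 + w * a, p.2 - ρ ^ 2 / 4) + κ * (p.2 - ρ ^ 2 / 4 - t₁) ≤ _
        linarith
      · rw [cutoff_eq_one, one_mul]
        exact (div_le_iff₀ hR).2 (by linarith)
    · have h1 : 1 ≤ ζ := (one_le_div hcut).2 (cutoff_le_one _)
      have h2 : 0 ≤ 34816 * ζ ^ 2 * (ρ ^ 2 / R ^ 2) := by positivity
      have h3 : avgFour (fun _ => 1) ρ = 1 := by unfold avgFour; norm_num
      linarith
  · have hκt : 0 ≤ κ * (p.2 - t₁) := mul_nonneg hκ0.le (by linarith)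
    obtain ⟨e₀, he₀, d, hd, hcutoff⟩ := cutoff_inv_le hcut
    obtain ⟨ρ₂, hρ₂, hfar⟩ := H.far_comparison hp.1 ht₁ hp.2.1 hcomp hsub hcurv hD
      (by linarith [hp.2.2]) ha
    refine ⟨min ρ₁ (min ρ₂ (e₀ * R / 2)), lt_min hρ₁ (lt_min hρ₂ (by positivity)),
      fun ρ hρ hlt => ?_⟩
    have hta := htI ρ hρ (hlt.trans_le (min_le_left _ _))
    have hρe : ρ < e₀ * R / 2 := hlt.trans_le ((min_le_right _ _).trans (min_le_right _ _))
    obtain ⟨L, hL, havg⟩ := hfar ρ hρ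
      (hlt.trans_le ((min_le_right _ _).trans (min_le_left _ _)))
    set e : ℂ → ℝ := fun w => (L w - κ * (ρ ^ 2 / 4) - basedDist M u γ p) / R with he
    have heabs : ∀ w : ℂ, ‖w‖ = ρ → |e w| ≤ 2 * ρ / R := fun w hw => by
      rw [he]
      simp only
      rw [abs_div, abs_of_pos hR]
      gcongr
      exact (hL w hw).2
    have hlt₀ : 2 * ρ / R < e₀ := (div_lt_iff₀ hR).2 (by linarith)
    refine ⟨fun w => 1 / cutoff (X + e w), fun w hw => ?_, ?_⟩
    · obtain ⟨hpos, -⟩ := hcutoff (e w) ((heabs w hw).trans_lt hlt₀)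
      have hJ := (hL w hw).1
      have hdist : basedDist M u γ (p.1 + w * a, p.2 - ρ ^ 2 / 4) ≤ L w := hJ.confDist_le
      have hXe : (basedDist M u γ (p.1 + w * a, p.2 - ρ ^ 2 / 4) +
          κ * (p.2 - ρ ^ 2 / 4 - t₁)) / R ≤ X + e w := by
        rw [hX, he]
        simp only
        rw [← add_div]
        exact div_le_div_of_nonneg_right (by linarith) hR.le
      have hcle := antitone_cutoff hXe
      have hlt15 := lt_of_cutoff_pos (hpos.trans_le hcle)
      refine ⟨⟨hta, hJ.mem_component, ((div_lt_iff₀ hR).1 hlt15).le⟩, by positivity, ?_⟩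
      rw [mul_one_div]
      exact (one_le_div hpos).2 hcle
    · have hmono : avgFour (fun w => 1 / cutoff (X + e w)) ρ ≤
          avgFour (fun w => (ζ + 34816 * ζ ^ 2 * (ρ ^ 2 / R ^ 2)) + d * e w) ρ := by
        refine avgFour_mono hρ fun w hw => ?_
        obtain ⟨-, h1⟩ := hcutoff (e w) ((heabs w hw).trans_lt hlt₀)
        have h2 : e w ^ 2 ≤ (2 * ρ / R) ^ 2 := by
          rw [← sq_abs (e w)]
          exact pow_le_pow_left₀ (abs_nonneg _) (heabs w hw) 2
        have h3 : 8704 * ζ ^ 2 * e w ^ 2 ≤ 8704 * ζ ^ 2 * (2 * ρ / R) ^ 2 := by gcongr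
        have h4 : 8704 * ζ ^ 2 * (2 * ρ / R) ^ 2 = 34816 * ζ ^ 2 * (ρ ^ 2 / R ^ 2) := by
          rw [div_pow]; ring
        linarith
      have havge : avgFour (fun w => d * e w) ρ =
          d * ((avgFour L ρ - κ * (ρ ^ 2 / 4) - basedDist M u γ p) / R) := by
        rw [he]
        unfold avgFour
        ring
      have hneg : d * ((avgFour L ρ - κ * (ρ ^ 2 / 4) - basedDist M u γ p) / R) ≤ 0 :=
        mul_nonpos_of_nonneg_of_nonpos hd (div_nonpos_of_nonpos_of_nonneg (by linarith) hR.le)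
      rw [avgFour_const_add, havge] at hmono
      linarith

end comparison

/-- The solution of `η' = -(1 - δ) η ^ 2` with `η t₁ = K`, truncated from below at `c`. -/
noncomputable def barrier (δ K c t₁ t : ℝ) : ℝ := max (1 / ((1 - δ) * (t - t₁) + 1 / K)) c

lemma barrier_base_pos {δ K t₁ t : ℝ} (hδ : δ < 1) (hK : 0 < K) (ht : t₁ ≤ t) :
    0 < (1 - δ) * (t - t₁) + 1 / K := by
  have : 0 ≤ (1 - δ) * (t - t₁) := mul_nonneg (by linarith) (by linarith)
  positivity

lemma barrier_pos {δ K c t₁ t : ℝ} (hδ : δ < 1) (hK : 0 < K) (ht : t₁ ≤ t) :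
    0 < barrier δ K c t₁ t :=
  lt_max_of_lt_left (one_div_pos.2 (barrier_base_pos hδ hK ht))

lemma continuousOn_barrier {δ K c t₁ t₂ : ℝ} (hδ : δ < 1) (hK : 0 < K) :
    ContinuousOn (barrier δ K c t₁) (Icc t₁ t₂) := by
  refine ContinuousOn.sup (continuousOn_const.div (by fun_prop) fun t ht => ?_) continuousOn_const
  exact (barrier_base_pos hδ hK ht.1).ne'

lemma barrier_sub_le {δ K c t₁ t τ : ℝ} (hδ0 : 0 < δ) (hδ : δ < 1) (hK : 0 < K) (hτ : 0 ≤ τ)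
    (ht : t₁ ≤ t - τ) (hsmall : barrier δ K c t₁ t * τ ≤ 1 / 2) :
    barrier δ K c t₁ (t - τ) ≤ barrier δ K c t₁ t +
      (1 - δ) * barrier δ K c t₁ t ^ 2 * τ + 2 * barrier δ K c t₁ t ^ 3 * τ ^ 2 := by
  set η := barrier δ K c t₁ t with hη
  have hη0 : 0 < η := barrier_pos hδ hK (by linarith)
  set b := (1 - δ) * (t - t₁) + 1 / K with hb
  have hb0 : 0 < b := barrier_base_pos hδ hK (by linarith)
  have hbη : 1 / b ≤ η := le_max_left _ _
  set s := (1 - δ) * (1 / b) * τ with hs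
  have hs0 : 0 ≤ s := by
    have : 0 ≤ 1 - δ := by linarith
    positivity
  have hδ1 : (1 - δ) * (1 / b) ≤ η := by
    calc (1 - δ) * (1 / b) ≤ 1 * (1 / b) := by gcongr; linarith
      _ ≤ η := by linarith
  have hsη : s ≤ η * τ := mul_le_mul_of_nonneg_right hδ1 hτ
  have hs2 : s ≤ 1 / 2 := hsη.trans hsmall
  refine max_le ?_ ?_
  · have hbs : b * s = (1 - δ) * τ := by
      rw [hs]
      field_simp
    have e1 : (1 - δ) * (t - τ - t₁) + 1 / K = b * (1 - s) := by
      rw [mul_one_sub, hbs, hb]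
      ring
    rw [e1, ← one_div_mul_one_div]
    have h1 : 1 / (1 - s) ≤ 1 + s + 2 * s ^ 2 := by
      rw [div_le_iff₀ (by linarith)]
      have : 0 ≤ s ^ 2 * (1 - 2 * s) := mul_nonneg (sq_nonneg s) (by linarith)
      linarith [show (1 + s + 2 * s ^ 2) * (1 - s) = 1 + s ^ 2 * (1 - 2 * s) by ring]
    have hδ' : 0 ≤ 1 - δ := by linarith
    calc 1 / b * (1 / (1 - s)) ≤ 1 / b * (1 + s + 2 * s ^ 2) := by gcongr
      _ = 1 / b + (1 - δ) * (1 / b) ^ 2 * τ + 2 * (1 / b) * ((1 - δ) * (1 / b)) ^ 2 * τ ^ 2 := by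
        rw [hs]; ring
      _ ≤ η + (1 - δ) * η ^ 2 * τ + 2 * η * η ^ 2 * τ ^ 2 := by gcongr
      _ = η + (1 - δ) * η ^ 2 * τ + 2 * η ^ 3 * τ ^ 2 := by ring
  · have h1 : c ≤ η := le_max_right _ _
    have h2 : 0 ≤ (1 - δ) * η ^ 2 * τ := mul_nonneg (mul_nonneg (by linarith) (by positivity)) hτ
    have h3 : 0 ≤ 2 * η ^ 3 * τ ^ 2 := by positivity
    linarith

/-- The differential inequality at a minimum is violated, in finite difference form. -/
lemma exists_reaction_dominates {η ζ m δ g : ℝ} (hη : 0 < η) (hζ : 1 ≤ ζ) (hm : 1 < m)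
    (hδ : δ < 1) (hg : 0 ≤ g) (hgδ : g ≤ δ * η) :
    ∃ ε > 0, ∃ τ₀ > 0, ∀ τ, 0 < τ → τ < τ₀ →
      m * (η + (1 - δ) * η ^ 2 * τ + 2 * η ^ 3 * τ ^ 2) * (ζ + g * ζ ^ 2 * τ) <
        m * η * ζ + τ * (m * η * ζ) ^ 2 - ε * τ := by
  have hζ0 : 0 < ζ := by linarith
  have hm0 : 0 < m := by linarith
  have hδ' : 0 ≤ 1 - δ := by linarith
  set N := m * (m - 1) * (η * ζ) ^ 2 with hN
  have hN0 : 0 < N := by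
    have : 0 < m - 1 := by linarith
    positivity
  set W := m * ((1 - δ) * η ^ 2 * (g * ζ ^ 2) + 2 * η ^ 3 * ζ + 2 * η ^ 3 * (g * ζ ^ 2)) with hW
  have hW0 : 0 ≤ W := by positivity
  refine ⟨N / 2, by positivity, min 1 (N / (2 * (W + 1))), lt_min one_pos (by positivity),
    fun τ hτ hlt => ?_⟩
  have hτ1 : τ < 1 := hlt.trans_le (min_le_left _ _)
  have hτ2 : τ * (2 * (W + 1)) < N :=
    (lt_div_iff₀ (by positivity)).1 (hlt.trans_le (min_le_right _ _))
  have i1 : (1 - δ) * η ^ 2 * ζ ≤ (1 - δ) * η ^ 2 * ζ ^ 2 := by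
    gcongr
    exact le_self_pow₀ hζ two_ne_zero
  have i2 : η * (g * ζ ^ 2) ≤ δ * η ^ 2 * ζ ^ 2 := by
    have := mul_le_mul_of_nonneg_left hgδ (show 0 ≤ η * ζ ^ 2 by positivity)
    linarith [show η * ζ ^ 2 * (δ * η) = δ * η ^ 2 * ζ ^ 2 by ring,
      show η * ζ ^ 2 * g = η * (g * ζ ^ 2) by ring]
  have i3 : τ ^ 3 * (m * (2 * η ^ 3 * (g * ζ ^ 2))) ≤ τ ^ 2 * (m * (2 * η ^ 3 * (g * ζ ^ 2))) :=
    mul_le_mul_of_nonneg_right (pow_le_pow_of_le_one hτ.le hτ1.le (by norm_num)) (by positivity)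
  have i4 : τ * m * ((1 - δ) * η ^ 2 * ζ + η * (g * ζ ^ 2)) ≤ τ * m * (η ^ 2 * ζ ^ 2) :=
    mul_le_mul_of_nonneg_left (by linarith) (by positivity)
  have i5 : τ * (τ * W) < τ * (N / 2) := mul_lt_mul_of_pos_left (by linarith) hτ
  have e : m * (η + (1 - δ) * η ^ 2 * τ + 2 * η ^ 3 * τ ^ 2) * (ζ + g * ζ ^ 2 * τ) =
      m * η * ζ + τ * m * ((1 - δ) * η ^ 2 * ζ + η * (g * ζ ^ 2)) +
        τ ^ 2 * (m * ((1 - δ) * η ^ 2 * (g * ζ ^ 2) + 2 * η ^ 3 * ζ)) +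
        τ ^ 3 * (m * (2 * η ^ 3 * (g * ζ ^ 2))) := by ring
  have e2 : τ ^ 2 * (m * ((1 - δ) * η ^ 2 * (g * ζ ^ 2) + 2 * η ^ 3 * ζ)) +
      τ ^ 2 * (m * (2 * η ^ 3 * (g * ζ ^ 2))) = τ * (τ * W) := by rw [hW]; ring
  have e3 : τ * m * (η ^ 2 * ζ ^ 2) + τ * N = τ * (m * η * ζ) ^ 2 := by rw [hN]; ring
  linarith

section bound

variable {T : ℝ} {M : Set (ℂ × ℝ)} {u : ℂ → ℝ → ℝ} {t₁ t₂ : ℝ} {γ : ℝ → ℂ} {r₀ : ℝ}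

lemma BasedFlow.cutoff_mul_neg_scalarCurv_le (H : BasedFlow T M u t₁ t₂ γ r₀) {R : ℝ} (hR : 0 < R)
    (hRr : r₀ + 3 / r₀ * (t₂ - t₁) ≤ 7 / 8 * R)
    (hcomp : ∀ t ∈ Icc t₁ t₂, IsCompact (closure (basedBall M u γ t R)) ∧
      closure (basedBall M u γ t R) ⊆ timeSlice M t)
    (hcurv : ∀ t ∈ Icc t₁ t₂, ∀ z ∈ basedBall M u γ t r₀,
      scalarCurv u (z, t) / 2 ≤ (r₀ ^ 2)⁻¹) {δ K c : ℝ} (hδ0 : 0 < δ) (hδ : δ < 1) (hK : 0 < K)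
    (hinit : ∀ z ∈ basedBall M u γ t₁ R, -K ≤ scalarCurv u (z, t₁))
    (hc : 139264 / R ^ 2 ≤ δ * c) {q : ℂ × ℝ}
    (hq : q ∈ controlRegion M u γ t₁ t₂ (3 / r₀) (15 / 16 * R)) :
    cutoff ((basedDist M u γ q + 3 / r₀ * (q.2 - t₁)) / R) * -scalarCurv u q ≤
      barrier δ K c t₁ q.2 := by
  have hr₀ := H.r₀_pos
  by_contra! hcon
  obtain ⟨m, hm, p, hp, hcut, heq, hmax⟩ := H.exists_max (show 0 ≤ 3 / r₀ by positivity) hR hcomp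
    (continuousOn_barrier (c := c) hδ hK) (fun t ht => barrier_pos hδ hK ht.1) hq hcon
  set κ := 3 / r₀ with hκ
  set X := (basedDist M u γ p + κ * (p.2 - t₁)) / R with hX
  set η := barrier δ K c t₁ p.2 with hη
  have hη0 : 0 < η := barrier_pos hδ hK hp.1.1
  have hκt : 0 ≤ κ * (p.2 - t₁) := mul_nonneg (by positivity) (by linarith [hp.1.1])
  have ht₁ : t₁ < p.2 := by
    refine lt_of_le_of_ne hp.1.1 fun h => ?_
    have h1 : -K ≤ scalarCurv u p := by
      have h2 := hp.2.1
      have h3 : basedDist M u γ p < R := by linarith [hp.2.2]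
      have := hinit p.1 (by rw [h]; exact ⟨h2, h3⟩)
      rwa [h] at this
    have h2 : K ≤ η := by
      rw [hη, ← h]
      refine le_max_of_le_left ?_
      simp
    have h3 : cutoff X * -scalarCurv u p ≤ K := by
      calc cutoff X * -scalarCurv u p ≤ cutoff X * K :=
            mul_le_mul_of_nonneg_left (by linarith) hcut.le
        _ ≤ 1 * K := mul_le_mul_of_nonneg_right (cutoff_le_one _) hK.le
        _ = K := one_mul K
    have h4 : 1 * η < m * η := mul_lt_mul_of_pos_right hm hη0
    linarith
  have hpM : p ∈ M := show p.1 ∈ timeSlice M p.2 from connectedComponentIn_subset _ _ hp.2.1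
  have hu : 0 < u p.1 p.2 := H.flow.pos p hpM
  set a : ℂ := (((√(u p.1 p.2))⁻¹ : ℝ) : ℂ) with ha
  have ha1 : ‖a‖ ^ 2 * u p.1 p.2 = 1 := by
    rw [ha, Complex.norm_real, Real.norm_of_nonneg (by positivity), inv_pow, Real.sq_sqrt hu.le]
    exact inv_mul_cancel₀ hu.ne'
  set ζ := 1 / cutoff X with hζ
  have hζ1 : 1 ≤ ζ := (one_le_div hcut).2 (cutoff_le_one _)
  have hS : scalarCurv u p = -(m * η * ζ) := by
    rw [hζ, mul_one_div, ← heq, mul_div_cancel_left₀ _ hcut.ne', neg_neg]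
  have hcη : c ≤ η := le_max_right _ _
  have hg : 139264 / R ^ 2 ≤ δ * η := hc.trans (mul_le_mul_of_nonneg_left hcη hδ0.le)
  obtain ⟨ε, hε, τ₀, hτ₀, hreact⟩ := exists_reaction_dominates hη0 hζ1 hm hδ
    (show 0 ≤ 139264 / R ^ 2 by positivity) hg
  obtain ⟨ρ₁, hρ₁, hcmp⟩ := H.comparison hR hRr hp ht₁ (hcomp _ hp.1).1 (hcomp _ hp.1).2
    (hcurv _ hp.1) hcut ha1
  obtain ⟨ρ₂, hρ₂, hevol⟩ := H.flow.avgFour_scalarCurv hpM ha1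
    (show 0 < ε / 4 by positivity)
  have hc2 : Tendsto (fun ρ : ℝ => ρ ^ 2 / 4) (𝓝[>] 0) (𝓝 0) := by
    have : Continuous fun ρ : ℝ => ρ ^ 2 / 4 := by fun_prop
    simpa using (this.tendsto 0).mono_left nhdsWithin_le_nhds
  have hsmall : ∀ {b : ℝ}, 0 < b → ∀ᶠ ρ : ℝ in 𝓝[>] 0, ρ < b := fun hb =>
    nhdsWithin_le_nhds (Iio_mem_nhds hb)
  obtain ⟨ρ, ⟨hρa, hρb⟩, hρc, hρd, hρ⟩ := (((hsmall hρ₁).and (hsmall hρ₂)).and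
    ((hc2.eventually_lt_const hτ₀).and ((hc2.eventually_lt_const
      (show 0 < 1 / (2 * η) by positivity)).and self_mem_nhdsWithin))).exists
  have hρ : 0 < ρ := hρ
  obtain ⟨Z, hZ, hZavg⟩ := hcmp ρ hρ hρa
  have hev := hevol ρ hρ hρb
  set τ := ρ ^ 2 / 4 with hτ
  have hτ0 : 0 < τ := by positivity
  have hre := hreact τ hτ0 hρc
  have htime : t₁ ≤ p.2 - τ := (hZ ρ (by simp [hρ.le])).1.1.1
  have hbar := barrier_sub_le (c := c) (t := p.2) hδ0 hδ hK hτ0.le htime (by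
    have h1 : η * τ < η * (1 / (2 * η)) := mul_lt_mul_of_pos_left hρd hη0
    have h2 : η * (1 / (2 * η)) = 1 / 2 := by field_simp
    exact (h1.trans_eq h2).le)
  rw [← hη] at hbar
  set η' := barrier δ K c t₁ (p.2 - τ) with hη'
  have hη'0 : 0 < η' := barrier_pos hδ hK htime
  have hlow : avgFour (fun w => -(m * η') * Z w) ρ ≤
      avgFour (fun w => scalarCurv u (p.1 + w * a, p.2 - τ)) ρ := by
    refine avgFour_mono hρ fun w hw => ?_
    obtain ⟨hmem, hZ0, hZ1⟩ := hZ w hw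
    have h1 := hmax _ hmem
    simp only at h1
    set S := scalarCurv u (p.1 + w * a, p.2 - τ) with hSw
    have hmη : 0 < m * η' := by positivity
    rcases le_total 0 S with h0 | h0
    · have : 0 ≤ m * η' * Z w := by positivity
      linarith
    · have h2 := mul_le_mul_of_nonneg_right h1 hZ0.le
      have h3 := mul_le_mul_of_nonneg_left hZ1 (neg_nonneg.2 h0)
      linarith
  have hlow' : avgFour (fun w => -(m * η') * Z w) ρ = -(m * η') * avgFour Z ρ := by
    unfold avgFour; ring
  have eZ : 34816 * ζ ^ 2 * (ρ ^ 2 / R ^ 2) = 139264 / R ^ 2 * ζ ^ 2 * τ := by rw [hτ]; ring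
  rw [eZ] at hZavg
  set B := ζ + 139264 / R ^ 2 * ζ ^ 2 * τ with hB
  have hB0 : 0 < B := by positivity
  have hZB : m * η' * avgFour Z ρ ≤ m * (η + (1 - δ) * η ^ 2 * τ + 2 * η ^ 3 * τ ^ 2) * B := by
    calc m * η' * avgFour Z ρ ≤ m * η' * B := mul_le_mul_of_nonneg_left hZavg (by positivity)
      _ ≤ _ := by gcongr
  rw [hS] at hev
  have e1 : τ * (-(m * η * ζ)) ^ 2 = τ * (m * η * ζ) ^ 2 := by ring
  have e2 : ε / 4 * ρ ^ 2 = ε * τ := by rw [hτ]; ring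
  linarith

lemma BasedFlow.scalarCurv_lower_bound (H : BasedFlow T M u t₁ t₂ γ r₀) {R : ℝ} (hR : 0 < R)
    (hRr : r₀ + 3 / r₀ * (t₂ - t₁) ≤ 7 / 8 * R) (hRt : 3 / r₀ * (t₂ - t₁) ≤ R / 8)
    (hcomp : ∀ t ∈ Icc t₁ t₂, IsCompact (closure (basedBall M u γ t R)) ∧
      closure (basedBall M u γ t R) ⊆ timeSlice M t)
    (hcurv : ∀ t ∈ Icc t₁ t₂, ∀ z ∈ basedBall M u γ t r₀,
      scalarCurv u (z, t) / 2 ≤ (r₀ ^ 2)⁻¹) {δ K c : ℝ} (hδ0 : 0 < δ) (hδ : δ < 1) (hK : 0 < K)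
    (hinit : ∀ z ∈ basedBall M u γ t₁ R, -K ≤ scalarCurv u (z, t₁))
    (hc : 139264 / R ^ 2 ≤ δ * c) {t : ℝ} (ht : t ∈ Icc t₁ t₂) {z : ℂ}
    (hz : z ∈ basedBall M u γ t (3 / 4 * R)) :
    -barrier δ K c t₁ t ≤ scalarCurv u (z, t) := by
  have hr₀ := H.r₀_pos
  have h1 : basedDist M u γ (z, t) < 3 / 4 * R := hz.2
  have h2 : 3 / r₀ * (t - t₁) ≤ 3 / r₀ * (t₂ - t₁) :=
    mul_le_mul_of_nonneg_left (by linarith [ht.2]) (by positivity)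
  have h3 := H.cutoff_mul_neg_scalarCurv_le hR hRr hcomp hcurv hδ0 hδ hK hinit hc (q := (z, t))
    ⟨ht, hz.1, by change basedDist M u γ (z, t) + 3 / r₀ * (t - t₁) ≤ _; linarith⟩
  rw [cutoff_eq_one ((div_le_iff₀ hR).2 (by
    change basedDist M u γ (z, t) + 3 / r₀ * (t - t₁) ≤ _; linarith)), one_mul] at h3
  linarith

end bound
/-- Chen's scalar curvature lower bound, 2-dimensional conformal version, for
conformal Ricci flow spacetimes in `ℂ × (0,T)` along a moving basepoint. -/
theorem chen_scalar_curvature_lower_bound :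
    ∀ δ ∈ Ioo (0:ℝ) 1, ∃ C : ℝ, 0 < C ∧
      ∀ (T : ℝ) (M : Set (ℂ × ℝ)) (u : ℂ → ℝ → ℝ), 0 < T → ConfRFS T M u →
      ∀ t₁ t₂ : ℝ, t₁ ≤ t₂ → Icc t₁ t₂ ⊆ Ioo 0 T →
      ∀ γ : ℝ → ℂ, ContDiffOn ℝ 1 γ (Icc t₁ t₂) →
        (∀ t ∈ Icc t₁ t₂, (γ t, t) ∈ M) →
      ∀ r₀ K A : ℝ, 0 < r₀ → 0 < K → 2 + 24 * (r₀ ^ 2)⁻¹ * t₂ ≤ A →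
      -- (i) the balls `B_{g(t)}(γ(t), A r₀)` have compact closure contained in `M_t`
      (∀ t ∈ Icc t₁ t₂,
        IsCompact (closure (confBall (fun z => u z t) (timeSlice M t) (γ t) (A * r₀))) ∧
        closure (confBall (fun z => u z t) (timeSlice M t) (γ t) (A * r₀)) ⊆ timeSlice M t) →
      -- (ii) Gaussian curvature `≤ r₀⁻²` on `B_{g(t)}(γ(t), r₀)`
      (∀ t ∈ Icc t₁ t₂, ∀ z ∈ confBall (fun w => u w t) (timeSlice M t) (γ t) r₀,
        -(lap (fun w => Real.log (u w t)) z) / (2 * u z t) ≤ (r₀ ^ 2)⁻¹) →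
      -- (iii) scalar curvature `≥ −K` on `B_{g(t₁)}(γ(t₁), A r₀)`
      (∀ z ∈ confBall (fun w => u w t₁) (timeSlice M t₁) (γ t₁) (A * r₀),
        -K ≤ -(lap (fun w => Real.log (u w t₁)) z) / u z t₁) →
      -- (iv) the basepoint moves with `g(t)`-speed at most `r₀⁻¹`
      (∀ t ∈ Icc t₁ t₂,
        Real.sqrt (u (γ t) t) * ‖derivWithin γ (Icc t₁ t₂) t‖ ≤ r₀⁻¹) →
      ∀ t ∈ Icc t₁ t₂, ∀ z ∈ confBall (fun w => u w t) (timeSlice M t) (γ t) (3 * A * r₀ / 4),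
        min (-(1 / ((1 - δ) * (t - t₁) + 1 / K))) (-(C / (A ^ 2 * r₀ ^ 2)))
          ≤ -(lap (fun w => Real.log (u w t)) z) / u z t := by
 
  intro δ hδ
  refine ⟨139264 / δ, div_pos (by norm_num) hδ.1, ?_⟩
  intro T M u hT hflow t₁ t₂ ht12 hsub γ hγ hmem r₀ K A hr₀ hK hA hcomp hcurv hinit hspeed t ht z hz
  have hslice : ∀ s r w, w ∈ confBall (fun z => u z s) (timeSlice M s) (γ s) r → (w, s) ∈ M :=
    fun s r w hw => show w ∈ timeSlice M s from connectedComponentIn_subset _ _ hw.1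
  have hcurv' : ∀ p ∈ M, -(lap (fun w => Real.log (u w p.2)) p.1) / u p.1 p.2 = scalarCurv u p :=
    fun p hp => hflow.scalarCurv_eq hp
  have ht₁ : 0 < t₁ := (hsub ⟨le_rfl, ht12⟩).1
  have hA' : (A - 2) * r₀ ^ 2 ≥ 24 * t₂ := by
    have h1 : 24 * (r₀ ^ 2)⁻¹ * t₂ * r₀ ^ 2 ≤ (A - 2) * r₀ ^ 2 :=
      mul_le_mul_of_nonneg_right (by linarith) (sq_nonneg r₀)
    have h2 : 24 * (r₀ ^ 2)⁻¹ * t₂ * r₀ ^ 2 = 24 * t₂ := by field_simp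
    linarith
  have hA2 : 2 ≤ A := by
    have : 0 ≤ 24 * (r₀ ^ 2)⁻¹ * t₂ := by have := ht₁.trans_le ht12; positivity
    linarith
  have hR : 0 < A * r₀ := by positivity
  have hzM := hslice t _ z hz
  rw [hcurv' (z, t) hzM]
  rcases ht12.eq_or_lt with rfl | hlt
  · obtain rfl : t = t₁ := le_antisymm ht.2 ht.1
    have h1 : -K ≤ -(lap (fun w => Real.log (u w t)) z) / u z t :=
      hinit z ⟨hz.1, hz.2.trans_le (by linarith)⟩
    rw [hcurv' (z, t) hzM] at h1
    refine (min_le_left _ _).trans ?_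
    simpa using h1
  have hdrift : 3 / r₀ * (t₂ - t₁) ≤ (A - 2) * r₀ / 8 := by
    rw [div_mul_eq_mul_div, div_le_iff₀ hr₀]
    linarith [show (A - 2) * r₀ / 8 * r₀ = (A - 2) * r₀ ^ 2 / 8 by ring]
  have h2r : 2 * r₀ ≤ A * r₀ := mul_le_mul_of_nonneg_right hA2 hr₀.le
  have H : BasedFlow T M u t₁ t₂ γ r₀ := ⟨hflow, hlt, hγ, hmem, hr₀, hspeed⟩
  have hbound := H.scalarCurv_lower_bound (R := A * r₀) (δ := δ) (K := K)
    (c := 139264 / δ / (A ^ 2 * r₀ ^ 2)) hR (by linarith) (by linarith) hcomp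
    (fun s hs w hw => by
      rw [← hcurv' (w, s) (hslice s _ w hw), div_div, mul_comm (u w s)]
      exact hcurv s hs w hw)
    hδ.1 hδ.2 hK
    (fun w hw => by
      rw [← hcurv' (w, t₁) (hslice t₁ _ w hw)]
      exact hinit w hw)
    (by
      have hδ0 := hδ.1
      refine le_of_eq ?_
      field_simp) ht
    (z := z) (by
      rw [← show 3 * A * r₀ / 4 = 3 / 4 * (A * r₀) by ring]
      exact hz)
  rwa [barrier, ← min_neg_neg] at hbound
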